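/- arXiv:2309.10262 — 12 statements merged into one kernel-verified Lean document; each statement's English description precedes it below -/
import Mathlib

section
/- Let k ≤ N and n ≥ 1, and let C 1, …, C n be submodules of V = Fin (N+1) → ℂ with finrank (C i) ≤ N − k for all i. Then the set S = { finrank (⨅ i, (C i ⊔ P)) | P a submodule of V with finrank P = k+1 and P ⊓ C i = ⊥ for all i } has a least element, and (as an integer) this least element equals (N + 1) + the maximum over all partitions λ of Fin n (Finpartition of Finset.univ) of ( −|λ|·(N − k − 1) + Σ_{I ∈ λ} (finrank (⨅_{i ∈ I} C i) − 1) ), where |λ| is the number of parts of λ. (Paper's Theorem 'lck final': ℓ_{c,k} = N + max_{λ ⊢ n} ( −|λ|(N−k−1) + Σ_{I∈λ} dim c_I ).) -/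
open Module

section Avoidance

variable {K V : Type*} [Field K] [AddCommGroup V] [Module K V]

theorem Submodule.exists_mem_forall_notMem_of_forall_not_le [Infinite K] {κ : Type*} [Finite κ]
    (L : Submodule K V) (A : κ → Submodule K V) (h : ∀ j, ¬ L ≤ A j) :
    ∃ x ∈ L, ∀ j, x ∉ A j := by
  by_contra! hcon
  obtain ⟨j, hj⟩ := Subspace.exists_eq_top_of_iUnion_eq_univ
    (p := fun j => (A j).comap L.subtype) (by
      refine Set.eq_univ_of_forall fun x => ?_
      obtain ⟨j, hj⟩ := hcon x x.2
      exact Set.mem_iUnion.2 ⟨j, hj⟩)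
  exact h j (Submodule.comap_subtype_eq_top.1 hj)

theorem Submodule.mem_dualAnnihilator_iff_le_ker (B : Submodule K V) (φ : Dual K V) :
    φ ∈ B.dualAnnihilator ↔ B ≤ LinearMap.ker φ := by
  rw [Submodule.mem_dualAnnihilator]
  exact Iff.rfl

/-- A subspace lies in a hyperplane containing none of finitely many subspaces not inside it. -/
theorem Submodule.exists_dual_le_ker_forall_not_le_ker [Infinite K] {κ : Type*} [Finite κ]
    (A : Submodule K V) (B : κ → Submodule K V) (h : ∀ j, ¬ B j ≤ A) :
    ∃ φ : Dual K V, A ≤ LinearMap.ker φ ∧ ∀ j, ¬ B j ≤ LinearMap.ker φ := by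
  obtain ⟨φ, hφ, hB⟩ := Submodule.exists_mem_forall_notMem_of_forall_not_le A.dualAnnihilator
    (fun j => (B j).dualAnnihilator)
    (fun j hj => h j (Subspace.dualAnnihilator_le_dualAnnihilator_iff.1 hj))
  simp only [Submodule.mem_dualAnnihilator_iff_le_ker] at hφ hB
  exact ⟨φ, hφ, hB⟩

theorem Submodule.finrank_inf_ker_add_one [FiniteDimensional K V] (B : Submodule K V)
    (φ : Dual K V) (h : ¬ B ≤ LinearMap.ker φ) :
    finrank K ↥(B ⊓ LinearMap.ker φ) + 1 = finrank K B := by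
  have hne : φ.domRestrict B ≠ 0 := by
    intro h0
    refine h fun x hx => ?_
    exact LinearMap.congr_fun h0 ⟨x, hx⟩
  rw [← Module.Dual.finrank_ker_add_one_of_ne_zero hne]
  have hmap : B ⊓ LinearMap.ker φ = (LinearMap.ker (φ.domRestrict B)).map B.subtype := by
    ext x
    simp [and_comm]
  rw [hmap, Submodule.finrank_map_subtype_eq]

theorem Submodule.finrank_sup_eq_add_of_disjoint [FiniteDimensional K V] {A B : Submodule K V}
    (h : A ⊓ B = ⊥) : finrank K ↥(A ⊔ B) = finrank K A + finrank K B := by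
  have := Submodule.finrank_sup_add_finrank_inf_eq A B
  rwa [h, finrank_bot, add_zero] at this

/-- A subspace in which each `C i` has codimension at least `c` contains a `c`-dimensional subspace
disjoint from all the `C i`. -/
theorem Submodule.exists_le_finrank_eq_forall_inf_eq_bot [Infinite K] [FiniteDimensional K V]
    {ι : Type*} [Finite ι] [Nonempty ι] (C : ι → Submodule K V) (W : Submodule K V) (c : ℕ)
    (h : ∀ i, finrank K ↥(W ⊓ C i) + c ≤ finrank K W) :
    ∃ P ≤ W, finrank K P = c ∧ ∀ i, P ⊓ C i = ⊥ := by
  induction c with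
  | zero => exact ⟨⊥, bot_le, finrank_bot K V, fun i => bot_inf_eq _⟩
  | succ c ih =>
    obtain ⟨P, hPW, hPc, hP⟩ := ih fun i => by have := h i; omega
    obtain ⟨x, hxW, hx⟩ := Submodule.exists_mem_forall_notMem_of_forall_not_le W
      (fun i => C i ⊔ P) (by
        intro i hle
        have hmod : W = W ⊓ C i ⊔ P := by
          rw [inf_sup_assoc_of_le _ hPW, inf_eq_left.2 hle]
        have h1 := Submodule.finrank_add_le_finrank_add_finrank (W ⊓ C i) P
        rw [← hmod] at h1
        have := h i
        omega)
    have hdisj : ∀ i, Disjoint (C i ⊔ P) (K ∙ x) := fun i =>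
      Submodule.disjoint_span_singleton_of_notMem (hx i)
    have hx0 : x ≠ 0 := by
      rintro rfl
      exact hx (Classical.arbitrary ι) (zero_mem _)
    refine ⟨P ⊔ K ∙ x, sup_le hPW ((Submodule.span_singleton_le_iff_mem _ _).2 hxW), ?_, ?_⟩
    · rw [Submodule.finrank_sup_eq_add_of_disjoint, finrank_span_singleton hx0, hPc]
      exact ((hdisj (Classical.arbitrary ι)).mono_left le_sup_right).eq_bot
    · intro i
      rw [inf_comm]
      exact (Disjoint.disjoint_sup_right_of_disjoint_sup_left
        (disjoint_iff.2 (by rw [inf_comm, hP i])) (hdisj i)).eq_bot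

end Avoidance

section GenericSection

variable {K V ι : Type*} [Field K] [Infinite K] [AddCommGroup V] [Module K V]
  [FiniteDimensional K V]

/-- Under a Rado-type condition, cutting `W` successively with `r i` generic hyperplanes through
each `C i` drops the dimension every time, and leaves each `C i` of codimension at least `c`. -/
theorem Submodule.exists_generic_section [Fintype ι] (C : ι → Submodule K V) {c : ℕ} (hc : 0 < c)
    (R : ℕ) (r : ι → ℕ) (hR : ∑ i, r i = R) (W : Submodule K V)
    (h : ∀ J : Finset ι, J.Nonempty →
      finrank K ↥(W ⊓ ⨅ i ∈ J, C i) + ∑ i ∈ J, r i + c ≤ finrank K W) :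
    ∃ W' ≤ W, finrank K W' + R = finrank K W ∧ W ⊓ ⨅ i, (C i ⊔ W') ≤ W' ∧
      ∀ i, finrank K ↥(W' ⊓ C i) + c ≤ finrank K W' := by
  classical
  induction R generalizing r W with
  | zero =>
    refine ⟨W, le_rfl, rfl, inf_le_left, fun i => ?_⟩
    have := h {i} (Finset.singleton_nonempty i)
    rw [Finset.iInf_singleton, Finset.sum_singleton] at this
    omega
  | succ R ih =>
    obtain ⟨i₀, hi₀⟩ : ∃ i, r i ≠ 0 := by
      by_contra! h0
      simp [h0] at hR
    obtain ⟨φ, hφC, hφ⟩ := Submodule.exists_dual_le_ker_forall_not_le_ker (C i₀)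
      (fun J : {J : Finset ι // ¬ W ⊓ ⨅ i ∈ J, C i ≤ C i₀} => W ⊓ ⨅ i ∈ J.1, C i)
      (fun J => J.2)
    have hW : ¬ W ≤ C i₀ := by
      intro hle
      have := h {i₀} (Finset.singleton_nonempty i₀)
      rw [Finset.iInf_singleton, inf_eq_left.2 hle, Finset.sum_singleton] at this
      omega
    have hWφ : finrank K ↥(W ⊓ LinearMap.ker φ) + 1 = finrank K W :=
      W.finrank_inf_ker_add_one φ (by simpa using hφ ⟨∅, by simpa using hW⟩)
    have hr : r = Function.update r i₀ (r i₀ - 1) + Pi.single i₀ 1 := by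
      ext i
      rcases eq_or_ne i i₀ with rfl | hi
      · simp; omega
      · simp [hi]
    have hsum : ∀ J : Finset ι, ∑ i ∈ J, r i =
        ∑ i ∈ J, Function.update r i₀ (r i₀ - 1) i + if i₀ ∈ J then 1 else 0 := by
      intro J
      conv_lhs => rw [hr]
      simp [Finset.sum_add_distrib, Finset.sum_pi_single']
    obtain ⟨W', hW', hrank, hinf, hcod⟩ := ih (Function.update r i₀ (r i₀ - 1))
      (by have := hsum Finset.univ; simp only [Finset.mem_univ, if_true] at this; omega)
      (W ⊓ LinearMap.ker φ) (by
        intro J hJ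
        rw [inf_right_comm]
        have hJ' := h J hJ
        have hs := hsum J
        by_cases hle : W ⊓ ⨅ i ∈ J, C i ≤ C i₀
        · rw [inf_eq_left.2 (hle.trans hφC)]
          by_cases hi : i₀ ∈ J
          · rw [if_pos hi] at hs
            omega
          · rw [if_neg hi] at hs
            have hins := h (insert i₀ J) (Finset.insert_nonempty _ _)
            rw [Finset.iInf_insert, Finset.sum_insert hi, inf_left_comm, inf_eq_right.2 hle]
              at hins
            omega
        · have := (W ⊓ ⨅ i ∈ J, C i).finrank_inf_ker_add_one φ (hφ ⟨J, hle⟩)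
          split_ifs at hs <;> omega)
    refine ⟨W', hW'.trans inf_le_left, by omega, le_trans ?_ hinf, hcod⟩
    refine le_inf (le_inf inf_le_left ?_) inf_le_right
    exact inf_le_right.trans ((iInf_le _ i₀).trans (sup_le hφC (hW'.trans inf_le_right)))

end GenericSection

/-- Duality for the polymatroid of an intersecting submodular function: some feasible vector has
total weight equal to the value of `g` on a partition. -/
theorem Finpartition.exists_sum_eq_of_intersecting_submodular {ι : Type*} [Fintype ι]
    [DecidableEq ι] (g : Finset ι → ℤ) (hg : ∀ J, J.Nonempty → 0 ≤ g J)
    (hsub : ∀ A B, (A ∩ B).Nonempty → g (A ∪ B) + g (A ∩ B) ≤ g A + g B) :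
    ∃ r : ι → ℕ, (∀ J : Finset ι, J.Nonempty → ∑ i ∈ J, (r i : ℤ) ≤ g J) ∧
      ∃ lam : Finpartition (Finset.univ : Finset ι), ∑ I ∈ lam.parts, g I = ∑ i, (r i : ℤ) := by
  classical
  have hfin : {r : ι → ℕ | ∀ J : Finset ι, J.Nonempty → ∑ i ∈ J, (r i : ℤ) ≤ g J}.Finite := by
    refine (Set.finite_Icc (0 : ι → ℕ) fun i => (g {i}).toNat).subset fun r hr => ?_
    refine ⟨fun i => Nat.zero_le _, fun i => ?_⟩
    have := hr {i} (Finset.singleton_nonempty i)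
    rw [Finset.sum_singleton] at this
    show r i ≤ (g {i}).toNat
    omega
  obtain ⟨r, hr, hmax⟩ := hfin.exists_maximal ⟨0, fun J hJ => by simpa using hg J hJ⟩
  refine ⟨r, hr, ?_⟩
  let Tight : Finset ι → Prop := fun J => J.Nonempty ∧ ∑ i ∈ J, (r i : ℤ) = g J
  have htight : ∀ i, ∃ J, Tight J ∧ i ∈ J := by
    intro i
    by_contra! hcon
    have hle := hmax (y := r + Pi.single i 1) (by
      intro J hJ
      have hJr := hr J hJ
      have hsum : ∑ j ∈ J, (((r + Pi.single i 1 : ι → ℕ) j : ℕ) : ℤ) =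
          ∑ j ∈ J, (r j : ℤ) + if i ∈ J then 1 else 0 := by
        simp [Finset.sum_add_distrib, Pi.single_apply]
      rw [hsum]
      split_ifs with hi
      · have : ∑ j ∈ J, (r j : ℤ) ≠ g J := fun he => hcon J ⟨hJ, he⟩ hi
        omega
      · omega) (fun j => by simp)
    have := hle i
    simp at this
  have hunion : ∀ A B, Tight A → Tight B → (A ∩ B).Nonempty → Tight (A ∪ B) := by
    intro A B hA hB hAB
    refine ⟨hA.1.mono Finset.subset_union_left, ?_⟩
    have h1 := hsub A B hAB
    have h2 := hr _ hAB
    have h3 := hr (A ∪ B) (hA.1.mono Finset.subset_union_left)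
    have h4 := Finset.sum_union_inter (s₁ := A) (s₂ := B) (f := fun i => (r i : ℤ))
    have h5 := hA.2
    have h6 := hB.2
    omega
  let lam : Finpartition (Finset.univ : Finset ι) := Finpartition.ofExistsUnique
    (Finset.univ.filter fun J => Maximal Tight J) (fun J _ => Finset.subset_univ J) (by
      intro i _
      obtain ⟨J, hJ, hiJ⟩ := htight i
      obtain ⟨M, hJM, hM⟩ := (Set.toFinite {J | Tight J}).exists_le_maximal hJ
      refine ⟨M, ⟨by simpa using hM, hJM hiJ⟩, ?_⟩
      rintro M' ⟨hM', hiM'⟩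
      replace hM' : Maximal Tight M' := by simpa using hM'
      have hU := hunion M' M hM'.prop hM.prop ⟨i, Finset.mem_inter.2 ⟨hiM', hJM hiJ⟩⟩
      rw [hM'.eq_of_le hU Finset.subset_union_left]
      exact (hM.eq_of_le hU Finset.subset_union_right).symm) (by
      intro h0
      exact Finset.not_nonempty_empty (Finset.mem_filter.1 h0).2.prop.1)
  refine ⟨lam, ?_⟩
  have hparts : ∀ I ∈ lam.parts, g I = ∑ i ∈ I, (r i : ℤ) := fun I hI =>
    ((Finset.mem_filter.1 hI).2.prop.2).symm
  rw [Finset.sum_congr rfl hparts]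
  conv_rhs => rw [← lam.biUnion_parts, Finset.sum_biUnion lam.disjoint]
  rfl

theorem Submodule.finrank_add_sum_le_finrank_iInf {K V κ : Type*} [Field K] [AddCommGroup V]
    [Module K V] [FiniteDimensional K V] (s : Finset κ) (A : κ → Submodule K V) :
    (finrank K V : ℤ) + ∑ j ∈ s, ((finrank K (A j) : ℤ) - finrank K V) ≤
      finrank K ↥(⨅ j ∈ s, A j) := by
  classical
  induction s using Finset.induction_on with
  | empty =>
    have h : ⨅ j ∈ (∅ : Finset κ), A j = ⊤ := by simp
    rw [h, finrank_top, Finset.sum_empty, add_zero]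
  | insert a s ha ih =>
    rw [Finset.sum_insert ha, Finset.iInf_insert]
    have h1 := Submodule.finrank_sup_add_finrank_inf_eq (A a) (⨅ j ∈ s, A j)
    have h2 := Submodule.finrank_le (A a ⊔ ⨅ j ∈ s, A j)
    omega

section BackProjection

variable {K V ι : Type*} [Field K] [AddCommGroup V] [Module K V] [FiniteDimensional K V]

theorem Submodule.finrank_iInf_union_add_iInf_inter_le [DecidableEq ι] (C : ι → Submodule K V)
    (A B : Finset ι) :
    finrank K ↥(⨅ i ∈ A, C i) + finrank K ↥(⨅ i ∈ B, C i) ≤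
      finrank K ↥(⨅ i ∈ A ∪ B, C i) + finrank K ↥(⨅ i ∈ A ∩ B, C i) := by
  have h1 := Submodule.finrank_sup_add_finrank_inf_eq (⨅ i ∈ A, C i) (⨅ i ∈ B, C i)
  rw [← Finset.iInf_union] at h1
  have h2 : (⨅ i ∈ A, C i) ⊔ (⨅ i ∈ B, C i) ≤ ⨅ i ∈ A ∩ B, C i :=
    sup_le (biInf_mono fun i hi => (Finset.mem_inter.1 hi).1)
      (biInf_mono fun i hi => (Finset.mem_inter.1 hi).2)
  have h3 := Submodule.finrank_mono h2
  omega

theorem Submodule.finrank_add_sum_le_finrank_iInf_sup [Fintype ι] [DecidableEq ι]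
    (C : ι → Submodule K V) (P : Submodule K V) (hP : ∀ i, P ⊓ C i = ⊥)
    (lam : Finpartition (Finset.univ : Finset ι)) :
    (finrank K V : ℤ) + ∑ I ∈ lam.parts,
        ((finrank K ↥(⨅ i ∈ I, C i) : ℤ) + finrank K P - finrank K V) ≤
      finrank K ↥(⨅ i, C i ⊔ P) := by
  have hrank : ∀ I ∈ lam.parts,
      (finrank K ↥(⨅ i ∈ I, C i) : ℤ) + finrank K P - finrank K V =
        (finrank K ↥((⨅ i ∈ I, C i) ⊔ P) : ℤ) - finrank K V := by
    intro I hI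
    obtain ⟨i, hi⟩ := lam.nonempty_of_mem_parts hI
    rw [Submodule.finrank_sup_eq_add_of_disjoint]
    · push_cast; ring
    · rw [inf_comm, ← le_bot_iff, ← hP i]
      exact inf_le_inf_left _ (biInf_le _ hi)
  rw [Finset.sum_congr rfl hrank]
  refine (Submodule.finrank_add_sum_le_finrank_iInf lam.parts
    fun I => (⨅ i ∈ I, C i) ⊔ P).trans ?_
  refine Int.ofNat_le.2 (Submodule.finrank_mono (le_iInf fun i => ?_))
  obtain ⟨I, hI, hi⟩ := lam.exists_mem (Finset.mem_univ i)
  exact (biInf_le _ hI).trans (sup_le_sup_right (biInf_le _ hi) P)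

/-- Some `c`-dimensional `P` meeting no `C i` attains the bound of
`Submodule.finrank_add_sum_le_finrank_iInf_sup` for some partition. -/
theorem Submodule.exists_finrank_iInf_sup_le [Infinite K] [Fintype ι] [DecidableEq ι] [Nonempty ι]
    (C : ι → Submodule K V) {c : ℕ} (hc : 0 < c)
    (hC : ∀ i, finrank K (C i) + c ≤ finrank K V) :
    ∃ P : Submodule K V, finrank K P = c ∧ (∀ i, P ⊓ C i = ⊥) ∧
      ∃ lam : Finpartition (Finset.univ : Finset ι),
        (finrank K ↥(⨅ i, C i ⊔ P) : ℤ) ≤ finrank K V + ∑ I ∈ lam.parts,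
          ((finrank K ↥(⨅ i ∈ I, C i) : ℤ) + c - finrank K V) := by
  obtain ⟨r, hr, lam, hlam⟩ := Finpartition.exists_sum_eq_of_intersecting_submodular
    (fun J : Finset ι => (finrank K V : ℤ) - c - finrank K ↥(⨅ i ∈ J, C i))
    (by
      rintro J ⟨i, hi⟩
      have h1 : finrank K ↥(⨅ i ∈ J, C i) ≤ finrank K (C i) :=
        Submodule.finrank_mono (biInf_le C hi)
      have := hC i
      omega)
    (by
      intro A B _
      have := Submodule.finrank_iInf_union_add_iInf_inter_le C A B
      omega)
  obtain ⟨W, -, hW, hle, hcod⟩ := Submodule.exists_generic_section C hc _ r rfl ⊤ (by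
    intro J hJ
    have := hr J hJ
    rw [top_inf_eq, finrank_top]
    zify
    linarith)
  obtain ⟨P, hPW, hPc, hP⟩ := Submodule.exists_le_finrank_eq_forall_inf_eq_bot C W c hcod
  refine ⟨P, hPc, hP, lam, ?_⟩
  rw [top_inf_eq] at hle
  have h1 := Submodule.finrank_mono ((iInf_mono fun i => sup_le_sup_left hPW (C i)).trans hle)
  have h2 : ∑ I ∈ lam.parts, ((finrank K ↥(⨅ i ∈ I, C i) : ℤ) + c - finrank K V) =
      -∑ i, (r i : ℤ) := by
    rw [← hlam, ← Finset.sum_neg_distrib]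
    exact Finset.sum_congr rfl fun I _ => by ring
  rw [finrank_top] at hW
  rw [h2, ← hW]
  push_cast
  linarith

end BackProjection

/-- **Paper's Theorem "lck final"**: for a center arrangement `C 1, …, C n` in
`ℙ^N` (cones in `V = Fin (N+1) → ℂ`), the least element of
`S = { finrank (⨅ i, C i ⊔ P) : finrank P = k+1, P ⊓ C i = ⊥ ∀ i }` exists and equals
`(N+1) + max_{λ ⊢ n} ( -|λ|(N-k-1) + Σ_{I ∈ λ} (finrank c_I - 1) )`. -/
theorem lck_final (N k n : ℕ) (hk : k ≤ N) (hn : 1 ≤ n)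
    (C : Fin n → Submodule ℂ (Fin (N + 1) → ℂ))
    (hC : ∀ i, finrank ℂ ↥(C i) ≤ N - k) :
    ∃ L : ℕ,
      IsLeast
        { r : ℕ | ∃ P : Submodule ℂ (Fin (N + 1) → ℂ),
            finrank ℂ ↥P = k + 1 ∧ (∀ i, P ⊓ C i = ⊥) ∧
            r = finrank ℂ ↥(⨅ i, C i ⊔ P) } L ∧
      IsGreatest
        { z : ℤ | ∃ lam : Finpartition (Finset.univ : Finset (Fin n)),
            z = -(lam.parts.card : ℤ) * ((N : ℤ) - k - 1) +
              ∑ I ∈ lam.parts, ((finrank ℂ ↥(⨅ i ∈ I, C i) : ℤ) - 1) }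
        ((L : ℤ) - (N + 1)) := by
  have hV : finrank ℂ (Fin (N + 1) → ℂ) = N + 1 := by simp
  have : Nonempty (Fin n) := ⟨⟨0, hn⟩⟩
  have hsum : ∀ lam : Finpartition (Finset.univ : Finset (Fin n)),
      -(lam.parts.card : ℤ) * ((N : ℤ) - k - 1) +
          ∑ I ∈ lam.parts, ((finrank ℂ ↥(⨅ i ∈ I, C i) : ℤ) - 1) =
        ∑ I ∈ lam.parts, ((finrank ℂ ↥(⨅ i ∈ I, C i) : ℤ) + (k + 1 : ℕ) -
          finrank ℂ (Fin (N + 1) → ℂ)) := by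
    intro lam
    rw [hV]
    simp only [Finset.sum_sub_distrib, Finset.sum_add_distrib, Finset.sum_const, nsmul_eq_mul]
    push_cast
    ring
  obtain ⟨P, hPc, hP, lam, hlam⟩ := Submodule.exists_finrank_iInf_sup_le C k.succ_pos
    (fun i => by have := hC i; omega)
  have hlow : ∀ (Q : Submodule ℂ (Fin (N + 1) → ℂ)), finrank ℂ Q = k + 1 →
      (∀ i, Q ⊓ C i = ⊥) → ∀ mu : Finpartition (Finset.univ : Finset (Fin n)), _ :=
    fun Q _ hQ mu => Submodule.finrank_add_sum_le_finrank_iInf_sup C Q hQ mu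
  refine ⟨finrank ℂ ↥(⨅ i, C i ⊔ P), ⟨⟨P, hPc, hP, rfl⟩, ?_⟩, ⟨lam, ?_⟩, ?_⟩
  · rintro _ ⟨Q, hQc, hQ, rfl⟩
    have := hlow Q hQc hQ lam
    rw [hQc] at this
    exact Int.ofNat_le.1 (hlam.trans this)
  · have := hlow P hPc hP lam
    rw [hPc] at this
    rw [hsum]
    have hV' : (finrank ℂ (Fin (N + 1) → ℂ) : ℤ) = N + 1 := by exact_mod_cast hV
    have := le_antisymm hlam this
    rw [this, hV']
    ring
  · rintro _ ⟨mu, rfl⟩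
    have := hlow P hPc hP mu
    rw [hPc] at this
    rw [hsum]
    have hV' : (finrank ℂ (Fin (N + 1) → ℂ) : ℤ) = N + 1 := by exact_mod_cast hV
    linarith
end

section
/- Let k ≤ N and let C 1, C 2 be submodules of V = Fin (N+1) → ℂ with finrank (C 1) ≤ N − k and finrank (C 2) ≤ N − k. Then the set S = { finrank ((C 1 ⊔ P) ⊓ (C 2 ⊔ P)) | P a submodule of V with finrank P = k+1, P ⊓ C 1 = ⊥ and P ⊓ C 2 = ⊥ } has a least element, equal (as an integer) to max ( finrank (C 1 ⊓ C 2) + k + 1, finrank (C 1) + finrank (C 2) + 2(k+1) − (N+1) ). (Paper's Lemma 'lck n = 2': ℓ_{(c1,c2),k} = max { dim c1∧c2 + k + 1, dim c1 + dim c2 + 2k + 2 − N }.) -/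
open Module

section GeneralPosition

variable {K V : Type*} [Field K] [AddCommGroup V] [Module K V] [FiniteDimensional K V]

/-- Over an infinite field there is a subspace of dimension `p` in general position with respect
to finitely many given subspaces. -/
theorem exists_submodule_forall_finrank_sup_eq_min [Infinite K] {ι : Type*} [Finite ι]
    (W : ι → Submodule K V) (p : ℕ) (hp : p ≤ finrank K V) :
    ∃ P : Submodule K V, finrank K P = p ∧
      ∀ i, finrank K ↥(W i ⊔ P) = min (finrank K V) (finrank K (W i) + p) := by
  induction p with
  | zero => exact ⟨⊥, finrank_bot K V, fun i ↦ by rw [sup_bot_eq, add_zero, min_eq_right (Submodule.finrank_le _)]⟩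
  | succ p ih =>
    obtain ⟨P, hP, hWP⟩ := ih (by omega)
    have hPtop : P ≠ ⊤ := by
      rintro rfl
      rw [finrank_top] at hP
      omega
    obtain ⟨v, hvP, hv⟩ : ∃ v : V, v ∉ P ∧ ∀ i, W i ⊔ P ≠ ⊤ → v ∉ W i ⊔ P := by
      classical
      by_contra! h
      obtain ⟨i, hi⟩ := Subspace.exists_eq_top_of_iUnion_eq_univ (k := K)
        (p := fun o : Option {i // W i ⊔ P ≠ ⊤} ↦ o.elim P fun i ↦ W i ⊔ P) <| by
          refine Set.eq_univ_of_forall fun v ↦ Set.mem_iUnion.2 ?_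
          by_cases hvP : v ∈ P
          · exact ⟨none, hvP⟩
          · obtain ⟨i, hi, hvi⟩ := h v hvP
            exact ⟨some ⟨i, hi⟩, hvi⟩
      cases i with
      | none => exact hPtop hi
      | some i => exact i.2 hi
    refine ⟨P ⊔ Submodule.span K {v}, by rw [Submodule.finrank_sup_span_singleton hvP, hP], fun i ↦ ?_⟩
    rw [← sup_assoc]
    have hi := hWP i
    by_cases htop : W i ⊔ P = ⊤
    · rw [htop, finrank_top] at hi
      rw [htop, top_sup_eq, finrank_top]
      omega
    · have hlt := Submodule.finrank_lt htop
      rw [Submodule.finrank_sup_span_singleton (hv i htop)]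
      omega

theorem finrank_sup_inf_sup_add_finrank_sup_sup {A B P : Submodule K V}
    (hA : P ⊓ A = ⊥) (hB : P ⊓ B = ⊥) :
    finrank K ↥((A ⊔ P) ⊓ (B ⊔ P)) + finrank K ↥(A ⊔ B ⊔ P) =
      finrank K A + finrank K B + 2 * finrank K P := by
  have h := Submodule.finrank_sup_add_finrank_inf_eq (A ⊔ P) (B ⊔ P)
  have h₁ := Submodule.finrank_sup_add_finrank_inf_eq A P
  have h₂ := Submodule.finrank_sup_add_finrank_inf_eq B P
  rw [inf_comm, hA, finrank_bot] at h₁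
  rw [inf_comm, hB, finrank_bot] at h₂
  rw [sup_sup_sup_comm, sup_idem] at h
  omega

theorem inf_eq_bot_of_finrank_sup_eq_add {A P : Submodule K V}
    (h : finrank K ↥(A ⊔ P) = finrank K A + finrank K P) : P ⊓ A = ⊥ := by
  have := Submodule.finrank_sup_add_finrank_inf_eq A P
  rw [inf_comm, ← Submodule.finrank_eq_zero (R := K)]
  omega

end GeneralPosition

/-- **Paper's Lemma "lck n = 2"**: for two centers `C 1, C 2` in `ℙ^N`,
`ℓ_{(c1,c2),k} + 1 = max (dim (c1∧c2) + k + 2, dim c1 + dim c2 + 2k + 2 - N + 1)`,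
phrased with cones: the least element of
`S = { finrank ((C1 ⊔ P) ⊓ (C2 ⊔ P)) : finrank P = k+1, P ⊓ C i = ⊥ }` equals
`max (finrank (C1 ⊓ C2) + k + 1, finrank C1 + finrank C2 + 2(k+1) - (N+1))`. -/
theorem lck_two_centers (N k : ℕ) (hk : k ≤ N)
    (C₁ C₂ : Submodule ℂ (Fin (N + 1) → ℂ))
    (hC₁ : finrank ℂ ↥C₁ ≤ N - k) (hC₂ : finrank ℂ ↥C₂ ≤ N - k) :
    ∃ L : ℕ,
      IsLeast
        { r : ℕ | ∃ P : Submodule ℂ (Fin (N + 1) → ℂ),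
            finrank ℂ ↥P = k + 1 ∧ P ⊓ C₁ = ⊥ ∧ P ⊓ C₂ = ⊥ ∧
            r = finrank ℂ ↥((C₁ ⊔ P) ⊓ (C₂ ⊔ P)) } L ∧
      (L : ℤ) = max ((finrank ℂ ↥(C₁ ⊓ C₂) : ℤ) + k + 1)
        ((finrank ℂ ↥C₁ : ℤ) + finrank ℂ ↥C₂ + 2 * (k + 1) - (N + 1)) := by
  have hV : finrank ℂ (Fin (N + 1) → ℂ) = N + 1 := by simp
  have hC := Submodule.finrank_sup_add_finrank_inf_eq C₁ C₂
  obtain ⟨P, hP, hW⟩ := exists_submodule_forall_finrank_sup_eq_min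
    ![C₁, C₂, C₁ ⊔ C₂] (k + 1) (by omega)
  have h₁ : finrank ℂ ↥(C₁ ⊔ P) = min _ (finrank ℂ C₁ + (k + 1)) := hW 0
  have h₂ : finrank ℂ ↥(C₂ ⊔ P) = min _ (finrank ℂ C₂ + (k + 1)) := hW 1
  have h₃ : finrank ℂ ↥(C₁ ⊔ C₂ ⊔ P) = min _ (finrank ℂ ↥(C₁ ⊔ C₂) + (k + 1)) := hW 2
  have hP₁ : P ⊓ C₁ = ⊥ := inf_eq_bot_of_finrank_sup_eq_add (by omega)
  have hP₂ : P ⊓ C₂ = ⊥ := inf_eq_bot_of_finrank_sup_eq_add (by omega)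
  have hr := finrank_sup_inf_sup_add_finrank_sup_sup hP₁ hP₂
  refine ⟨_, ⟨⟨P, hP, hP₁, hP₂, rfl⟩, ?_⟩, by omega⟩
  rintro _ ⟨Q, hQ, hQ₁, hQ₂, rfl⟩
  have hs := finrank_sup_inf_sup_add_finrank_sup_sup hQ₁ hQ₂
  have hle := Submodule.finrank_le (C₁ ⊔ C₂ ⊔ Q)
  have hadd := Submodule.finrank_add_le_finrank_add_finrank (C₁ ⊔ C₂) Q
  omega
end

section
/- Let k ≤ N, n ≥ 1, and let C 1, …, C n be submodules of V = Fin (N+1) → ℂ with finrank (C i) ≤ N − k for all i. The arrangement (C i) is pseudo-disjoint with respect to k if and only if for every nonempty I ⊆ Fin n with ⨅_{i∈I} C i ≠ ⊥ one has (as integers) Σ_{i∈I} finrank (C i) ≥ (|I| − 1)·(N − k) + finrank (⨅_{i∈I} C i). (Paper's Theorem 'Pseudo-Disjoint': c is pseudo-disjoint with respect to k iff for each I with c_I ≠ ∅, Σ_{i∈I} dim c_i ≥ (|I|−1)(N−k−1) + dim c_I.) -/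
open Module

/-- A center arrangement `C` in `ℙ^N` (cones in `V = Fin (N+1) → ℂ`) is
*pseudo-disjoint with respect to `k`* if every tuple `H` of back-projected planes
(`C i ≤ H i`, `finrank (H i) = finrank (C i) + k + 1`) whose total intersection
contains a `k`-plane (`finrank (⨅ i, H i) ≥ k + 1`) satisfies the constraints
coming from intersections of centers. -/
def IsPseudoDisjoint (N k n : ℕ) (C : Fin n → Submodule ℂ (Fin (N + 1) → ℂ)) : Prop :=
  ∀ H : Fin n → Submodule ℂ (Fin (N + 1) → ℂ),
    (∀ i, C i ≤ H i ∧ finrank ℂ ↥(H i) = finrank ℂ ↥(C i) + k + 1) →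
    finrank ℂ ↥(⨅ i, H i) ≥ k + 1 →
    ∀ I : Finset (Fin n), 2 ≤ I.card → (⨅ i ∈ I, C i) ≠ ⊥ →
      finrank ℂ ↥(⨅ i ∈ I, H i) ≥ finrank ℂ ↥(⨅ i ∈ I, C i) + k + 1

/-- A vector outside `A` and outside every proper subspace of the form `A ⊔ B j`. -/
theorem exists_notMem_of_forall_sup_ne_top {K V κ : Type*} [Field K] [Infinite K]
    [AddCommGroup V] [Module K V] {A : Submodule K V} (hA : A ≠ ⊤)
    (s : Finset κ) (B : κ → Submodule K V) :
    ∃ v, v ∉ A ∧ ∀ j ∈ s, A ⊔ B j ≠ ⊤ → v ∉ A ⊔ B j := by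
  classical
  let t : Finset (Submodule K V) := insert A ((s.image fun j => A ⊔ B j).filter (· ≠ ⊤))
  have ht : ⊤ ∉ t := by simp [t, hA.symm]
  obtain ⟨v, hv⟩ := (Set.ne_univ_iff_exists_notMem _).1
    (Subspace.biUnion_ne_univ_of_top_notMem ht)
  simp only [Set.mem_iUnion, SetLike.mem_coe, not_exists] at hv
  refine ⟨v, hv A (Finset.mem_insert_self _ _), fun j hj hne => hv _ ?_⟩
  exact Finset.mem_insert_of_mem
    (Finset.mem_filter.2 ⟨Finset.mem_image_of_mem _ hj, hne⟩)

section Subspaces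

variable {K V ι : Type*} [Field K] [AddCommGroup V] [Module K V] [FiniteDimensional K V]

theorem finrank_sup_span_singleton_of_notMem {S : Submodule K V} {v : V} (hv : v ∉ S) :
    finrank K ↥(S ⊔ K ∙ v) = finrank K S + 1 := by
  have hlt : finrank K S < finrank K ↥(S ⊔ K ∙ v) := by
    refine Submodule.finrank_lt_finrank_of_lt (lt_of_le_of_ne le_sup_left fun h => hv ?_)
    rw [h]
    exact Submodule.mem_sup_right (Submodule.mem_span_singleton_self v)
  have hle := Submodule.finrank_add_le_finrank_add_finrank S (K ∙ v)
  have hspan : finrank K ↥(K ∙ v) ≤ 1 := (finrank_span_le_card {v}).trans (by simp)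
  lia

/-- Subspaces of every intermediate dimension exist between two nested subspaces. -/
theorem exists_between_finrank_eq {A B : Submodule K V} (hAB : A ≤ B) {d : ℕ}
    (hA : finrank K A ≤ d) (hB : d ≤ finrank K B) :
    ∃ H : Submodule K V, A ≤ H ∧ H ≤ B ∧ finrank K H = d := by
  induction d, hA using Nat.le_induction with
  | base => exact ⟨A, le_rfl, hAB, rfl⟩
  | succ d _ ih =>
    obtain ⟨H, hAH, hHB, hH⟩ := ih (by lia)
    have hlt : H < B := lt_of_le_of_ne hHB fun h => by subst h; lia
    obtain ⟨v, hvB, hvH⟩ := SetLike.exists_of_lt hlt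
    refine ⟨H ⊔ K ∙ v, hAH.trans le_sup_left, sup_le hHB ?_, ?_⟩
    · simpa using hvB
    · rw [finrank_sup_span_singleton_of_notMem hvH, hH]

/-- Codimension is subadditive under intersection. -/
theorem finrank_le_finrank_iInf_add_sum (I : Finset ι) (H : ι → Submodule K V) (w : ι → ℕ)
    (h : ∀ i ∈ I, finrank K V ≤ finrank K (H i) + w i) :
    finrank K V ≤ finrank K ↥(⨅ i ∈ I, H i) + ∑ i ∈ I, w i := by
  classical
  induction I using Finset.induction_on with
  | empty => rw [show ⨅ i ∈ (∅ : Finset ι), H i = ⊤ by simp, finrank_top]; lia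
  | insert a s ha ih =>
    have ih' := ih fun i hi => h i (Finset.mem_insert_of_mem hi)
    have h_a := h a (Finset.mem_insert_self a s)
    rw [Finset.iInf_insert, Finset.sum_insert ha]
    have hmod := Submodule.finrank_sup_add_finrank_inf_eq (H a) (⨅ i ∈ s, H i)
    have hle := Submodule.finrank_le (H a ⊔ ⨅ i ∈ s, H i)
    lia

/-- A dual form of Rado's theorem for subspaces: if
`dim (⋂_{j ∈ J} C j) ≤ dim V - ∑_{j ∈ J} w j` for all `J ⊆ I`, then the `C i` can be enlarged
to subspaces of codimension `w i` that intersect transversally. -/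
theorem exists_transversal_of_hall [Infinite K] (I : Finset ι) (w : ι → ℕ)
    (C : ι → Submodule K V)
    (hall : ∀ J ⊆ I, finrank K ↥(⨅ i ∈ J, C i) + ∑ i ∈ J, w i ≤ finrank K V) :
    ∃ T : ι → Submodule K V, (∀ i, C i ≤ T i) ∧
      (∀ i ∈ I, finrank K (T i) + w i = finrank K V) ∧
      finrank K ↥(⨅ i ∈ I, T i) + ∑ i ∈ I, w i ≤ finrank K V := by
  classical
  induction hm : ∑ i ∈ I, (finrank K V - (finrank K (C i) + w i)) using
    Nat.strong_induction_on generalizing C with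
  | _ m ih =>
  have hsingle : ∀ i ∈ I, finrank K (C i) + w i ≤ finrank K V := fun i hi => by
    have := hall {i} (by simpa using hi)
    rwa [Finset.iInf_singleton, Finset.sum_singleton] at this
  by_cases hdone : ∀ i ∈ I, finrank K (C i) + w i = finrank K V
  · exact ⟨C, fun _ => le_rfl, hdone, hall I subset_rfl⟩
  push Not at hdone
  obtain ⟨i, hi, hne⟩ := hdone
  have hlt := lt_of_le_of_ne (hsingle i hi) hne
  have htop : C i ≠ ⊤ := fun h => by rw [h, finrank_top] at hlt; lia
  obtain ⟨v, hvC, hv⟩ := exists_notMem_of_forall_sup_ne_top htop (I.erase i).powerset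
    (fun J => ⨅ j ∈ J, C j)
  have hrank := finrank_sup_span_singleton_of_notMem hvC
  set C' := Function.update C i (C i ⊔ K ∙ v) with hC'
  have hle : ∀ j, C j ≤ C' j := fun j => by
    rcases eq_or_ne j i with rfl | hj
    · simp [hC']
    · simp [hC', hj]
  have hdecr : ∑ j ∈ I, (finrank K V - (finrank K (C' j) + w j)) < m := by
    rw [← hm]
    refine Finset.sum_lt_sum (fun j _ => ?_) ⟨i, hi, ?_⟩
    · have := Submodule.finrank_mono (hle j)
      lia
    · rw [show C' i = C i ⊔ K ∙ v from Function.update_self ..]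
      lia
  have hall' : ∀ J ⊆ I, finrank K ↥(⨅ j ∈ J, C' j) + ∑ j ∈ J, w j ≤ finrank K V := by
    intro J hJ
    by_cases hiJ : i ∈ J
    · obtain ⟨J, hiJ', rfl⟩ : ∃ J', i ∉ J' ∧ insert i J' = J :=
        ⟨J.erase i, Finset.notMem_erase i J, Finset.insert_erase hiJ⟩
      have hJI : J ⊆ I := (Finset.subset_insert i J).trans hJ
      have hJe : J ∈ (I.erase i).powerset :=
        Finset.mem_powerset.2 (Finset.subset_erase.2 ⟨hJI, hiJ'⟩)
      have hi_J := hall _ hJ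
      have h_J := hall J hJI
      rw [Finset.iInf_insert, Finset.sum_insert hiJ'] at hi_J
      rw [Finset.iInf_insert_update C hiJ', Finset.sum_insert hiJ']
      have hmod := Submodule.finrank_sup_add_finrank_inf_eq (C i) (⨅ j ∈ J, C j)
      have hmod' := Submodule.finrank_sup_add_finrank_inf_eq (C i ⊔ K ∙ v) (⨅ j ∈ J, C j)
      rw [sup_right_comm] at hmod'
      by_cases hsup : C i ⊔ ⨅ j ∈ J, C j = ⊤
      · rw [hsup, top_sup_eq, finrank_top] at hmod'
        lia
      · rw [finrank_sup_span_singleton_of_notMem (hv J hJe hsup)] at hmod'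
        lia
    · have hcongr : ⨅ j ∈ J, C' j = ⨅ j ∈ J, C j :=
        biInf_congr fun j hj => Function.update_of_ne (ne_of_mem_of_not_mem hj hiJ) _ _
      rw [hcongr]
      exact hall J hJ
  obtain ⟨T, hCT, hT, hTI⟩ := ih _ hdecr C' hall' rfl
  exact ⟨T, fun j => (hle j).trans (hCT j), hT, hTI⟩

end Subspaces

theorem exists_le_sum_eq {ι : Type*} (I : Finset ι) (w : ι → ℕ) {t : ℕ} (ht : t ≤ ∑ i ∈ I, w i) :
    ∃ u : ι → ℕ, (∀ i, u i ≤ w i) ∧ ∑ i ∈ I, u i = t := by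
  classical
  induction I using Finset.induction_on generalizing t with
  | empty => exact ⟨0, fun _ => Nat.zero_le _, by simp_all⟩
  | insert a s ha ih =>
    rw [Finset.sum_insert ha] at ht
    obtain ⟨u, hu, hsum⟩ := ih (t := t - min (w a) t) (by lia)
    refine ⟨Function.update u a (min (w a) t), fun i => ?_, ?_⟩
    · rcases eq_or_ne i a with rfl | hi
      · simp
      · simpa [hi] using hu i
    · rw [Finset.sum_insert ha, Finset.sum_update_of_notMem ha, hsum, Function.update_self]
      lia

/-- The dimension inequality expressed through the codimensions `N - k - finrank (C i)` of
the back-projected planes. -/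
theorem sum_finrank_ge_iff {N k n : ℕ} (hk : k ≤ N) {C : Fin n → Submodule ℂ (Fin (N + 1) → ℂ)}
    (hC : ∀ i, finrank ℂ ↥(C i) ≤ N - k) (I : Finset (Fin n)) (d : ℕ) :
    (∑ i ∈ I, (finrank ℂ ↥(C i) : ℤ)) ≥ ((I.card : ℤ) - 1) * ((N : ℤ) - k) + d ↔
      d + ∑ i ∈ I, (N - k - finrank ℂ ↥(C i)) ≤ N - k := by
  have hsum : ((∑ i ∈ I, (N - k - finrank ℂ ↥(C i)) : ℕ) : ℤ) =
      I.card * ((N : ℤ) - k) - ∑ i ∈ I, (finrank ℂ ↥(C i) : ℤ) := by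
    push_cast [Nat.cast_sum, Nat.cast_sub (hC _), Nat.cast_sub hk]
    simp [Finset.sum_sub_distrib, mul_sub]
  rw [← Nat.cast_le (α := ℤ), Nat.cast_add, hsum, Nat.cast_sub hk, sub_mul]
  constructor <;> intro h <;> linarith

/-- **Paper's Theorem "Pseudo-Disjoint"**: `C` is pseudo-disjoint with respect to `k`
iff for each nonempty `I` with `⨅_{i∈I} C i ≠ ⊥`,
`Σ_{i∈I} finrank (C i) ≥ (|I|-1)(N-k) + finrank (⨅_{i∈I} C i)`. -/
theorem pseudo_disjoint_iff (N k n : ℕ) (hk : k ≤ N) (hn : 1 ≤ n)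
    (C : Fin n → Submodule ℂ (Fin (N + 1) → ℂ))
    (hC : ∀ i, finrank ℂ ↥(C i) ≤ N - k) :
    IsPseudoDisjoint N k n C ↔
      ∀ I : Finset (Fin n), I.Nonempty → (⨅ i ∈ I, C i) ≠ ⊥ →
        (∑ i ∈ I, (finrank ℂ ↥(C i) : ℤ)) ≥
          ((I.card : ℤ) - 1) * ((N : ℤ) - k) + finrank ℂ ↥(⨅ i ∈ I, C i) := by
  simp only [sum_finrank_ge_iff hk hC]
  have hV : finrank ℂ (Fin (N + 1) → ℂ) = N + 1 := by simp
  constructor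
  · intro hpd I
    induction I using Finset.strongInduction with
    | H I ih =>
    intro hI hbot
    by_contra! hviol
    have hc : finrank ℂ ↥(⨅ i ∈ I, C i) ≠ 0 := fun h => hbot (Submodule.finrank_eq_zero.1 h)
    obtain ⟨i₀, hi₀⟩ := hI
    have hcle : finrank ℂ ↥(⨅ i ∈ I, C i) ≤ N - k :=
      (Submodule.finrank_mono (iInf₂_le i₀ hi₀)).trans (hC i₀)
    have hcard : 2 ≤ I.card := by
      by_contra! hlt
      obtain ⟨i, rfl⟩ : ∃ i, I = {i} := Finset.card_eq_one.1
        (le_antisymm (by lia) (Finset.card_pos.2 ⟨i₀, hi₀⟩))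
      have := hC i
      rw [Finset.iInf_singleton, Finset.sum_singleton] at hviol
      lia
    obtain ⟨u, hu, hsum⟩ := exists_le_sum_eq I (fun i => N - k - finrank ℂ ↥(C i))
      (t := N - k + 1 - finrank ℂ ↥(⨅ i ∈ I, C i)) (by lia)
    obtain ⟨T, hCT, hT, hTI⟩ := exists_transversal_of_hall I u C fun J hJ => by
      rcases J.eq_empty_or_nonempty with rfl | hJne
      · simpa using Submodule.finrank_le (⨅ i ∈ (∅ : Finset (Fin n)), C i)
      rcases hJ.eq_or_ssubset with rfl | hss
      · lia
      · have hJbot : ⨅ i ∈ J, C i ≠ ⊥ := fun h =>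
          hbot (le_bot_iff.1 (h ▸ biInf_mono hJ))
        have hJ' := ih J hss hJne hJbot
        have hle := Finset.sum_le_sum fun i (_ : i ∈ J) => hu i
        lia
    have hTge := finrank_le_finrank_iInf_add_sum I T u fun i hi => (hT i hi).ge
    obtain ⟨L, -, hLT, hL⟩ := exists_between_finrank_eq (A := ⊥) (B := ⨅ i ∈ I, T i) bot_le
      (d := k + 1) (by simp) (by lia)
    have hH : ∀ i, ∃ H : Submodule ℂ (Fin (N + 1) → ℂ), C i ⊔ L ≤ H ∧
        (i ∈ I → H ≤ T i) ∧ finrank ℂ ↥H = finrank ℂ ↥(C i) + k + 1 := by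
      intro i
      have hdim := Submodule.finrank_add_le_finrank_add_finrank (C i) L
      have hCi := hC i
      by_cases hi : i ∈ I
      · have hTi := hT i hi
        have hui := hu i
        obtain ⟨H, h₁, h₂, h₃⟩ := exists_between_finrank_eq
          (sup_le (hCT i) (hLT.trans (iInf₂_le i hi))) (d := finrank ℂ ↥(C i) + k + 1)
          (by lia) (by lia)
        exact ⟨H, h₁, fun _ => h₂, h₃⟩
      · obtain ⟨H, h₁, -, h₃⟩ := exists_between_finrank_eq (le_top : C i ⊔ L ≤ ⊤)
          (d := finrank ℂ ↥(C i) + k + 1) (by lia) (by rw [finrank_top]; lia)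
        exact ⟨H, h₁, fun h => absurd h hi, h₃⟩
    choose H hCL hHT hHrank using hH
    have hkey := hpd H (fun i => ⟨le_sup_left.trans (hCL i), hHrank i⟩)
      (hL ▸ Submodule.finrank_mono (le_iInf fun i => le_sup_right.trans (hCL i))) I hcard hbot
    have hle : finrank ℂ ↥(⨅ i ∈ I, H i) ≤ finrank ℂ ↥(⨅ i ∈ I, T i) :=
      Submodule.finrank_mono (iInf₂_mono hHT)
    lia
  · intro h H hH _ I hcard hbot
    have hI := h I (Finset.card_pos.1 (by lia)) hbot
    have hge := finrank_le_finrank_iInf_add_sum I H (fun i => N - k - finrank ℂ ↥(C i))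
      fun i _ => by
        have hHi := (hH i).2
        have hCi := hC i
        lia
    lia
end

section
/- Let k ≤ N, n ≥ 1, and let C 1, …, C n be submodules of V = Fin (N+1) → ℂ with finrank (C i) ≤ N − k for all i. The arrangement (C i) is pseudo-disjoint with respect to k if and only if every tuple (H 1, …, H n) of submodules of V with C i ≤ H i and finrank (H i) = finrank (C i) + k + 1 for all i (with no condition on the total intersection) satisfies: for every I ⊆ Fin n with 2 ≤ |I| and ⨅_{i∈I} C i ≠ ⊥, finrank (⨅_{i∈I} H i) ≥ finrank (⨅_{i∈I} C i) + k + 1. (Paper's Lemma 'Pck Vck': c is pseudo-disjoint with respect to k iff P_{c,k} = P_{c,k} ∩ V_{c,k}.) -/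
open Module

section SubspaceInterpolation

variable {K V : Type*} [Field K] [AddCommGroup V] [Module K V] [FiniteDimensional K V]

/-- Subspaces of every intermediate dimension exist between nested subspaces. -/
theorem Submodule.exists_between_finrank_eq {W U : Submodule K V} (hWU : W ≤ U) {d : ℕ}
    (hW : finrank K W ≤ d) (hU : d ≤ finrank K U) :
    ∃ Z, W ≤ Z ∧ Z ≤ U ∧ finrank K Z = d := by
  induction d, hW using Nat.le_induction with
  | base => exact ⟨W, le_rfl, hWU, rfl⟩
  | succ d _ ih =>
    obtain ⟨Z, hWZ, hZU, hZ⟩ := ih (by omega)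
    have hne : Z ≠ U := by rintro rfl; omega
    obtain ⟨x, hxU, hxZ⟩ := SetLike.exists_of_lt (lt_of_le_of_ne hZU hne)
    refine ⟨Z ⊔ span K {x}, hWZ.trans le_sup_left, sup_le hZU ?_, ?_⟩
    · exact (span_singleton_le_iff_mem x U).2 hxU
    · rw [finrank_sup_span_singleton hxZ, hZ]

/-- Moving `A` to `B` through subspaces of constant dimension containing `A ⊓ B`, the dimension
of the intersection with `X` attains every intermediate value. -/
theorem Submodule.exists_finrank_inf_eq {A B X C : Submodule K V} {m : ℕ}
    (hCA : C ≤ A) (hCB : C ≤ B) (hAB : finrank K A = finrank K B)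
    (hA : finrank K ↥(A ⊓ X) ≤ m) (hB : m ≤ finrank K ↥(B ⊓ X)) :
    ∃ A', C ≤ A' ∧ finrank K A' = finrank K B ∧ finrank K ↥(A' ⊓ X) = m := by
  induction hr : finrank K B - finrank K ↥(A ⊓ B) using Nat.strong_induction_on
    generalizing A with
  | _ r ih =>
    rcases hA.eq_or_lt with heq | hlt
    · exact ⟨A, hCA, hAB, heq⟩
    have hBA : ¬ B ≤ A := fun h ↦ by
      have := eq_of_le_of_finrank_eq h hAB.symm
      subst this
      omega
    have hnAB : A ⊓ B < A := inf_le_left.lt_of_ne fun h ↦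
      hBA (eq_of_le_of_finrank_eq (inf_eq_left.1 h) hAB).ge
    have hlt' := finrank_lt_finrank_of_lt hnAB
    obtain ⟨M, hM, hMA, hMd⟩ := exists_between_finrank_eq hnAB.le (d := finrank K A - 1)
      (by omega) (by omega)
    obtain ⟨b, hbB, hbA⟩ := SetLike.not_le_iff_exists.1 hBA
    have hbM : b ∉ M := fun h ↦ hbA (hMA h)
    set A' := M ⊔ span K {b}
    have hA'd : finrank K A' = finrank K M + 1 := finrank_sup_span_singleton hbM
    have hbA' : b ∈ A' := mem_sup_right (mem_span_singleton_self b)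
    have hMA' : M ≤ A' := le_sup_left
    have hcloser : finrank K ↥(A ⊓ B) < finrank K ↥(A' ⊓ B) := by
      refine finrank_lt_finrank_of_lt (SetLike.lt_iff_le_and_exists.2
        ⟨le_inf (hM.trans hMA') inf_le_right, b, mem_inf.2 ⟨hbA', hbB⟩,
          fun h ↦ hbA (mem_inf.1 h).1⟩)
    have hA'B : finrank K ↥(A' ⊓ B) ≤ finrank K B := finrank_mono inf_le_right
    have hstep : finrank K ↥(A' ⊓ X) ≤ m := by
      have hsum := finrank_sup_add_finrank_inf_eq (A' ⊓ X) M
      have hsup : finrank K ↥(A' ⊓ X ⊔ M) ≤ finrank K A' :=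
        finrank_mono (sup_le inf_le_left hMA')
      have hinf : finrank K ↥(A' ⊓ X ⊓ M) ≤ finrank K ↥(A ⊓ X) :=
        finrank_mono (le_inf (inf_le_right.trans hMA) (inf_le_left.trans inf_le_right))
      omega
    exact ih _ (by omega) ((le_inf hCA hCB).trans (hM.trans hMA')) (by omega) hstep rfl

/-- Tuple version of `Submodule.exists_finrank_inf_eq`. -/
theorem Submodule.exists_finrank_inf_iInf_eq {ι : Type*} [DecidableEq ι]
    {H H' C : ι → Submodule K V} (hCH : ∀ i, C i ≤ H i) (hCH' : ∀ i, C i ≤ H' i)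
    (hd : ∀ i, finrank K (H i) = finrank K (H' i)) {m : ℕ} (I : Finset ι) (Y : Submodule K V)
    (hH : finrank K ↥(Y ⊓ ⨅ i ∈ I, H i) ≤ m) (hH' : m ≤ finrank K ↥(Y ⊓ ⨅ i ∈ I, H' i)) :
    ∃ G : ι → Submodule K V, (∀ i, C i ≤ G i ∧ finrank K (G i) = finrank K (H' i)) ∧
      finrank K ↥(Y ⊓ ⨅ i ∈ I, G i) = m := by
  induction I using Finset.induction_on generalizing Y with
  | empty =>
    have hempty : ∀ G : ι → Submodule K V, Y ⊓ ⨅ i ∈ (∅ : Finset ι), G i = Y := fun G ↦ by simp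
    rw [hempty] at hH hH'
    exact ⟨H', fun i ↦ ⟨hCH' i, rfl⟩, by rw [hempty]; exact le_antisymm hH hH'⟩
  | insert a s has ih =>
    have key : ∀ (G : ι → Submodule K V) (Z : Submodule K V),
        ⨅ i ∈ insert a s, Function.update G a Z i = Z ⊓ ⨅ i ∈ s, G i := fun G Z ↦
      Finset.iInf_insert_update G has
    have hupd : ∀ (G : ι → Submodule K V) (Z : Submodule K V),
        (∀ i, C i ≤ G i ∧ finrank K (G i) = finrank K (H' i)) →
        C a ≤ Z → finrank K Z = finrank K (H' a) →
        ∀ i, C i ≤ Function.update G a Z i ∧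
          finrank K (Function.update G a Z i) = finrank K (H' i) := by
      intro G Z hG hZ hZd i
      rcases eq_or_ne i a with rfl | hi
      · rw [Function.update_self]
        exact ⟨hZ, hZd⟩
      · rw [Function.update_of_ne hi]
        exact hG i
    rw [Finset.iInf_insert] at hH hH'
    rcases le_total (finrank K ↥(Y ⊓ H' a ⊓ ⨅ i ∈ s, H i)) m with h | h
    · obtain ⟨G, hG, hGm⟩ := ih (Y ⊓ H' a) h (by rwa [inf_assoc])
      exact ⟨Function.update G a (H' a), hupd G _ hG (hCH' a) rfl, by
        rw [key, ← inf_assoc, hGm]⟩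
    · obtain ⟨Z, hCZ, hZd, hZm⟩ := exists_finrank_inf_eq (X := Y ⊓ ⨅ i ∈ s, H i)
        (m := m) (hCH a) (hCH' a) (hd a) (by rwa [inf_left_comm])
        (by rwa [inf_left_comm, ← inf_assoc])
      exact ⟨Function.update H a Z, hupd H Z (fun i ↦ ⟨hCH i, hd i⟩) hCZ hZd, by
        rw [key, inf_left_comm, hZm]⟩

end SubspaceInterpolation

/-- **Paper's Lemma "Pck Vck"** (`P_{c,k} = P_{c,k} ∩ V_{c,k}`): `C` is pseudo-disjoint
with respect to `k` iff every tuple of back-projected planes (with no condition on the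
total intersection) satisfies the constraints coming from intersections of centers. -/
theorem pseudo_disjoint_iff_Pck_eq_Pck_Vck (N k n : ℕ) (hk : k ≤ N) (hn : 1 ≤ n)
    (C : Fin n → Submodule ℂ (Fin (N + 1) → ℂ))
    (hC : ∀ i, finrank ℂ ↥(C i) ≤ N - k) :
    IsPseudoDisjoint N k n C ↔
      ∀ H : Fin n → Submodule ℂ (Fin (N + 1) → ℂ),
        (∀ i, C i ≤ H i ∧ finrank ℂ ↥(H i) = finrank ℂ ↥(C i) + k + 1) →
        ∀ I : Finset (Fin n), 2 ≤ I.card → (⨅ i ∈ I, C i) ≠ ⊥ →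
          finrank ℂ ↥(⨅ i ∈ I, H i) ≥ finrank ℂ ↥(⨅ i ∈ I, C i) + k + 1 := by
  classical
  refine ⟨fun hpd H hH I hI hD ↦ ?_, fun h H hH _ ↦ h H hH⟩
  by_contra hlt
  have hext : ∀ W : Submodule ℂ (Fin (N + 1) → ℂ), finrank ℂ W = k + 1 →
      ∀ i, ∃ Z, C i ⊔ W ≤ Z ∧ finrank ℂ Z = finrank ℂ ↥(C i) + k + 1 := by
    intro W hW i
    have hsup := Submodule.finrank_add_le_finrank_add_finrank (C i) W
    have hCi := hC i
    obtain ⟨Z, hZ, -, hZd⟩ := Submodule.exists_between_finrank_eq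
      (le_top : C i ⊔ W ≤ ⊤) (d := finrank ℂ ↥(C i) + k + 1) (by omega)
      (by rw [finrank_top, finrank_fin_fun]; omega)
    exact ⟨Z, hZ, hZd⟩
  obtain ⟨G, hG, hGlo, hGhi⟩ : ∃ G : Fin n → Submodule ℂ (Fin (N + 1) → ℂ),
      (∀ i, C i ≤ G i ∧ finrank ℂ ↥(G i) = finrank ℂ ↥(C i) + k + 1) ∧
      k + 1 ≤ finrank ℂ ↥(⨅ i ∈ I, G i) ∧
      finrank ℂ ↥(⨅ i ∈ I, G i) < finrank ℂ ↥(⨅ i ∈ I, C i) + k + 1 := by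
    rcases le_total (k + 1) (finrank ℂ ↥(⨅ i ∈ I, H i)) with hle | hle
    · exact ⟨H, hH, hle, not_le.1 hlt⟩
    obtain ⟨W, -, -, hW⟩ := Submodule.exists_between_finrank_eq
      (bot_le : (⊥ : Submodule ℂ (Fin (N + 1) → ℂ)) ≤ ⊤) (d := k + 1) (by simp)
      (by rw [finrank_top, finrank_fin_fun]; omega)
    choose H' hWH' hH'd using hext W hW
    obtain ⟨G, hG, hGm⟩ := Submodule.exists_finrank_inf_iInf_eq (H := H) (H' := H') (C := C)
      (m := k + 1) (fun i ↦ (hH i).1) (fun i ↦ le_sup_left.trans (hWH' i))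
      (fun i ↦ (hH i).2.trans (hH'd i).symm) I ⊤ (by rwa [top_inf_eq]) (by
        rw [top_inf_eq, ← hW]
        exact Submodule.finrank_mono (le_iInf₂ fun i _ ↦ le_sup_right.trans (hWH' i)))
    rw [top_inf_eq] at hGm
    have hDpos : finrank ℂ ↥(⨅ i ∈ I, C i) ≠ 0 := fun h ↦ hD (Submodule.finrank_eq_zero.1 h)
    exact ⟨G, fun i ↦ ⟨(hG i).1, (hG i).2.trans (hH'd i)⟩, hGm.ge, by omega⟩
  obtain ⟨W, -, hWG, hW⟩ := Submodule.exists_between_finrank_eq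
    (bot_le : ⊥ ≤ ⨅ i ∈ I, G i) (d := k + 1) (by simp) hGlo
  choose Z hWZ hZd using hext W hW
  have hres : ⨅ i ∈ I, (if i ∈ I then G i else Z i) = ⨅ i ∈ I, G i :=
    iInf_congr fun i ↦ iInf_congr fun hi ↦ if_pos hi
  refine hGhi.not_ge (hres ▸ hpd (fun i ↦ if i ∈ I then G i else Z i) (fun i ↦ ?_) ?_ I hI hD)
  · by_cases hi : i ∈ I
    · rw [if_pos hi]
      exact hG i
    · rw [if_neg hi]
      exact ⟨le_sup_left.trans (hWZ i), hZd i⟩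
  · rw [ge_iff_le, ← hW]
    refine Submodule.finrank_mono (le_iInf fun i ↦ ?_)
    by_cases hi : i ∈ I
    · simpa only [if_pos hi] using hWG.trans (iInf₂_le i hi)
    · simpa only [if_neg hi] using le_sup_right.trans (hWZ i)
end

section
/- Let k ≤ N, n ≥ 1, and let C 1, …, C n be submodules of V = Fin (N+1) → ℂ with finrank (C i) ≤ N − k for all i, and assume the arrangement (C i) is pseudo-disjoint with respect to k. Then the set S = { finrank (⨅ i, (C i ⊔ P)) | P a submodule of V with finrank P = k+1 and P ⊓ C i = ⊥ for all i } has a least element, equal (as an integer) to max ( k + 1, (N + 1) − Σ_i (N − k − finrank (C i)) ). (Paper's Theorem 'pseudo dim': ℓ_{c,k} = max { k, N − Σ_i (h_i − k) } with h_i = N − dim c_i − 1.) -/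
open Module

open Filter Topology

section Perturbation

variable {E F : Type*} [AddCommGroup E] [Module ℂ E] [AddCommGroup F] [Module ℂ F]
  [FiniteDimensional ℂ F]

/-- Linear independence of a finite family persists under small linear perturbations. -/
theorem LinearIndependent.eventually_add_smul {ι : Type*} [Finite ι] {u : ι → F}
    (hu : LinearIndependent ℂ u) (w : ι → F) :
    ∀ᶠ t in 𝓝 (0 : ℂ), LinearIndependent ℂ (fun i => u i + t • w i) := by
  have := Fintype.ofFinite ι
  let e := (finBasis ℂ F).equivFun
  have hcont : Continuous fun t : ℂ => fun i => e (u i) + t • e (w i) := by fun_prop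
  have h0 : LinearIndependent ℂ (fun i => e (u i) + (0 : ℂ) • e (w i)) := by
    simp only [zero_smul, add_zero]
    exact hu.map' e.toLinearMap e.ker
  have h := hcont.continuousAt.eventually (isOpen_setOfPred_linearIndependent.mem_nhds h0)
  filter_upwards [h] with t ht
  refine LinearIndependent.of_comp e.toLinearMap ?_
  have heq : (e.toLinearMap ∘ fun i => u i + t • w i) = fun i => e (u i) + t • e (w i) := by
    ext1 i
    simp
  rw [heq]
  exact ht

theorem Submodule.exists_linearIndependent_map (W : Submodule ℂ E) (f : E →ₗ[ℂ] F) :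
    ∃ u : Fin (finrank ℂ (W.map f)) → E, (∀ i, u i ∈ W) ∧
      LinearIndependent ℂ (fun i => f (u i)) ∧
      Submodule.span ℂ (Set.range fun i => f (u i)) = W.map f := by
  let b := finBasis ℂ (W.map f)
  choose u hu hub using fun i => (b i).2
  refine ⟨u, hu, ?_, ?_⟩
  · simp only [hub]
    exact b.linearIndependent.map' (W.map f).subtype (Submodule.ker_subtype _)
  · simp only [hub]
    have := congrArg (Submodule.map (W.map f).subtype) b.span_eq
    rw [Submodule.map_span, ← Set.range_comp, Submodule.map_subtype_top] at this
    exact this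

theorem LinearIndependent.le_finrank_map {m : ℕ} {W : Submodule ℂ E} {f : E →ₗ[ℂ] F} {y : Fin m → F}
    (hy : LinearIndependent ℂ y) (hmem : ∀ i, y i ∈ W.map f) : m ≤ finrank ℂ (W.map f) := by
  have h : LinearIndependent ℂ (fun i => (⟨y i, hmem i⟩ : W.map f)) :=
    LinearIndependent.of_comp (W.map f).subtype hy
  simpa using h.fintype_card_le_finrank

/-- The rank of a linear map on a subspace is lower semicontinuous along lines. -/
theorem eventually_finrank_map_le (W : Submodule ℂ E) (f g : E →ₗ[ℂ] F) :
    ∀ᶠ t in 𝓝 (0 : ℂ), finrank ℂ (W.map f) ≤ finrank ℂ (W.map (f + t • g)) := by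
  obtain ⟨u, huW, hu, -⟩ := W.exists_linearIndependent_map f
  filter_upwards [hu.eventually_add_smul fun i => g (u i)] with t ht
  exact LinearIndependent.le_finrank_map ht fun i => ⟨u i, huW i, by simp⟩

/-- If the rank of `f` on `W` does not jump in the direction `g`, then `g` maps the kernel of `f`
on `W` into the image of `f` on `W`. -/
theorem apply_mem_map_of_finrank_map_le {W : Submodule ℂ E} {f g : E →ₗ[ℂ] F}
    (hle : ∀ᶠ t in 𝓝 (0 : ℂ), finrank ℂ (W.map (f + t • g)) ≤ finrank ℂ (W.map f))
    {x : E} (hx : x ∈ W) (hfx : f x = 0) : g x ∈ W.map f := by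
  by_contra hgx
  obtain ⟨u, huW, hu, hspan⟩ := W.exists_linearIndependent_map f
  have hli : LinearIndependent ℂ (Fin.cons (g x) (fun i => f (u i)) :
      Fin (finrank ℂ (W.map f) + 1) → F) :=
    linearIndependent_finCons.2 ⟨hu, by rwa [hspan]⟩
  have hev := hli.eventually_add_smul (Fin.cons 0 (fun i => g (u i)))
  have hne : ∀ᶠ t in 𝓝[≠] (0 : ℂ), t ≠ 0 := eventually_mem_nhdsWithin
  obtain ⟨t, ⟨ht, hlet⟩, ht0⟩ :=
    (((hev.and hle).filter_mono nhdsWithin_le_nhds).and hne).exists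
  have := LinearIndependent.le_finrank_map (W := W) (f := f + t • g) ht fun i => by
    refine Fin.cases ?_ (fun j => ?_) i
    · exact ⟨t⁻¹ • x, W.smul_mem _ hx, by simp [hfx, ht0]⟩
    · exact ⟨u j, huW j, by simp⟩
  omega

end Perturbation

section Relations

variable {V : Type*} [AddCommGroup V] [Module ℂ V] {ι : Type*} [Fintype ι]
  {D : Type*} [AddCommGroup D] [Module ℂ D]

theorem finrank_span_range_of_linearIndependent_mkQ {C : Submodule ℂ V} {q : ℕ}
    {p : Fin q → V} (hp : LinearIndependent ℂ (fun j => C.mkQ (p j))) :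
    finrank ℂ (Submodule.span ℂ (Set.range p)) = q ∧
      Submodule.span ℂ (Set.range p) ⊓ C = ⊥ := by
  refine ⟨?_, ?_⟩
  · have := finrank_span_eq_card (LinearIndependent.of_comp C.mkQ hp)
    simpa using this
  · have := Submodule.range_ker_disjoint (f := C.mkQ) (v := p) hp
    rw [Submodule.ker_mkQ] at this
    exact this.eq_bot

/-- A relation of minimal support among members of a family of subspaces. -/
theorem exists_minimal_relation {G : ι → Submodule ℂ D}
    (h : ∃ g : ι → D, g ≠ 0 ∧ (∀ i, g i ∈ G i) ∧ ∑ i, g i = 0) :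
    ∃ g : ι → D, g ≠ 0 ∧ (∀ i, g i ∈ G i) ∧ ∑ i, g i = 0 ∧
      ∀ c : ι → ℂ, ∑ i, c i • g i = 0 → ∃ a : ℂ, ∀ i, g i ≠ 0 → c i = a := by
  classical
  obtain ⟨_, ⟨g, ⟨hg0, hg, hsum⟩, rfl⟩, hmin⟩ := exists_minimal_of_wellFoundedLT
    (fun s : Finset ι => ∃ g : ι → D, (g ≠ 0 ∧ (∀ i, g i ∈ G i) ∧ ∑ i, g i = 0) ∧
      s = Finset.univ.filter fun i => g i ≠ 0) (h.elim fun g hg => ⟨_, g, hg, rfl⟩)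
  refine ⟨g, hg0, hg, hsum, fun c hc => ?_⟩
  obtain ⟨i₀, hi₀⟩ := Function.ne_iff.1 hg0
  refine ⟨c i₀, fun i hi => ?_⟩
  by_contra hne
  have hle := hmin (y := Finset.univ.filter fun i => (c i - c i₀) • g i ≠ 0)
    ⟨fun i => (c i - c i₀) • g i, ⟨?_, fun i => (G i).smul_mem _ (hg i), ?_⟩, rfl⟩ ?_
  · have : i₀ ∈ Finset.univ.filter fun i => (c i - c i₀) • g i ≠ 0 := hle (by simpa using hi₀)
    simp at this
  · exact Function.ne_iff.2 ⟨i, smul_ne_zero (sub_ne_zero.2 hne) hi⟩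
  · simp only [sub_smul, Finset.sum_sub_distrib, hc, ← Finset.smul_sum, hsum, smul_zero, sub_zero]
  · intro j
    simp only [Finset.mem_filter, Finset.mem_univ, true_and]
    exact fun h h0 => h (by simp [h0])

theorem exists_forall_apply_eq {g : ι → Dual ℂ V}
    (hg : ∀ c : ι → ℂ, ∑ i, c i • g i = 0 → ∃ a : ℂ, ∀ i, g i ≠ 0 → c i = a)
    {w : ι → ℂ} (hw : ∑ i, w i = 0) (hw0 : ∀ i, g i = 0 → w i = 0) :
    ∃ v : V, ∀ i, g i v = w i := by
  classical
  suffices w ∈ LinearMap.range (LinearMap.pi g) by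
    obtain ⟨v, hv⟩ := this
    exact ⟨v, fun i => congrFun hv i⟩
  rw [← Subspace.forall_mem_dualAnnihilator_apply_eq_zero_iff]
  intro φ hφ
  rw [Submodule.mem_dualAnnihilator] at hφ
  have h2 : ∀ i : ι, (fun j => if i = j then (1 : ℂ) else 0) = Pi.single i 1 := fun i => by
    ext j; simp [Pi.single_apply, eq_comm]
  obtain ⟨a, ha⟩ := hg (fun i => φ (Pi.single i 1)) (by
    ext v
    have := hφ _ ⟨v, rfl⟩
    rw [LinearMap.pi_apply_eq_sum_univ] at this
    simpa only [h2, LinearMap.pi_apply, smul_eq_mul, LinearMap.coe_sum, Finset.sum_apply,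
      LinearMap.smul_apply, LinearMap.zero_apply, mul_comm] using this)
  have : ∀ i, w i * φ (Pi.single i 1) = w i * a := fun i => by
    by_cases hi : g i = 0
    · simp [hw0 i hi]
    · rw [ha i hi]
  rw [LinearMap.pi_apply_eq_sum_univ]
  simp only [h2, smul_eq_mul, this, ← Finset.sum_mul, hw, zero_mul]

theorem exists_sup_span_singleton_eq {G : Submodule ℂ D} {x : D} (hx0 : x ≠ 0) (hx : x ∈ G) :
    ∃ K : Submodule ℂ D, x ∉ K ∧ K ⊔ Submodule.span ℂ {x} = G := by
  obtain ⟨K, hK⟩ := Submodule.exists_isCompl (Submodule.span ℂ {x})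
  refine ⟨K ⊓ G, fun h => hx0 ?_, ?_⟩
  · exact (Submodule.disjoint_def.1 hK.disjoint) x (Submodule.mem_span_singleton_self x) h.1
  · rw [sup_comm, ← sup_inf_assoc_of_le K ((Submodule.span_singleton_le_iff_mem x G).2 hx),
      hK.sup_eq_top, top_inf_eq]

end Relations

section Generic

variable {V : Type*} [AddCommGroup V] [Module ℂ V] [FiniteDimensional ℂ V]

theorem exists_forall_linearIndependent_mkQ {ι : Type*} [Finite ι] (C : ι → Submodule ℂ V)
    (q : ℕ) (hq : ∀ i, finrank ℂ (C i) + q ≤ finrank ℂ V) :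
    ∃ p : Fin q → V, ∀ i, LinearIndependent ℂ (fun j => (C i).mkQ (p j)) := by
  induction q with
  | zero => exact ⟨Fin.elim0, fun i => linearIndependent_empty_type⟩
  | succ q ih =>
    obtain ⟨p, hp⟩ := ih fun i => by have := hq i; omega
    let S : ι → Submodule ℂ V := fun i =>
      (Submodule.span ℂ (Set.range fun j => (C i).mkQ (p j))).comap (C i).mkQ
    have hS : ∀ i, S i ≠ ⊤ := fun i hi => by
      have h1 : Submodule.span ℂ (Set.range fun j => (C i).mkQ (p j)) = ⊤ := by
        rw [← Submodule.map_comap_eq_of_surjective (C i).mkQ_surjective (Submodule.span ℂ _)]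
        change (S i).map _ = ⊤
        rw [hi, Submodule.map_top, Submodule.range_mkQ]
      have h2 := finrank_range_le_card (R := ℂ) (fun j => (C i).mkQ (p j))
      rw [Set.finrank, h1, finrank_top, Fintype.card_fin] at h2
      have h3 := (C i).finrank_quotient_add_finrank
      have := hq i
      omega
    obtain ⟨x, hx⟩ : ∃ x, ∀ i, x ∉ S i := by
      by_contra! h
      obtain ⟨i, hi⟩ := Subspace.exists_eq_top_of_iUnion_eq_univ (p := S)
        (Set.eq_univ_of_forall fun x => Set.mem_iUnion.2 (h x))
      exact hS i hi
    refine ⟨Fin.cons x p, fun i => ?_⟩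
    have : (fun j => (C i).mkQ ((Fin.cons x p : Fin (q + 1) → V) j)) =
        Fin.cons ((C i).mkQ x) (fun j => (C i).mkQ (p j)) := by
      ext1 j
      refine Fin.cases ?_ (fun j => ?_) j <;> simp
    rw [this]
    exact linearIndependent_finCons.2 ⟨hp i, hx i⟩

variable {ι : Type*} [Fintype ι] {D : Type*} [AddCommGroup D] [Module ℂ D]
  [FiniteDimensional ℂ D]

theorem finrank_iSup_le_sum_finrank (G : ι → Submodule ℂ D) :
    finrank ℂ ↥(⨆ i, G i) ≤ ∑ i, finrank ℂ (G i) := by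
  classical
  have key : ∀ s : Finset ι, finrank ℂ ↥(⨆ i ∈ s, G i) ≤ ∑ i ∈ s, finrank ℂ (G i) := by
    intro s
    induction s using Finset.induction_on with
    | empty => simp
    | insert a s ha ih =>
      rw [Finset.iSup_insert, Finset.sum_insert ha]
      exact (Submodule.finrank_add_le_finrank_add_finrank _ _).trans (by omega)
  have := key Finset.univ
  rwa [show (⨆ i ∈ Finset.univ, G i) = ⨆ i, G i by simp] at this

theorem exists_sum_eq_zero_of_finrank_iSup_lt {G : ι → Submodule ℂ D}
    (h : finrank ℂ ↥(⨆ i, G i) < ∑ i, finrank ℂ (G i)) :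
    ∃ g : ι → D, g ≠ 0 ∧ (∀ i, g i ∈ G i) ∧ ∑ i, g i = 0 := by
  let S : (∀ i, G i) →ₗ[ℂ] ↥(⨆ i, G i) :=
    ∑ i, (Submodule.inclusion (le_iSup G i)).comp (LinearMap.proj i)
  have hker : LinearMap.ker S ≠ ⊥ := by
    apply LinearMap.ker_ne_bot_of_finrank_lt
    rwa [Module.finrank_pi_fintype]
  obtain ⟨g, hg, hg0⟩ := (Submodule.ne_bot_iff _).1 hker
  refine ⟨fun i => g i, fun h0 => hg0 ?_, fun i => (g i).2, ?_⟩
  · ext i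
    exact congrFun h0 i
  · have := congrArg (Subtype.val) (LinearMap.mem_ker.1 hg)
    simpa [S] using this

/-- The family of values of the functionals `a i` at the points `p j`. -/
def evalFamily {ι : Type*} {q : ℕ} (p : Fin q → V) :
    (ι → Dual ℂ V) →ₗ[ℂ] (ι → Fin q → ℂ) where
  toFun a i j := a i (p j)
  map_add' _ _ := rfl
  map_smul' _ _ := rfl

/-- The sum of the functionals `a i`, together with their values at the points `p j`. -/
def sumProdEvalFamily (ι : Type*) [Fintype ι] {q : ℕ} (p : Fin q → V) :
    (ι → Dual ℂ V) →ₗ[ℂ] Dual ℂ V × (ι → Fin q → ℂ) :=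
  (∑ i, LinearMap.proj i).prod (evalFamily p)

/-- For a general tuple of points `p`, every relation among functionals vanishing on `p` can be
deformed to first order along any deformation of `p`. -/
theorem exists_linearIndependent_mkQ_and_deformation (C : ι → Submodule ℂ V)
    (A : ι → Submodule ℂ (Dual ℂ V)) (q : ℕ)
    (hq : ∀ i, finrank ℂ (C i) + q ≤ finrank ℂ V) :
    ∃ p : Fin q → V, (∀ i, LinearIndependent ℂ (fun j => (C i).mkQ (p j))) ∧
      ∀ (I : Finset ι) (v : Fin q → V) (g : ι → Dual ℂ V), (∀ i, g i ∈ A i) →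
        (∀ i ∉ I, g i = 0) → ∑ i, g i = 0 → (∀ i j, g i (p j) = 0) →
        ∃ b : ι → Dual ℂ V, (∀ i, b i ∈ A i) ∧ (∀ i ∉ I, b i = 0) ∧ ∑ i, b i = 0 ∧
          ∀ i j, b i (p j) = g i (v j) := by
  classical
  let W : Finset ι → Submodule ℂ (ι → Dual ℂ V) := fun I =>
    Submodule.pi Set.univ fun i => if i ∈ I then A i else ⊥
  have hW : ∀ I a, a ∈ W I ↔ (∀ i, a i ∈ A i) ∧ ∀ i ∉ I, a i = 0 := by
    intro I a
    simp only [W, Submodule.mem_pi, Set.mem_univ, true_implies, ← forall_and]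
    refine forall_congr' fun i => ?_
    by_cases hi : i ∈ I
    · simp [hi]
    · simp only [hi, if_false, Submodule.mem_bot, not_false_eq_true, true_implies]
      exact ⟨fun h => ⟨h ▸ (A i).zero_mem, h⟩, fun h => h.2⟩
  let f : (Fin q → V) → ℕ := fun p => ∑ I, finrank ℂ ((W I).map (sumProdEvalFamily ι p))
  let U : Set (Fin q → V) := {p | ∀ i, LinearIndependent ℂ (fun j => (C i).mkQ (p j))}
  have hU : (f '' U).Nonempty := Set.Nonempty.image _ (exists_forall_linearIndependent_mkQ C q hq)
  have hbdd : BddAbove (f '' U) := by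
    refine ⟨∑ _I : Finset ι, finrank ℂ (Dual ℂ V × (ι → Fin q → ℂ)), ?_⟩
    rintro _ ⟨p, -, rfl⟩
    exact Finset.sum_le_sum fun I _ => Submodule.finrank_le _
  obtain ⟨p, hpU, hp⟩ := Nat.sSup_mem hU hbdd
  have hmax : ∀ p' ∈ U, f p' ≤ f p := fun p' hp' =>
    (le_csSup hbdd (Set.mem_image_of_mem f hp')).trans hp.ge
  refine ⟨p, hpU, fun I v g hgA hgI hgsum hgp => ?_⟩
  have hlin : ∀ t : ℂ, sumProdEvalFamily ι (p + t • v) = sumProdEvalFamily ι p +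
      t • (0 : (ι → Dual ℂ V) →ₗ[ℂ] Dual ℂ V).prod (evalFamily v) := by
    intro t
    refine LinearMap.ext fun a => ?_
    ext <;> simp [sumProdEvalFamily, evalFamily]
  have hUev : ∀ᶠ t in 𝓝 (0 : ℂ), p + t • v ∈ U := by
    refine eventually_all.2 fun i => ?_
    filter_upwards [(hpU i).eventually_add_smul fun j => (C i).mkQ (v j)] with t ht
    simpa using ht
  have hrank : ∀ᶠ t in 𝓝 (0 : ℂ), finrank ℂ ((W I).map (sumProdEvalFamily ι p +
      t • (0 : (ι → Dual ℂ V) →ₗ[ℂ] Dual ℂ V).prod (evalFamily v))) ≤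
      finrank ℂ ((W I).map (sumProdEvalFamily ι p)) := by
    have hsemi := eventually_all.2 fun J : Finset ι => eventually_finrank_map_le (W J)
      (sumProdEvalFamily ι p) ((0 : (ι → Dual ℂ V) →ₗ[ℂ] Dual ℂ V).prod (evalFamily v))
    filter_upwards [hUev, hsemi] with t htU ht
    have hle : ∀ J, finrank ℂ ((W J).map (sumProdEvalFamily ι p)) ≤
        finrank ℂ ((W J).map (sumProdEvalFamily ι (p + t • v))) := fun J => by
      rw [hlin t]
      exact ht J
    rw [← hlin t]
    by_contra! hlt
    have := hmax _ htU
    exact this.not_gt (Finset.sum_lt_sum (fun J _ => hle J) ⟨I, Finset.mem_univ _, hlt⟩)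
  have hg0 : sumProdEvalFamily ι p g = 0 := by
    ext <;> simp [sumProdEvalFamily, evalFamily, hgsum, hgp]
  obtain ⟨b, hb, hbeq⟩ := apply_mem_map_of_finrank_map_le hrank ((hW I g).2 ⟨hgA, hgI⟩) hg0
  obtain ⟨hbA, hbI⟩ := (hW I b).1 hb
  have h1 := congrArg Prod.fst hbeq
  have h2 := congrArg Prod.snd hbeq
  refine ⟨b, hbA, hbI, ?_, fun i j => ?_⟩
  · simpa [sumProdEvalFamily] using h1
  · exact congrFun (congrFun h2 i) j

theorem finrank_dualAnnihilator_add (C : Submodule ℂ V) :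
    finrank ℂ C.dualAnnihilator + finrank ℂ C = finrank ℂ V := by
  rw [add_comm, Subspace.finrank_add_finrank_dualAnnihilator_eq]

theorem finrank_sup_span_singleton {K : Submodule ℂ D} {x : D} (hx : x ∉ K) :
    finrank ℂ ↥(K ⊔ Submodule.span ℂ {x}) = finrank ℂ K + 1 := by
  have hx0 : x ≠ 0 := fun h => hx (h ▸ K.zero_mem)
  have h := Submodule.finrank_sup_add_finrank_inf_eq K (Submodule.span ℂ {x})
  rwa [((Submodule.disjoint_span_singleton' hx0).2 hx).eq_bot, finrank_bot,
    finrank_span_singleton hx0] at h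

/-- For a general subspace `P` of dimension `q`, if the annihilators of the spaces `C i ⊔ P` are
not independent, then they can be modified without changing dimensions, so that the sum of all of
them grows by at most one, while some partial sum becomes larger than its expected size. -/
theorem exists_general_span_and_modification (C : ι → Submodule ℂ V) (q : ℕ) (hq0 : 0 < q)
    (hq : ∀ i, finrank ℂ (C i) + q ≤ finrank ℂ V) :
    ∃ p : Fin q → V, (∀ i, LinearIndependent ℂ (fun j => (C i).mkQ (p j))) ∧
      (finrank ℂ ↥(⨆ i, (C i ⊔ Submodule.span ℂ (Set.range p)).dualAnnihilator) <
          ∑ i, finrank ℂ (C i ⊔ Submodule.span ℂ (Set.range p)).dualAnnihilator →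
        ∃ (G : ι → Submodule ℂ (Dual ℂ V)) (I : Finset ι), 2 ≤ I.card ∧
          (∀ i, G i ≤ (C i).dualAnnihilator ∧ finrank ℂ (G i) =
            finrank ℂ (C i ⊔ Submodule.span ℂ (Set.range p)).dualAnnihilator) ∧
          finrank ℂ ↥(⨆ i, G i) ≤
            finrank ℂ ↥(⨆ i, (C i ⊔ Submodule.span ℂ (Set.range p)).dualAnnihilator) + 1 ∧
          (⨆ i ∈ I, (C i).dualAnnihilator) ⊓
              (Submodule.span ℂ (Set.range p)).dualAnnihilator ≤
            ⨆ i, (C i ⊔ Submodule.span ℂ (Set.range p)).dualAnnihilator ∧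
          finrank ℂ ↥(⨆ i ∈ I, (C i).dualAnnihilator) < finrank ℂ ↥(⨆ i ∈ I, G i) + q) := by
  classical
  obtain ⟨p, hp, hdef⟩ := exists_linearIndependent_mkQ_and_deformation C
    (fun i => (C i).dualAnnihilator) q hq
  refine ⟨p, hp, fun hlt => ?_⟩
  set P := Submodule.span ℂ (Set.range p) with hP
  have hPmem : ∀ φ : Dual ℂ V, φ ∈ P.dualAnnihilator ↔ ∀ j, φ (p j) = 0 := by
    intro φ
    rw [Submodule.mem_dualAnnihilator]
    refine ⟨fun h j => h _ (Submodule.subset_span ⟨j, rfl⟩), fun h w hw => ?_⟩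
    have : P ≤ LinearMap.ker φ := Submodule.span_le.2 (by rintro _ ⟨j, rfl⟩; exact h j)
    exact this hw
  have hG : ∀ i, (C i ⊔ P).dualAnnihilator = (C i).dualAnnihilator ⊓ P.dualAnnihilator :=
    fun i => Submodule.dualAnnihilator_sup_eq _ _
  obtain ⟨g, hg0, hgG, hgsum, hgmin⟩ :=
    exists_minimal_relation (exists_sum_eq_zero_of_finrank_iSup_lt hlt)
  simp only [hG, Submodule.mem_inf] at hgG
  let I : Finset ι := Finset.univ.filter fun i => g i ≠ 0
  have hI : ∀ i ∉ I, g i = 0 := fun i hi => by simpa [I] using hi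
  have hcut : (⨆ i ∈ I, (C i).dualAnnihilator) ⊓ P.dualAnnihilator ≤
      ⨆ i ∈ I, (C i).dualAnnihilator ⊓ P.dualAnnihilator := by
    rintro x ⟨hxA, hxP⟩
    obtain ⟨a, rfl⟩ := (Submodule.mem_iSup_finset_iff_exists_sum _ _).1 hxA
    rw [SetLike.mem_coe, hPmem] at hxP
    have hv : ∀ j, ∃ v : V, ∀ i, g i v = if i ∈ I then (a i : Dual ℂ V) (p j) else 0 := by
      intro j
      refine exists_forall_apply_eq hgmin ?_ fun i hi => if_neg (by simp [I, hi])
      have := hxP j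
      simpa [Finset.sum_ite_mem] using this
    choose v hv using hv
    obtain ⟨b, hbA, hbI, hbsum, hb⟩ := hdef I v g (fun i => (hgG i).1) hI hgsum
      fun i => (hPmem _).1 (hgG i).2
    have hbsum' : ∑ i ∈ I, b i = 0 := by
      rw [← hbsum]
      exact Finset.sum_subset (Finset.subset_univ _) fun i _ hi => hbI i hi
    rw [← sub_zero (∑ i ∈ I, _), ← hbsum', ← Finset.sum_sub_distrib]
    refine Submodule.sum_mem _ fun i hi => Submodule.mem_iSup_of_mem i
      (Submodule.mem_iSup_of_mem hi ⟨Submodule.sub_mem _ (a i).2 (hbA i), ?_⟩)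
    rw [SetLike.mem_coe, hPmem]
    intro j
    rw [LinearMap.sub_apply, hb, hv, if_pos hi, sub_self]
  obtain ⟨i₀, hi₀⟩ := Function.ne_iff.1 hg0
  have hi₀I : i₀ ∈ I := by simpa [I] using hi₀
  have hcard : 2 ≤ I.card := by
    by_contra! hlt
    have hIs : I = {i₀} := by
      refine Finset.eq_singleton_iff_unique_mem.2 ⟨hi₀I, fun i hi => ?_⟩
      exact Finset.card_le_one.1 (by omega) i hi i₀ hi₀I
    have : ∑ i ∈ I, g i = 0 := by
      rw [← hgsum]
      exact Finset.sum_subset (Finset.subset_univ _) fun i _ hi => hI i hi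
    rw [hIs, Finset.sum_singleton] at this
    exact hi₀ this
  obtain ⟨x, hxA, hxP⟩ : ∃ x ∈ (C i₀).dualAnnihilator, x ∉ P.dualAnnihilator := by
    by_contra! h
    have h1 := hG i₀
    rw [inf_eq_left.2 h] at h1
    have h2 := finrank_dualAnnihilator_add (C i₀)
    have h3 := finrank_dualAnnihilator_add (C i₀ ⊔ P)
    obtain ⟨h4, h5⟩ := finrank_span_range_of_linearIndependent_mkQ (hp i₀)
    have h6 := Submodule.finrank_sup_add_finrank_inf_eq (C i₀) P
    rw [inf_comm, h5, finrank_bot, h4] at h6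
    rw [h1] at h3
    omega
  obtain ⟨K, hK, hKsup⟩ := exists_sup_span_singleton_eq hi₀
    (show g i₀ ∈ (C i₀).dualAnnihilator ⊓ P.dualAnnihilator from hgG i₀)
  have hxK : x ∉ K := fun h => hxP ((le_sup_left.trans hKsup.le) h).2
  let G : ι → Submodule ℂ (Dual ℂ V) := Function.update
    (fun i => (C i).dualAnnihilator ⊓ P.dualAnnihilator) i₀ (K ⊔ Submodule.span ℂ {x})
  have hGi₀ : G i₀ = K ⊔ Submodule.span ℂ {x} := Function.update_self ..
  have hGne : ∀ i ≠ i₀, G i = (C i).dualAnnihilator ⊓ P.dualAnnihilator :=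
    fun i hi => Function.update_of_ne hi ..
  have hKle : K ≤ (C i₀).dualAnnihilator ⊓ P.dualAnnihilator := hKsup ▸ le_sup_left
  refine ⟨G, I, hcard, fun i => ?_, ?_, hcut.trans ?_, ?_⟩
  · rcases eq_or_ne i i₀ with rfl | hi
    · rw [hGi₀, hG]
      refine ⟨sup_le (hKle.trans inf_le_left) ?_, ?_⟩
      · rwa [Submodule.span_singleton_le_iff_mem]
      · rw [← hKsup, finrank_sup_span_singleton hxK, finrank_sup_span_singleton hK]
    · rw [hGne i hi, hG]
      exact ⟨inf_le_left, rfl⟩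
  · rw [iSup_congr hG]
    have hle : ⨆ i, G i ≤ (⨆ i, (C i).dualAnnihilator ⊓ P.dualAnnihilator) ⊔
        Submodule.span ℂ {x} := by
      refine iSup_le fun i => ?_
      rcases eq_or_ne i i₀ with rfl | hi
      · rw [hGi₀]
        exact sup_le_sup_right (hKle.trans (le_iSup
          (fun i => (C i).dualAnnihilator ⊓ P.dualAnnihilator) i)) _
      · rw [hGne i hi]
        exact (le_iSup (fun i => (C i).dualAnnihilator ⊓ P.dualAnnihilator) i).trans le_sup_left
    refine (Submodule.finrank_mono hle).trans
      ((Submodule.finrank_add_le_finrank_add_finrank _ _).trans ?_)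
    gcongr
    simpa using finrank_span_le_card (R := ℂ) ({x} : Set (Dual ℂ V))
  · rw [iSup_congr hG]
    exact iSup₂_le fun i _ =>
      le_iSup (fun i => (C i).dualAnnihilator ⊓ P.dualAnnihilator) i
  · have hGI : ∀ i ∈ I, G i ≤ ⨆ i ∈ I, G i := fun i hi => le_iSup₂_of_le i hi le_rfl
    have hgi₀ : g i₀ ∈ ⨆ i ∈ I, G i := by
      have hsum : g i₀ + ∑ i ∈ Finset.univ.erase i₀, g i = 0 := by
        rw [Finset.add_sum_erase _ _ (Finset.mem_univ i₀), hgsum]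
      rw [eq_neg_of_add_eq_zero_left hsum]
      refine Submodule.neg_mem _ (Submodule.sum_mem _ fun i hi => ?_)
      by_cases hiI : i ∈ I
      · refine hGI i hiI ?_
        rw [hGne i (Finset.ne_of_mem_erase hi)]
        exact hgG i
      · rw [hI i hiI]
        exact Submodule.zero_mem _
    have hlt : (⨆ i ∈ I, (C i).dualAnnihilator) ⊓ P.dualAnnihilator < ⨆ i ∈ I, G i := by
      refine lt_of_le_of_ne (hcut.trans (iSup₂_le fun i hi => ?_)) fun heq => ?_
      · rcases eq_or_ne i i₀ with rfl | hne
        · rw [← hKsup, sup_le_iff, Submodule.span_singleton_le_iff_mem]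
          exact ⟨(le_sup_left.trans hGi₀.ge).trans (hGI i hi), hgi₀⟩
        · rw [← hGne i hne]
          exact hGI i hi
      · have hx : x ∈ ⨆ i ∈ I, G i := hGI i₀ hi₀I (by
          rw [hGi₀]
          exact Submodule.mem_sup_right (Submodule.mem_span_singleton_self x))
        rw [← heq] at hx
        exact hxP hx.2
    have h1 := Submodule.finrank_lt_finrank_of_lt hlt
    have h2 := Submodule.finrank_sup_add_finrank_inf_eq (⨆ i ∈ I, (C i).dualAnnihilator)
      P.dualAnnihilator
    have h3 := Submodule.finrank_le ((⨆ i ∈ I, (C i).dualAnnihilator) ⊔ P.dualAnnihilator)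
    have h4 := finrank_dualAnnihilator_add P
    rw [(finrank_span_range_of_linearIndependent_mkQ (hp i₀)).1] at h4
    rw [Subspace.dual_finrank_eq] at h3
    omega

theorem finrank_iInf_add_finrank_iSup_dualAnnihilator (H : ι → Submodule ℂ V) :
    finrank ℂ ↥(⨅ i, H i) + finrank ℂ ↥(⨆ i, (H i).dualAnnihilator) = finrank ℂ V := by
  rw [← Subspace.dualAnnihilator_iInf_eq, add_comm]
  exact finrank_dualAnnihilator_add _

theorem finrank_biInf_add_finrank_biSup_dualAnnihilator (H : ι → Submodule ℂ V)
    (I : Finset ι) :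
    finrank ℂ ↥(⨅ i ∈ I, H i) + finrank ℂ ↥(⨆ i ∈ I, (H i).dualAnnihilator) = finrank ℂ V := by
  have : (⨆ i ∈ I, (H i).dualAnnihilator) = (⨅ i ∈ I, H i).dualAnnihilator := by
    rw [Subspace.dualAnnihilator_iInf_eq]
    refine iSup_congr fun i => ?_
    by_cases hi : i ∈ I <;> simp [hi]
  rw [this, add_comm]
  exact finrank_dualAnnihilator_add _

end Generic

/-- **Paper's Theorem "pseudo dim"**: for a pseudo-disjoint arrangement,
`ℓ_{c,k} = max { k, N − Σ_i (h_i − k) }`, phrased with cones: the least element of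
`S = { finrank (⨅ i, C i ⊔ P) : finrank P = k+1, P ⊓ C i = ⊥ ∀ i }` equals
`max (k + 1, (N+1) − Σ_i (N − k − finrank (C i)))`. -/
theorem pseudo_disjoint_lck (N k n : ℕ) (hk : k ≤ N) (hn : 1 ≤ n)
    (C : Fin n → Submodule ℂ (Fin (N + 1) → ℂ))
    (hC : ∀ i, finrank ℂ ↥(C i) ≤ N - k)
    (hpd : IsPseudoDisjoint N k n C) :
    ∃ L : ℕ,
      IsLeast
        { r : ℕ | ∃ P : Submodule ℂ (Fin (N + 1) → ℂ),
            finrank ℂ ↥P = k + 1 ∧ (∀ i, P ⊓ C i = ⊥) ∧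
            r = finrank ℂ ↥(⨅ i, C i ⊔ P) } L ∧
      (L : ℤ) = max ((k : ℤ) + 1)
        (((N : ℤ) + 1) - ∑ i, ((N : ℤ) - k - finrank ℂ ↥(C i))) := by
  have hd : finrank ℂ (Fin (N + 1) → ℂ) = N + 1 := by simp
  have hq : ∀ i, finrank ℂ (C i) + (k + 1) ≤ finrank ℂ (Fin (N + 1) → ℂ) := fun i => by
    have := hC i
    omega
  have : Nonempty (Fin n) := ⟨⟨0, hn⟩⟩
  have hann : ∀ P : Submodule ℂ (Fin (N + 1) → ℂ), finrank ℂ P = k + 1 → (∀ i, P ⊓ C i = ⊥) →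
      ∀ i, finrank ℂ (C i ⊔ P).dualAnnihilator + finrank ℂ (C i) + (k + 1) = N + 1 := by
    intro P hP hPC i
    have h1 := Submodule.finrank_sup_add_finrank_inf_eq (C i) P
    have h2 := finrank_dualAnnihilator_add (C i ⊔ P)
    rw [inf_comm, hPC i, finrank_bot] at h1
    omega
  have hsum : ∀ P : Submodule ℂ (Fin (N + 1) → ℂ), finrank ℂ P = k + 1 →
      (∀ i, P ⊓ C i = ⊥) → ∑ i, ((N : ℤ) - k - finrank ℂ ↥(C i)) =
        ((∑ i, finrank ℂ (C i ⊔ P).dualAnnihilator : ℕ) : ℤ) := by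
    intro P hP hPC
    rw [Nat.cast_sum]
    refine Finset.sum_congr rfl fun i _ => ?_
    have := hann P hP hPC i
    omega
  have hlower : ∀ P : Submodule ℂ (Fin (N + 1) → ℂ), finrank ℂ P = k + 1 →
      (∀ i, P ⊓ C i = ⊥) → max ((k : ℤ) + 1)
        (((N : ℤ) + 1) - ∑ i, ((N : ℤ) - k - finrank ℂ ↥(C i))) ≤
        finrank ℂ ↥(⨅ i, C i ⊔ P) := by
    intro P hP hPC
    have h1 : finrank ℂ P ≤ finrank ℂ ↥(⨅ i, C i ⊔ P) :=
      Submodule.finrank_mono (le_iInf fun i => le_sup_right)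
    have h2 := finrank_iInf_add_finrank_iSup_dualAnnihilator fun i => C i ⊔ P
    have h3 := finrank_iSup_le_sum_finrank fun i => (C i ⊔ P).dualAnnihilator
    rw [hsum P hP hPC]
    omega
  obtain ⟨p, hp, hmod⟩ := exists_general_span_and_modification C (k + 1) k.succ_pos hq
  obtain ⟨hP, -⟩ := finrank_span_range_of_linearIndependent_mkQ (hp ⟨0, hn⟩)
  have hPC := fun i => (finrank_span_range_of_linearIndependent_mkQ (hp i)).2
  set P := Submodule.span ℂ (Set.range p)
  have heq : (finrank ℂ ↥(⨅ i, C i ⊔ P) : ℤ) = max ((k : ℤ) + 1)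
      (((N : ℤ) + 1) - ∑ i, ((N : ℤ) - k - finrank ℂ ↥(C i))) := by
    refine le_antisymm ?_ (hlower P hP hPC)
    by_contra! hlt
    rw [hsum P hP hPC] at hlt
    have hdual := finrank_iInf_add_finrank_iSup_dualAnnihilator fun i => C i ⊔ P
    obtain ⟨G, I, hI, hG, hGsup, hcut, hGI⟩ := hmod (by omega)
    let H : Fin n → Submodule ℂ (Fin (N + 1) → ℂ) := fun i => (G i).dualCoannihilator
    have hH : ∀ i, (H i).dualAnnihilator = G i :=
      fun i => Subspace.dualCoannihilator_dualAnnihilator_eq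
    have hHdual := finrank_iInf_add_finrank_iSup_dualAnnihilator H
    have hHI := finrank_biInf_add_finrank_biSup_dualAnnihilator H I
    have hCI := finrank_biInf_add_finrank_biSup_dualAnnihilator C I
    rw [iSup_congr hH] at hHdual
    rw [iSup_congr fun i => iSup_congr fun _ => hH i] at hHI
    have := hpd H (fun i => ⟨?_, ?_⟩) (by omega) I hI ?_
    · omega
    · rw [← Subspace.dualAnnihilator_le_dualAnnihilator_iff, hH]
      exact (hG i).1
    · have h1 := finrank_dualAnnihilator_add (H i)
      have h2 := hann P hP hPC i
      have h3 := (hG i).2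
      rw [hH] at h1
      omega
    · intro hbot
      have htop : (⨆ i ∈ I, (C i).dualAnnihilator) = ⊤ := by
        apply Submodule.eq_top_of_finrank_eq
        rw [hbot, finrank_bot] at hCI
        rw [Subspace.dual_finrank_eq]
        omega
      rw [htop, top_inf_eq] at hcut
      have h1 := Submodule.finrank_mono hcut
      have h2 := finrank_dualAnnihilator_add P
      omega
  refine ⟨finrank ℂ ↥(⨅ i, C i ⊔ P), ⟨⟨P, hP, hPC, rfl⟩, ?_⟩, heq⟩
  rintro _ ⟨Q, hQ, hQC, rfl⟩
  have := hlower Q hQ hQC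
  omega
end

section
/- Let k ≤ N, n ≥ 1, and let C 1, …, C n be submodules of V = Fin (N+1) → ℂ with finrank (C i) ≤ N − k for all i. Assume L is the least element of the set S = { finrank (⨅ i, (C i ⊔ P)) | finrank P = k+1, P ⊓ C i = ⊥ for all i }. Then (k+1)·(N+1−L) is the greatest element of the set { h : ℕ | ∃ m : Fin n → ℕ, Σ_i m i = h and for every nonempty I ⊆ Fin n, Σ_{i∈I} m i ≤ (k+1)·(N − k − finrank (⨅_{i∈I} C i)) }. (Paper's Theorem 'dim other': dim M_{c,k} = max { h : M_{c,k}(h) ≠ ∅ }, where dim M_{c,k} = (k+1)(N − ℓ_{c,k}) by the paper's Proposition 3.4.) -/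
open Module

section Combinatorics

variable {ι : Type*} [Fintype ι] [DecidableEq ι]

/-- The maximal integral solution of a system of intersecting submodular upper bounds has total at
least the total of any solution of the system scaled by `s`, divided by `s`. -/
theorem exists_sum_le_of_intersecting_submodular (g : Finset ι → ℤ)
    (hg : ∀ I : Finset ι, I.Nonempty → 0 ≤ g I)
    (hsub : ∀ I J : Finset ι, (I ∩ J).Nonempty → g (I ∪ J) + g (I ∩ J) ≤ g I + g J)
    (s : ℕ) (m : ι → ℕ)
    (hm : ∀ I : Finset ι, I.Nonempty → ((∑ i ∈ I, m i : ℕ) : ℤ) ≤ s * g I) :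
    ∃ m' : ι → ℕ, (∀ I : Finset ι, I.Nonempty → ((∑ i ∈ I, m' i : ℕ) : ℤ) ≤ g I) ∧
      ∑ i, m i ≤ s * ∑ i, m' i := by
  let feasible : (ι → ℕ) → Prop := fun m' ↦
    ∀ I : Finset ι, I.Nonempty → ((∑ i ∈ I, m' i : ℕ) : ℤ) ≤ g I
  obtain ⟨m', hm', hmax⟩ : ∃ m', feasible m' ∧ ∀ m'', feasible m'' → ∑ i, m'' i ≤ ∑ i, m' i := by
    let totals : Set ℕ := {t | ∃ m', feasible m' ∧ ∑ i, m' i = t}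
    have hne : totals.Nonempty := ⟨_, 0, fun I hI ↦ by simpa using hg I hI, rfl⟩
    have hbdd : BddAbove totals := by
      refine ⟨(g Finset.univ).toNat, ?_⟩
      rintro t ⟨m', hm', rfl⟩
      rcases isEmpty_or_nonempty ι with h | h
      · simp
      · have := hm' Finset.univ Finset.univ_nonempty
        omega
    obtain ⟨m', hm', ht⟩ := Nat.sSup_mem hne hbdd
    exact ⟨m', hm', fun m'' h ↦ ht ▸ le_csSup hbdd ⟨m'', h, rfl⟩⟩
  refine ⟨m', hm', ?_⟩
  let tight : Finset ι → Prop := fun I ↦ ((∑ i ∈ I, m' i : ℕ) : ℤ) = g I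
  have tight_union (I J : Finset ι) (hI : tight I) (hJ : tight J) (hIJ : (I ∩ J).Nonempty) :
      tight (I ∪ J) := by
    have h1 := hsub I J hIJ
    have h2 := hm' _ hIJ
    have h3 := hm' (I ∪ J) (hIJ.mono (Finset.inter_subset_left.trans Finset.subset_union_left))
    have h4 := Finset.sum_union_inter (s₁ := I) (s₂ := J) (f := m')
    simp only [tight] at hI hJ ⊢
    omega
  have exists_tight (i : ι) : ∃ I, i ∈ I ∧ tight I := by
    by_contra! h
    have hf : feasible (m' + Pi.single i 1) := by
      intro I hI
      have h1 := hm' I hI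
      simp only [Pi.add_apply, Finset.sum_add_distrib, Finset.sum_pi_single']
      split_ifs with hi
      · have h2 : ¬ (((∑ i ∈ I, m' i : ℕ) : ℤ) = g I) := h I hi
        push_cast at *
        omega
      · simpa using h1
    have := hmax _ hf
    simp [Finset.sum_add_distrib] at this
  have exists_maximal (i : ι) :
      ∃ I, (i ∈ I ∧ tight I) ∧ ∀ J, i ∈ J → tight J → I ⊆ J → J ⊆ I := by
    obtain ⟨I, hI⟩ := (Set.toFinite {I : Finset ι | i ∈ I ∧ tight I}).exists_maximal
      (exists_tight i)
    exact ⟨I, hI.1, fun J hJ hJ' hIJ ↦ hI.2 ⟨hJ, hJ'⟩ hIJ⟩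
  choose T hT hTmax using exists_maximal
  have subset_of_inter (i j : ι) (h : (T i ∩ T j).Nonempty) : T j ⊆ T i :=
    Finset.subset_union_right.trans
      (hTmax i _ (Finset.mem_union_left _ (hT i).1) (tight_union _ _ (hT i).2 (hT j).2 h)
        Finset.subset_union_left)
  have hcover : (Finset.univ.image T).biUnion id = Finset.univ := by
    ext i
    simp only [Finset.mem_biUnion, Finset.mem_image, Finset.mem_univ, true_and, id, iff_true]
    exact ⟨T i, ⟨i, rfl⟩, (hT i).1⟩
  have hdisj : Set.PairwiseDisjoint (Finset.univ.image T : Set (Finset ι)) id := by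
    simp only [Finset.coe_image, Finset.coe_univ, Set.image_univ]
    rintro _ ⟨i, rfl⟩ _ ⟨j, rfl⟩ hne
    by_contra h
    rw [Function.onFun, id, id, Finset.disjoint_iff_inter_eq_empty, ← ne_eq,
      ← Finset.nonempty_iff_ne_empty] at h
    exact hne ((subset_of_inter j i (Finset.inter_comm (T i) (T j) ▸ h)).antisymm
      (subset_of_inter i j h))
  rw [← hcover, Finset.sum_biUnion hdisj, Finset.sum_biUnion hdisj, Finset.mul_sum]
  refine Finset.sum_le_sum fun I hI ↦ ?_
  obtain ⟨i, -, rfl⟩ := Finset.mem_image.1 hI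
  have h1 := hm (T i) ⟨i, (hT i).1⟩
  have h2 : ((∑ i ∈ T i, m' i : ℕ) : ℤ) = g (T i) := (hT i).2
  rw [← h2] at h1
  exact_mod_cast h1

end Combinatorics

section LinearAlgebra

variable {K V ι : Type*} [Field K] [AddCommGroup V] [Module K V] [FiniteDimensional K V]

theorem Submodule.finrank_add_finrank_le_finrank_inf_add (A B X : Submodule K V) (hA : A ≤ X)
    (hB : B ≤ X) : finrank K A + finrank K B ≤ finrank K ↥(A ⊓ B) + finrank K X := by
  have h1 := Submodule.finrank_sup_add_finrank_inf_eq A B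
  have h2 := Submodule.finrank_mono (sup_le hA hB)
  omega

/-- Over an infinite field, a subspace `D` lies in a hyperplane `H` cutting down the dimension of
each of finitely many given subspaces not contained in `D`. -/
theorem Submodule.exists_le_finrank_inf_succ_le [Infinite K] {κ : Type*} [Finite κ]
    (D : Submodule K V) (A : κ → Submodule K V) :
    ∃ H : Submodule K V, D ≤ H ∧ (∀ B : Submodule K V, finrank K B ≤ finrank K ↥(B ⊓ H) + 1) ∧
      ∀ i, ¬ A i ≤ D → finrank K ↥(A i ⊓ H) + 1 ≤ finrank K (A i) := by
  have hv (i : {i // ¬ A i ≤ D}) : ∃ v ∈ A i, v ∉ D := SetLike.not_le_iff_exists.1 i.2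
  choose v hvA hvD using hv
  obtain ⟨f, hf⟩ := Module.exists_dual_forall_apply_ne_zero (K := K) (fun i ↦ D.mkQ (v i))
    (fun i ↦ by simpa using hvD i)
  refine ⟨LinearMap.ker (f ∘ₗ D.mkQ), fun x hx ↦ ?_, fun B ↦ ?_, fun i hi ↦ ?_⟩
  · simp [(Submodule.Quotient.mk_eq_zero D).2 hx]
  · have h1 := Submodule.finrank_add_finrank_le_finrank_inf_add B
      (LinearMap.ker (f ∘ₗ D.mkQ)) ⊤ le_top le_top
    have h2 := LinearMap.finrank_range_add_finrank_ker (f ∘ₗ D.mkQ)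
    have h3 := Submodule.finrank_le (LinearMap.range (f ∘ₗ D.mkQ))
    rw [finrank_self] at h3
    rw [finrank_top] at h1
    omega
  · refine Submodule.finrank_lt_finrank_of_lt (lt_of_le_not_ge inf_le_left fun h ↦ ?_)
    exact hf ⟨i, hi⟩ (h (hvA ⟨i, hi⟩)).2

/-- Over an infinite field, finitely many subspaces of dimension at most `finrank X - s` in `X`
have a common `s`-dimensional subspace of `X` meeting all of them trivially. -/
theorem Submodule.exists_finrank_eq_forall_disjoint [Infinite K] [Finite ι] [Nonempty ι]
    (C : ι → Submodule K V) (X : Submodule K V) (s : ℕ)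
    (hC : ∀ i, finrank K ↥(X ⊓ C i) + s ≤ finrank K X) :
    ∃ P ≤ X, finrank K P = s ∧ ∀ i, Disjoint P (C i) := by
  induction s with
  | zero => exact ⟨⊥, bot_le, finrank_bot K V, fun i ↦ disjoint_bot_left⟩
  | succ s ih =>
    obtain ⟨P, hPX, hP, hPC⟩ := ih fun i ↦ by have := hC i; omega
    obtain ⟨⟨v, hvX⟩, hv⟩ := Submodule.exists_forall_notMem_of_forall_ne_top
      (fun i ↦ (P ⊔ C i).comap X.subtype) fun i h ↦ by
        rw [Submodule.comap_subtype_eq_top] at h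
        have h1 : X ≤ P ⊔ X ⊓ C i := by
          rw [inf_comm, ← sup_inf_assoc_of_le _ hPX]
          exact le_inf h le_rfl
        have h2 := Submodule.finrank_mono h1
        have h3 := Submodule.finrank_add_le_finrank_add_finrank P (X ⊓ C i)
        have h4 := hC i
        omega
    replace hv (i : ι) : v ∉ P ⊔ C i := hv i
    have hdisj {A : Submodule K V} (h : v ∉ A) : Disjoint A (span K {v}) :=
      Submodule.disjoint_span_singleton.2 fun hvA ↦ (h hvA).elim
    have hv' : v ∉ P := fun h ↦ hv (Classical.arbitrary ι) (mem_sup_left h)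
    refine ⟨P ⊔ span K {v}, sup_le hPX (by simpa using hvX), ?_, fun i ↦ ?_⟩
    · have h1 := Submodule.finrank_sup_add_finrank_inf_eq P (span K {v})
      rw [(hdisj hv').eq_bot, finrank_bot,
        finrank_span_singleton (ne_of_mem_of_not_mem P.zero_mem hv').symm] at h1
      omega
    · rw [sup_comm]
      exact (hPC i).disjoint_sup_left_of_disjoint_sup_right (hdisj (hv i)).symm

/-- A form of Lovász's theorem on generic sections of a family of subspaces. -/
theorem Submodule.exists_finrank_eq_finrank_iInf_sup_add_sum_le [Infinite K] [Fintype ι]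
    [DecidableEq ι] [Nonempty ι]
    (C : ι → Submodule K V) (s : ℕ) (t : ℕ) (m : ι → ℕ) (ht : ∑ i, m i = t) (X : Submodule K V)
    (hm : ∀ I : Finset ι, I.Nonempty →
      finrank K ↥(X ⊓ ⨅ i ∈ I, C i) + ∑ i ∈ I, m i + s ≤ finrank K X) :
    ∃ P ≤ X, finrank K P = s ∧ (∀ i, Disjoint P (C i)) ∧
      finrank K ↥(X ⊓ ⨅ i, C i ⊔ P) + t ≤ finrank K X := by
  induction t generalizing m X with
  | zero =>
    obtain ⟨P, hPX, hP, hPC⟩ := Submodule.exists_finrank_eq_forall_disjoint C X s fun i ↦ by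
      have := hm {i} (Finset.singleton_nonempty i)
      rw [Finset.iInf_singleton] at this
      omega
    exact ⟨P, hPX, hP, hPC, Submodule.finrank_mono inf_le_left⟩
  | succ t ih =>
    obtain ⟨a, ha⟩ : ∃ a, m a ≠ 0 := by
      by_contra! h
      simp [h] at ht
    obtain ⟨m', rfl⟩ : ∃ m' : ι → ℕ, m = m' + Pi.single a 1 := by
      refine ⟨m - Pi.single a 1, (tsub_add_cancel_of_le fun i ↦ ?_).symm⟩
      rcases eq_or_ne i a with rfl | h
      · simpa using Nat.one_le_iff_ne_zero.2 ha
      · simp [h]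
    have hsum (I : Finset ι) : ∑ i ∈ I, (m' + Pi.single a 1 : ι → ℕ) i =
        ∑ i ∈ I, m' i + if a ∈ I then 1 else 0 := by
      simp only [Pi.add_apply, Finset.sum_add_distrib, Finset.sum_pi_single']
    simp only [hsum] at hm
    rw [hsum, if_pos (Finset.mem_univ a)] at ht
    obtain ⟨H, hH, hH1, hH2⟩ := Submodule.exists_le_finrank_inf_succ_le (X ⊓ C a)
      (fun I : Finset ι ↦ X ⊓ ⨅ i ∈ I, C i)
    have hXH := hH1 X
    have hXH' : finrank K ↥(X ⊓ H) + 1 ≤ finrank K X := by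
      have h := hH2 ∅
      rw [show X ⊓ ⨅ i ∈ (∅ : Finset ι), C i = X by simp] at h
      refine h fun h ↦ ?_
      have h1 := Submodule.finrank_mono h
      have h2 := hm {a} (Finset.singleton_nonempty a)
      rw [Finset.iInf_singleton, if_pos (Finset.mem_singleton_self a)] at h2
      omega
    obtain ⟨P, hPX, hP, hPC, hPr⟩ := ih m' (by omega) (X ⊓ H) fun I hI ↦ by
      rw [inf_right_comm]
      by_cases h : X ⊓ ⨅ i ∈ I, C i ≤ X ⊓ C a
      · have h1 := hm (insert a I) (Finset.insert_nonempty a I)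
        rw [if_pos (Finset.mem_insert_self a I), Finset.iInf_insert, ← inf_assoc] at h1
        have h2 : (X ⊓ ⨅ i ∈ I, C i) ⊓ H ≤ X ⊓ C a ⊓ ⨅ i ∈ I, C i :=
          inf_le_left.trans (le_inf h inf_le_right)
        have h3 := Submodule.finrank_mono h2
        have h4 : ∑ i ∈ I, m' i ≤ ∑ i ∈ insert a I, m' i :=
          Finset.sum_le_sum_of_subset (Finset.subset_insert a I)
        omega
      · have h1 := hH2 I h
        have h2 := hm I hI
        split_ifs at h2 <;> omega
    refine ⟨P, hPX.trans inf_le_left, hP, hPC, ?_⟩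
    have h1 : X ⊓ ⨅ i, C i ⊔ P ≤ X ⊓ H ⊓ ⨅ i, C i ⊔ P := by
      refine le_inf (le_inf inf_le_left ?_) inf_le_right
      refine (inf_le_inf_left X (iInf_le _ a)).trans ?_
      rw [inf_comm, sup_comm, sup_inf_assoc_of_le _ (hPX.trans inf_le_left), inf_comm]
      exact sup_le (hPX.trans inf_le_right) hH
    have h2 := Submodule.finrank_mono h1
    omega

/-- The codimension of an intersection of subspaces is distributed among them so that each
partial sum is at most the codimension of the corresponding intersection. -/
theorem Submodule.exists_sum_add_finrank_iInf [DecidableEq ι] (A : ι → Submodule K V)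
    (S : Finset ι) :
    ∃ m : ι → ℕ, ∑ i ∈ S, m i + finrank K ↥(⨅ i ∈ S, A i) = finrank K V ∧
      ∀ I ⊆ S, ∑ i ∈ I, m i + finrank K ↥(⨅ i ∈ I, A i) ≤ finrank K V := by
  induction S using Finset.induction_on with
  | empty =>
    have h : ⨅ i ∈ (∅ : Finset ι), A i = ⊤ := by simp
    refine ⟨0, by rw [h]; simp, fun I hI ↦ ?_⟩
    rw [Finset.subset_empty.1 hI, h]
    simp
  | insert a S ha ih =>
    obtain ⟨m, hm, hmI⟩ := ih
    set D := ⨅ i ∈ S, A i with hD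
    have hDA : finrank K ↥(A a ⊓ D) ≤ finrank K D := Submodule.finrank_mono inf_le_right
    have hupd (b : ℕ) (I : Finset ι) (hI : a ∉ I) :
        ∑ i ∈ I, Function.update m a b i = ∑ i ∈ I, m i :=
      Finset.sum_congr rfl fun i hi ↦ Function.update_of_ne (ne_of_mem_of_not_mem hi hI) _ _
    refine ⟨Function.update m a (finrank K D - finrank K ↥(A a ⊓ D)), ?_, fun I hI ↦ ?_⟩
    · rw [Finset.sum_insert ha, hupd _ _ ha, Finset.iInf_insert, Function.update_self, ← hD]
      omega
    · by_cases haI : a ∈ I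
      · obtain ⟨J, haJ, rfl⟩ : ∃ J, a ∉ J ∧ I = insert a J :=
          ⟨I.erase a, Finset.notMem_erase a I, (Finset.insert_erase haI).symm⟩
        have hJS : J ⊆ S := (Finset.insert_subset_insert_iff haJ).1 hI
        rw [Finset.sum_insert haJ, hupd _ _ haJ, Finset.iInf_insert, Function.update_self]
        have h1 := hmI J hJS
        have hDJ : D ≤ ⨅ i ∈ J, A i := biInf_mono hJS
        have h2 := Submodule.finrank_add_finrank_le_finrank_inf_add D (A a ⊓ ⨅ i ∈ J, A i)
          (⨅ i ∈ J, A i) hDJ inf_le_right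
        rw [inf_left_comm, inf_eq_left.2 hDJ] at h2
        omega
      · rw [hupd _ _ haI]
        exact hmI I ((Finset.subset_insert_iff_of_notMem haI).1 hI)

end LinearAlgebra

/-- **Paper's Theorem "dim other"**: if `L = ℓ_{c,k} + 1` is the least element of
`S = { finrank (⨅ i, C i ⊔ P) : finrank P = k+1, P ⊓ C i = ⊥ ∀ i }`, then the
dimension `(k+1)(N − ℓ_{c,k}) = (k+1)(N+1−L)` of the multiview variety is the
greatest `h` such that `M_{c,k}(h) ≠ ∅`. -/
theorem dim_other (N k n : ℕ) (hk : k ≤ N) (hn : 1 ≤ n)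
    (C : Fin n → Submodule ℂ (Fin (N + 1) → ℂ))
    (hC : ∀ i, finrank ℂ ↥(C i) ≤ N - k)
    (L : ℕ)
    (hL : IsLeast
        { r : ℕ | ∃ P : Submodule ℂ (Fin (N + 1) → ℂ),
            finrank ℂ ↥P = k + 1 ∧ (∀ i, P ⊓ C i = ⊥) ∧
            r = finrank ℂ ↥(⨅ i, C i ⊔ P) } L) :
    IsGreatest
      { h : ℕ | ∃ m : Fin n → ℕ, ∑ i, m i = h ∧
          ∀ I : Finset (Fin n), I.Nonempty →
            ((∑ i ∈ I, m i : ℕ) : ℤ) ≤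
              ((k : ℤ) + 1) * ((N : ℤ) - k - finrank ℂ ↥(⨅ i ∈ I, C i)) }
      ((k + 1) * (N + 1 - L)) := by
  have : Nonempty (Fin n) := ⟨⟨0, hn⟩⟩
  constructor
  · obtain ⟨P, hP, hPC, rfl⟩ := hL.1
    obtain ⟨m, hm, hmI⟩ := Submodule.exists_sum_add_finrank_iInf (fun i ↦ C i ⊔ P) Finset.univ
    rw [show ⨅ i ∈ Finset.univ, C i ⊔ P = ⨅ i, C i ⊔ P by simp, finrank_fin_fun] at hm
    rw [finrank_fin_fun] at hmI
    refine ⟨fun i ↦ (k + 1) * m i, ?_, fun I hI ↦ ?_⟩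
    · rw [← Finset.mul_sum, ← Nat.eq_sub_of_add_eq hm]
    · rw [← Finset.mul_sum]
      push_cast
      refine mul_le_mul_of_nonneg_left ?_ (by positivity)
      obtain ⟨a, ha⟩ := hI
      have h1 := hmI I (Finset.subset_univ I)
      have h2 : (⨅ i ∈ I, C i) ⊔ P ≤ ⨅ i ∈ I, C i ⊔ P :=
        le_iInf₂ fun i hi ↦ sup_le_sup_right (iInf₂_le i hi) P
      have h3 := Submodule.finrank_mono h2
      have h4 := Submodule.finrank_sup_add_finrank_inf_eq (⨅ i ∈ I, C i) P
      have h5 : (⨅ i ∈ I, C i) ⊓ P = ⊥ :=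
        eq_bot_iff.2 ((inf_le_inf_right P (iInf₂_le a ha)).trans (inf_comm P (C a) ▸ hPC a).le)
      rw [h5, finrank_bot] at h4
      zify at *
      linarith
  · rintro h ⟨m, rfl, hm⟩
    have hfin (I : Finset (Fin n)) (hI : I.Nonempty) : finrank ℂ ↥(⨅ i ∈ I, C i) ≤ N - k := by
      obtain ⟨a, ha⟩ := hI
      exact (Submodule.finrank_mono (iInf₂_le a ha)).trans (hC a)
    obtain ⟨m', hm', hle⟩ := exists_sum_le_of_intersecting_submodular
      (fun I ↦ (N : ℤ) - k - finrank ℂ ↥(⨅ i ∈ I, C i))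
      (fun I hI ↦ by have := hfin I hI; omega)
      (fun I J _ ↦ by
        have h1 := Submodule.finrank_add_finrank_le_finrank_inf_add (⨅ i ∈ I, C i) (⨅ i ∈ J, C i)
          (⨅ i ∈ I ∩ J, C i) (biInf_mono fun _ ↦ Finset.mem_of_mem_inter_left)
          (biInf_mono fun _ ↦ Finset.mem_of_mem_inter_right)
        rw [← Finset.iInf_union] at h1
        omega)
      (k + 1) m (fun I hI ↦ by exact_mod_cast hm I hI)
    obtain ⟨P, -, hP, hPC, hr⟩ := Submodule.exists_finrank_eq_finrank_iInf_sup_add_sum_le C (k + 1)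
      _ m' rfl ⊤ fun I hI ↦ by
        have h1 := hm' I hI
        rw [top_inf_eq, finrank_top, finrank_fin_fun]
        omega
    rw [top_inf_eq, finrank_top, finrank_fin_fun] at hr
    have hLr := hL.2 ⟨P, hP, fun i ↦ (hPC i).eq_bot, rfl⟩
    exact hle.trans (Nat.mul_le_mul_left _ (by omega))
end

section
/- Let k ≤ N, n ≥ 1, and let C 1, …, C n be submodules of V = Fin (N+1) → ℂ with finrank (C i) ≤ N − k for all i. Assume L is the least element of the set S = { finrank (⨅ i, (C i ⊔ P)) | finrank P = k+1, P ⊓ C i = ⊥ for all i }. Then (as integers) (k+1)·(N+1−L) = (k+1)·min over all partitions λ of Fin n of ( |λ|·(N − k − 1) − Σ_{I∈λ} (finrank (⨅_{i∈I} C i) − 1) ). (Paper's Corollary 'dim final': dim M_{c,k} = (k+1)·min_{λ⊢n} { |λ|(N−k−1) − Σ_{I∈λ} dim c_I }, where dim M_{c,k} = (k+1)(N − ℓ_{c,k}) by the paper's Proposition 3.4.) -/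
open Module

/-- A derivation into a formally étale extension field of `R` extends from `R`. -/
theorem Derivation.exists_extension_of_formallyEtale {K R L : Type*} [CommRing K] [CommRing R]
    [CommRing L] [Algebra K R] [Algebra K L] [Algebra R L] [IsScalarTower K R L]
    [Algebra.FormallyEtale R L] (d : Derivation K R L) :
    ∃ D : Derivation K L L, ∀ r, D (algebraMap R L r) = d r := by
  have hb := KaehlerDifferential.isBaseChange_of_formallyEtale K R L
  refine ⟨(hb.lift d.liftKaehlerDifferential).compDer (KaehlerDifferential.D K L), fun r => ?_⟩
  have h := hb.lift_eq d.liftKaehlerDifferential (KaehlerDifferential.D K R r)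
  simpa using h

theorem IsTranscendenceBasis.exists_derivation {K L ι : Type*} [Field K] [CharZero K] [Field L]
    [Algebra K L] {v : ι → L} (hv : IsTranscendenceBasis K v) (f : ι → L) :
    ∃ D : Derivation K L L, ∀ i, D (v i) = f i := by
  let : Algebra (MvPolynomial ι K) L := (MvPolynomial.aeval v).toAlgebra
  have hmap : ∀ p, algebraMap (MvPolynomial ι K) L p = MvPolynomial.aeval v p := fun _ => rfl
  have : IsScalarTower K (MvPolynomial ι K) L := .of_algebraMap_eq fun x => by simp [hmap]
  have : FaithfulSMul (MvPolynomial ι K) L := (faithfulSMul_iff_algebraMap_injective _ _).2 hv.1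
  have := hv.isAlgebraic
  have : Algebra.IsAlgebraic (MvPolynomial ι K) L := ⟨fun x =>
    (Algebra.IsAlgebraic.isAlgebraic (R := Algebra.adjoin K (Set.range v)) x).of_ringHom_of_comp_eq
      (hv.1.aevalEquiv : MvPolynomial ι K →+* _) (RingHom.id L) hv.1.aevalEquiv.surjective
      Function.injective_id (by ext <;> simp [hmap])⟩
  let := FractionRing.liftAlgebra (MvPolynomial ι K) L
  have : Algebra.IsAlgebraic (FractionRing (MvPolynomial ι K)) L :=
    (IsFractionRing.comap_isAlgebraic_iff (A := MvPolynomial ι K)).1 inferInstance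
  have : CharZero (FractionRing (MvPolynomial ι K)) :=
    charZero_of_injective_algebraMap (algebraMap K _).injective
  have : Algebra.FormallyEtale (MvPolynomial ι K) (FractionRing (MvPolynomial ι K)) :=
    .of_isLocalization (nonZeroDivisors _)
  have : Algebra.FormallyEtale (FractionRing (MvPolynomial ι K)) L :=
    .of_isSeparable _ _
  have : Algebra.FormallyEtale (MvPolynomial ι K) L :=
    .comp _ (FractionRing (MvPolynomial ι K)) _
  obtain ⟨D, hD⟩ := (MvPolynomial.mkDerivation K f).exists_extension_of_formallyEtale (L := L)
  refine ⟨D, fun i => ?_⟩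
  simpa [hmap] using hD (MvPolynomial.X i)

/-- Over a countable set of parameters there are finitely many generic complex numbers on which the
values of a derivation killing the parameters can be prescribed. -/
theorem Complex.exists_derivation_eq {s : Set ℂ} (hs : s.Countable) (κ : Type) [Finite κ] :
    ∃ x : κ → ℂ, ∀ y : κ → ℂ, ∃ D : Derivation ℤ ℂ ℂ, (∀ z ∈ s, D z = 0) ∧ ∀ a, D (x a) = y a := by
  let K := Subfield.closure s
  obtain ⟨ι, v, hv⟩ := exists_isTranscendenceBasis' K ℂ
  have hK : Cardinal.mk K ≤ Cardinal.aleph0 :=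
    (Subfield.cardinalMk_closure_le_max s).trans (max_le hs.le_aleph0 le_rfl)
  have hι := IsAlgClosed.cardinal_eq_cardinal_transcendence_basis_of_aleph0_lt' v hv hK
    (by rw [Cardinal.mk_complex]; exact Cardinal.aleph0_lt_continuum)
  have : Infinite ι := by
    rw [Cardinal.infinite_iff, ← hι]; exact Cardinal.aleph0_le_mk ℂ
  have := Fintype.ofFinite κ
  obtain ⟨e⟩ : Nonempty (κ ↪ ι) := ⟨(Fintype.equivFin κ).toEmbedding.trans
    (Fin.valEmbedding.trans (Infinite.natEmbedding ι))⟩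
  refine ⟨v ∘ e, fun y => ?_⟩
  obtain ⟨D, hD⟩ := hv.exists_derivation (Function.extend e y 0)
  refine ⟨D.restrictScalars ℤ, fun z hz => ?_, fun a => ?_⟩
  · exact D.map_algebraMap (⟨z, Subfield.subset_closure hz⟩ : K)
  · simp [hD, e.injective.extend_apply]

theorem LinearMap.surjective_pi_mkQ_of_forall_exists_sub_smul_mem {K V J : Type*} [Field K]
    [AddCommGroup V] [Module K V] [Finite J] (E : J → Submodule K V) {γ : J → K}
    (hγ : Function.Injective γ) (h : ∀ w, ∃ v, ∀ j, v - γ j • w ∈ E j) :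
    Function.Surjective (LinearMap.pi fun j => (E j).mkQ) := by
  classical
  have := Fintype.ofFinite J
  have hpoly : ∀ (r : Polynomial K) (w : V), ∃ v, ∀ j, v - r.eval (γ j) • w ∈ E j := by
    intro r
    induction r using Polynomial.induction_on with
    | C a => exact fun w => ⟨a • w, fun j => by simp⟩
    | add p q hp hq =>
      intro w
      obtain ⟨v₁, h₁⟩ := hp w
      obtain ⟨v₂, h₂⟩ := hq w
      refine ⟨v₁ + v₂, fun j => ?_⟩
      convert (E j).add_mem (h₁ j) (h₂ j) using 1
      simp only [Polynomial.eval_add]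
      module
    | monomial m a ih =>
      intro w
      obtain ⟨v₁, h₁⟩ := ih w
      obtain ⟨v₂, h₂⟩ := h v₁
      refine ⟨v₂, fun j => ?_⟩
      convert (E j).add_mem (h₂ j) ((E j).smul_mem (γ j) (h₁ j)) using 1
      simp only [Polynomial.eval_mul, Polynomial.eval_C, Polynomial.eval_pow, Polynomial.eval_X]
      module
  intro y
  choose w hw using fun j => (E j).mkQ_surjective (y j)
  choose v hv using fun j => hpoly (Lagrange.basis Finset.univ γ j) (w j)
  refine ⟨∑ j, v j, funext fun i => ?_⟩
  have hmk : ∀ j, (E i).mkQ (v j) = if j = i then y i else 0 := by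
    intro j
    have h₁ := (Submodule.Quotient.eq (E i)).2 (hv j i)
    split_ifs with hji
    · subst hji
      rw [Lagrange.eval_basis_self hγ.injOn (Finset.mem_univ j), one_smul] at h₁
      exact h₁.trans (hw j)
    · rw [Lagrange.eval_basis_of_ne hji (Finset.mem_univ i), zero_smul] at h₁
      exact h₁
  simp [hmk, -Submodule.mkQ_apply]

section Codimension

variable {K V J : Type*} [Field K] [AddCommGroup V] [Module K V]
  (E : J → Submodule K V)

theorem Submodule.ker_pi_mkQ :
    LinearMap.ker (LinearMap.pi fun j => (E j).mkQ) = ⨅ j, E j := by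
  simp only [LinearMap.ker_pi, Submodule.ker_mkQ]

variable [FiniteDimensional K V] [Fintype J]

theorem Submodule.finrank_le_finrank_iInf_add_sum_finrank_quotient :
    finrank K V ≤ finrank K ↥(⨅ j, E j) + ∑ j, finrank K (V ⧸ E j) := by
  have h := (LinearMap.pi fun j => (E j).mkQ).finrank_range_add_finrank_ker
  have hle := Submodule.finrank_le (LinearMap.range (LinearMap.pi fun j => (E j).mkQ))
  rw [Submodule.ker_pi_mkQ] at h
  rw [finrank_pi_fintype] at hle
  omega

theorem Submodule.finrank_iInf_add_sum_finrank_quotient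
    (hE : Function.Surjective (LinearMap.pi fun j => (E j).mkQ)) :
    finrank K ↥(⨅ j, E j) + ∑ j, finrank K (V ⧸ E j) = finrank K V := by
  have h := (LinearMap.pi fun j => (E j).mkQ).finrank_range_add_finrank_ker
  rw [Submodule.ker_pi_mkQ, LinearMap.range_eq_top.2 hE, finrank_top, finrank_pi_fintype] at h
  omega

end Codimension

/-- The vectors `p a` are generic with respect to the family `C`: their first order deformations
can be prescribed by derivations of `ℂ` that preserve every `C i`. -/
def IsDifferentiallyGeneric {ι σ κ : Type*} (C : ι → Submodule ℂ (σ → ℂ)) (p : κ → σ → ℂ) : Prop :=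
  ∀ q : κ → σ → ℂ, ∃ D : Derivation ℤ ℂ ℂ,
    (∀ i, ∀ c ∈ C i, (fun j => D (c j)) ∈ C i) ∧ ∀ a j, D (p a j) = q a j

theorem exists_isDifferentiallyGeneric {ι : Type*} {σ κ : Type} [Countable ι] [Finite σ]
    [Finite κ] (C : ι → Submodule ℂ (σ → ℂ)) :
    ∃ p : κ → σ → ℂ, IsDifferentiallyGeneric C p := by
  choose S hS using fun i => (IsNoetherian.noetherian (C i) : (C i).FG)
  obtain ⟨x, hx⟩ := Complex.exists_derivation_eq (s := ⋃ i, ⋃ c ∈ S i, Set.range c)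
    (Set.countable_iUnion fun i => (S i).countable_toSet.biUnion fun c _ => Set.countable_range c)
    (κ × σ)
  refine ⟨fun a j => x (a, j), fun q => ?_⟩
  obtain ⟨D, hD, hDx⟩ := hx fun a => q a.1 a.2
  refine ⟨D, fun i c hc => ?_, fun a j => by simp [hDx]⟩
  rw [← hS i] at hc
  induction hc using Submodule.span_induction with
  | mem c hc =>
    have h0 : (fun j => D (c j)) = 0 :=
      funext fun j => hD _ (Set.mem_iUnion.2 ⟨i, Set.mem_biUnion hc ⟨j, rfl⟩⟩)
    exact h0 ▸ (C i).zero_mem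
  | zero =>
    change (fun j => D ((0 : σ → ℂ) j)) ∈ C i
    have h0 : (fun j => D ((0 : σ → ℂ) j)) = 0 := funext fun j => D.map_zero
    rw [h0]
    exact (C i).zero_mem
  | add c d _ _ hc hd => simpa using! (C i).add_mem hc hd
  | smul z c hc' hc =>
    have hz := (C i).add_mem ((C i).smul_mem z hc) ((C i).smul_mem (D z) (hS i ▸ hc' : c ∈ C i))
    convert! hz using 1
    ext j
    simp [mul_comm]

namespace IsDifferentiallyGeneric

variable {ι σ κ : Type*} [Fintype κ] {C : ι → Submodule ℂ (σ → ℂ)} {p : κ → σ → ℂ}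

/-- Differentiating the condition `v - ∑ a, t a • p a ∈ C i` in a prescribed direction. -/
theorem exists_tangent (hp : IsDifferentiallyGeneric C p) (q : κ → σ → ℂ) :
    ∃ δ : (σ → ℂ) →+ (σ → ℂ), ∀ v : σ → ℂ, ∀ t : κ → ℂ, ∃ t' : κ → ℂ,
      ∀ i, v - Fintype.linearCombination ℂ p t ∈ C i →
        δ v - Fintype.linearCombination ℂ q t - Fintype.linearCombination ℂ p t' ∈ C i := by
  obtain ⟨D, hD, hDp⟩ := hp q
  refine ⟨AddMonoidHom.compLeft D σ, fun v t => ⟨fun a => D (t a), fun i hi => ?_⟩⟩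
  convert! hD i _ hi using 1
  ext j
  simp [Fintype.linearCombination_apply, hDp, Finset.sum_add_distrib, mul_comm, sub_sub, add_comm]

variable [Fintype σ]

theorem eq_zero_of_linearCombination_mem (hp : IsDifferentiallyGeneric C p) {i : ι}
    (hC : finrank ℂ ↥(C i) + Fintype.card κ ≤ Fintype.card σ) {t : κ → ℂ}
    (ht : Fintype.linearCombination ℂ p t ∈ C i) : t = 0 := by
  classical
  let f := Fintype.linearCombination ℂ p
  let F : (↥(C i) × (κ → ℂ)) →ₗ[ℂ] (σ → ℂ) := (C i).subtype.coprod f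
  by_contra h
  obtain ⟨a, ha⟩ := Function.ne_iff.1 h
  have hsurj : Function.Surjective F := by
    intro w
    obtain ⟨δ, hδ⟩ := hp.exists_tangent (Pi.single a ((t a)⁻¹ • w))
    obtain ⟨t', ht'⟩ := hδ 0 (-t)
    have hc := ht' i (by simpa using ht)
    refine ⟨(⟨_, hc⟩, t'), ?_⟩
    have hw : Fintype.linearCombination ℂ (Pi.single a ((t a)⁻¹ • w)) t = w := by
      rw [Fintype.linearCombination_apply, Finset.sum_eq_single a]
      · simp [smul_smul, mul_inv_cancel₀ (show t a ≠ 0 from ha)]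
      · intro b _ hb
        simp [hb]
      · simp
    simp [F, f, hw]
  have hinj : Function.Injective F := by
    refine (LinearMap.injective_iff_surjective_of_finrank_eq_finrank ?_).2 hsurj
    refine le_antisymm ?_ (LinearMap.finrank_le_finrank_of_surjective hsurj)
    simpa using hC
  have h0 : F (⟨f t, ht⟩, -t) = 0 := by simp [F, f]
  have := congrArg Prod.snd ((map_eq_zero_iff F hinj).1 h0)
  exact h (by simpa using this)

end IsDifferentiallyGeneric

section Projection

variable {K V W : Type*} [Field K] [AddCommGroup V] [Module K V] [AddCommGroup W] [Module K W]

theorem Submodule.exists_linearMap_forall_sub_mem (U : Submodule K V) (f : W →ₗ[K] V)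
    (hf : ∀ t, f t ∈ U → t = 0) :
    ∃ T : V →ₗ[K] W, ∀ v ∈ U ⊔ LinearMap.range f, v - f (T v) ∈ U := by
  obtain ⟨g, hg⟩ := (U.mkQ ∘ₗ f).exists_leftInverse_of_injective
    (LinearMap.ker_eq_bot'.2 fun t ht => hf t (by simpa using ht))
  refine ⟨g ∘ₗ U.mkQ, fun v hv => ?_⟩
  obtain ⟨c, hc, -, ⟨t, rfl⟩, rfl⟩ := Submodule.mem_sup.1 hv
  have h₁ : g (U.mkQ (f t)) = t := LinearMap.congr_fun hg t
  have h₂ : U.mkQ c = 0 := by simpa using hc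
  simpa [-Submodule.mkQ_apply, h₁, h₂] using hc

theorem Submodule.exists_forall_dual_ne [Infinite K] [FiniteDimensional K W] {ι : Type*} [Finite ι]
    (X : Submodule K V) (T : ι → V →ₗ[K] W) :
    ∃ v ∈ X, ∃ c : Dual K W, ∀ i j, c (T i v) = c (T j v) → ∀ x ∈ X, T i x = T j x := by
  classical
  let Idx := {a : ι × ι // ∃ x ∈ X, T a.1 x ≠ T a.2 x}
  choose x hx hne using fun a : Idx => a.2
  obtain ⟨c, hc⟩ := Module.exists_dual_forall_apply_ne_zero (K := K)
    (fun a : Idx => T a.1.1 (x a) - T a.1.2 (x a)) fun a => sub_ne_zero.2 (hne a)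
  obtain ⟨v, hv, hcv⟩ := Module.Dual.exists_forall_mem_ne_zero_of_forall_exists X
    (fun a : Idx => c ∘ₗ (T a.1.1 - T a.1.2)) fun a => ⟨x a, hx a, by simpa using hc a⟩
  refine ⟨v, hv, c, fun i j hij y hy => ?_⟩
  by_contra h
  exact hcv ⟨(i, j), y, hy, h⟩ (by simp [hij])

end Projection

theorem Finpartition.iInf_iInf_sup_le {α ι : Type*} [CompleteLattice α] [Fintype ι]
    [DecidableEq ι] (lam : Finpartition (Finset.univ : Finset ι)) (C : ι → α) (P : α) :
    (⨅ I : lam.parts, (⨅ i ∈ I.1, C i) ⊔ P) ≤ ⨅ i, C i ⊔ P :=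
  le_iInf fun i => (iInf_le _ (⟨_, lam.part_mem.2 (Finset.mem_univ i)⟩ : lam.parts)).trans
    (sup_le_sup_right (iInf₂_le i (lam.mem_part (Finset.mem_univ i))) _)

namespace IsDifferentiallyGeneric

variable {ι σ κ : Type*} [Fintype ι] [DecidableEq ι] [Fintype σ] [Fintype κ]
  {C : ι → Submodule ℂ (σ → ℂ)} {p : κ → σ → ℂ}

theorem exists_finpartition (hp : IsDifferentiallyGeneric C p)
    (hC : ∀ i, finrank ℂ ↥(C i) + Fintype.card κ ≤ Fintype.card σ) :
    ∃ lam : Finpartition (Finset.univ : Finset ι),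
      (⨅ I : lam.parts, ((⨅ i ∈ I.1, C i) ⊔ LinearMap.range (Fintype.linearCombination ℂ p)) =
        ⨅ i, C i ⊔ LinearMap.range (Fintype.linearCombination ℂ p)) ∧
      Function.Surjective (LinearMap.pi fun I : lam.parts =>
        ((⨅ i ∈ I.1, C i) ⊔ LinearMap.range (Fintype.linearCombination ℂ p)).mkQ) := by
  classical
  set f := Fintype.linearCombination ℂ p
  set X := ⨅ i, C i ⊔ LinearMap.range f
  choose T hT using fun i => (C i).exists_linearMap_forall_sub_mem f
    fun t ht => hp.eq_zero_of_linearCombination_mem (hC i) ht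
  have hXT : ∀ i, ∀ x ∈ X, x - f (T i x) ∈ C i :=
    fun i x hx => hT i x (Submodule.mem_iInf _ |>.1 hx i)
  obtain ⟨v, hv, c, hc⟩ := X.exists_forall_dual_ne T
  let S : Setoid ι := Setoid.comap (fun i => c (T i v)) ⊥
  have hS : ∀ i j, S i j ↔ c (T i v) = c (T j v) := fun i j => Iff.rfl
  let lam := Finpartition.ofSetoid S
  choose r hr using fun I : lam.parts => lam.nonempty_of_mem_parts I.2
  have hpart : ∀ I : lam.parts, ∀ i, i ∈ I.1 ↔ c (T (r I) v) = c (T i v) := by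
    intro I i
    rw [← hS, ← Finpartition.mem_part_ofSetoid_iff_rel, ← lam.part_eq_of_mem I.2 (hr I)]
  have hTr : ∀ I : lam.parts, ∀ i ∈ I.1, ∀ x ∈ X, T (r I) x = T i x :=
    fun I i hi => hc _ _ ((hpart I i).1 hi)
  have hmem : ∀ I : lam.parts, ∀ x t, (∀ i ∈ I.1, x - f t ∈ C i) →
      x ∈ (⨅ i ∈ I.1, C i) ⊔ LinearMap.range f := by
    intro I x t h
    refine Submodule.mem_sup.2 ⟨x - f t, by simpa using h, f t, ⟨t, rfl⟩, by simp⟩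
  refine ⟨lam, le_antisymm (lam.iInf_iInf_sup_le C _) ?_, ?_⟩
  · exact le_iInf fun I x hx => hmem I x (T (r I) x) fun i hi =>
      (hTr I i hi x hx).symm ▸ hXT i x hx
  · refine LinearMap.surjective_pi_mkQ_of_forall_exists_sub_smul_mem _
      (γ := fun I => c (T (r I) v)) ?_ ?_
    · intro I I' h
      exact Subtype.ext (Finset.ext fun i => by rw [hpart, hpart]; simp only at h; rw [h])
    · intro w
      obtain ⟨δ, hδ⟩ := hp.exists_tangent fun a => c (fun j => if a = j then 1 else 0) • w
      refine ⟨δ v, fun I => ?_⟩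
      obtain ⟨t', ht'⟩ := hδ v (T (r I) v)
      refine hmem I _ t' fun i hi => ?_
      convert! ht' i ((hTr I i hi v hv).symm ▸ hXT i v hv) using 3
      rw [Fintype.linearCombination_apply, LinearMap.pi_apply_eq_sum_univ c, Finset.sum_smul]
      simp [smul_smul]

end IsDifferentiallyGeneric

theorem Submodule.finrank_quotient_sup_add {K V : Type*} [Field K] [AddCommGroup V] [Module K V]
    [FiniteDimensional K V] {U P : Submodule K V} (h : Disjoint P U) :
    finrank K (V ⧸ (U ⊔ P)) + finrank K ↥U + finrank K ↥P = finrank K V := by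
  have h₁ := Submodule.finrank_sup_add_finrank_inf_eq U P
  have h₂ := (U ⊔ P).finrank_quotient_add_finrank
  rw [h.symm.eq_bot, finrank_bot] at h₁
  omega

theorem Finpartition.sum_finrank_quotient_iInf_sup {K V ι : Type*} [Field K] [AddCommGroup V]
    [Module K V] [FiniteDimensional K V] {s : Finset ι} [DecidableEq ι] (lam : Finpartition s)
    {C : ι → Submodule K V} {P : Submodule K V} (hP : ∀ i, P ⊓ C i = ⊥) :
    ((∑ I : lam.parts, finrank K (V ⧸ ((⨅ i ∈ I.1, C i) ⊔ P)) : ℕ) : ℤ) =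
      (lam.parts.card : ℤ) * ((finrank K V : ℤ) - finrank K ↥P - 1) -
        ∑ I ∈ lam.parts, ((finrank K ↥(⨅ i ∈ I, C i) : ℤ) - 1) := by
  rw [Finset.sum_coe_sort lam.parts fun I => finrank K (V ⧸ ((⨅ i ∈ I, C i) ⊔ P)), Nat.cast_sum,
    ← nsmul_eq_mul, ← Finset.sum_const, ← Finset.sum_sub_distrib]
  refine Finset.sum_congr rfl fun I hI => ?_
  obtain ⟨i, hi⟩ := lam.nonempty_of_mem_parts hI
  have h := Submodule.finrank_quotient_sup_add
    ((disjoint_iff.2 (hP i)).mono_right (iInf₂_le (f := fun i (_ : i ∈ I) => C i) i hi))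
  omega

/-- **Paper's Corollary "dim final"**: if `L = ℓ_{c,k} + 1` is the least element of
`S = { finrank (⨅ i, C i ⊔ P) : finrank P = k+1, P ⊓ C i = ⊥ ∀ i }`, then the
dimension `(k+1)(N − ℓ_{c,k}) = (k+1)(N+1−L)` of the multiview variety equals
`(k+1) · min_{λ ⊢ n} ( |λ|(N−k−1) − Σ_{I∈λ} dim c_I )`. -/
theorem dim_final (N k n : ℕ) (hk : k ≤ N) (hn : 1 ≤ n)
    (C : Fin n → Submodule ℂ (Fin (N + 1) → ℂ))
    (hC : ∀ i, finrank ℂ ↥(C i) ≤ N - k)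
    (L : ℕ)
    (hL : IsLeast
        { r : ℕ | ∃ P : Submodule ℂ (Fin (N + 1) → ℂ),
            finrank ℂ ↥P = k + 1 ∧ (∀ i, P ⊓ C i = ⊥) ∧
            r = finrank ℂ ↥(⨅ i, C i ⊔ P) } L) :
    ∃ z : ℤ,
      IsLeast
        { w : ℤ | ∃ lam : Finpartition (Finset.univ : Finset (Fin n)),
            w = (lam.parts.card : ℤ) * ((N : ℤ) - k - 1) -
              ∑ I ∈ lam.parts, ((finrank ℂ ↥(⨅ i ∈ I, C i) : ℤ) - 1) } z ∧
      ((k : ℤ) + 1) * ((N : ℤ) + 1 - L) = ((k : ℤ) + 1) * z := by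
  have hV : finrank ℂ (Fin (N + 1) → ℂ) = N + 1 := by simp
  have hlower : ∀ (P : Submodule ℂ (Fin (N + 1) → ℂ)), finrank ℂ ↥P = k + 1 →
      (∀ i, P ⊓ C i = ⊥) → ∀ lam : Finpartition (Finset.univ : Finset (Fin n)),
      (N : ℤ) + 1 - finrank ℂ ↥(⨅ i, C i ⊔ P) ≤ (lam.parts.card : ℤ) * ((N : ℤ) - k - 1) -
        ∑ I ∈ lam.parts, ((finrank ℂ ↥(⨅ i ∈ I, C i) : ℤ) - 1) := by
    intro P hPk hPC lam
    have h₁ := lam.sum_finrank_quotient_iInf_sup hPC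
    have h₂ := Submodule.finrank_le_finrank_iInf_add_sum_finrank_quotient
      fun I : lam.parts => (⨅ i ∈ I.1, C i) ⊔ P
    have h₃ := Submodule.finrank_mono (lam.iInf_iInf_sup_le C P)
    have h₄ : ((N + 1 : ℕ) : ℤ) - (k + 1 : ℕ) - 1 = (N : ℤ) - k - 1 := by push_cast; ring
    rw [hV, hPk, h₄] at h₁
    rw [hV] at h₂
    omega
  obtain ⟨p, hp⟩ := exists_isDifferentiallyGeneric (κ := Fin (k + 1)) C
  have hC' : ∀ i, finrank ℂ ↥(C i) + Fintype.card (Fin (k + 1)) ≤ Fintype.card (Fin (N + 1)) := by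
    intro i
    have := hC i
    simp only [Fintype.card_fin]
    omega
  obtain ⟨lam, hlam, hsurj⟩ := hp.exists_finpartition hC'
  set P := LinearMap.range (Fintype.linearCombination ℂ p)
  have hPk : finrank ℂ ↥P = k + 1 := by
    rw [LinearMap.finrank_range_of_inj]
    · simp
    · refine (injective_iff_map_eq_zero _).2 fun t ht => ?_
      exact hp.eq_zero_of_linearCombination_mem (hC' ⟨0, hn⟩) (ht ▸ Submodule.zero_mem _)
  have hPC : ∀ i, P ⊓ C i = ⊥ := by
    refine fun i => (Submodule.eq_bot_iff _).2 ?_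
    rintro _ ⟨⟨t, rfl⟩, ht⟩
    rw [hp.eq_zero_of_linearCombination_mem (hC' i) ht, map_zero]
  have hw : (lam.parts.card : ℤ) * ((N : ℤ) - k - 1) -
      ∑ I ∈ lam.parts, ((finrank ℂ ↥(⨅ i ∈ I, C i) : ℤ) - 1) =
        (N : ℤ) + 1 - finrank ℂ ↥(⨅ i, C i ⊔ P) := by
    have h₁ := lam.sum_finrank_quotient_iInf_sup hPC
    have h₂ := Submodule.finrank_iInf_add_sum_finrank_quotient _ hsurj
    have h₄ : ((N + 1 : ℕ) : ℤ) - (k + 1 : ℕ) - 1 = (N : ℤ) - k - 1 := by push_cast; ring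
    rw [hV, hPk, h₄] at h₁
    rw [hV, hlam] at h₂
    omega
  obtain ⟨⟨Q, hQk, hQC, hQL⟩, hmin⟩ := hL
  have hLP := hmin ⟨P, hPk, hPC, rfl⟩
  refine ⟨(N : ℤ) + 1 - L, ⟨⟨lam, ?_⟩, ?_⟩, rfl⟩
  · have := hlower Q hQk hQC lam
    omega
  · rintro w ⟨mu, rfl⟩
    rw [hQL]
    exact hlower Q hQk hQC mu
end

section
/- Let k ≤ N, n ≥ 1, and let C 1, …, C n be submodules of V = Fin (N+1) → ℂ with finrank (C i) ≤ N − k for all i, and assume the arrangement (C i) is pseudo-disjoint with respect to k. If L is the least element of the set S = { finrank (⨅ i, (C i ⊔ P)) | finrank P = k+1, P ⊓ C i = ⊥ for all i }, then (as integers) (k+1)·(N+1−L) = (k+1)·min ( N − k, Σ_i (N − k − finrank (C i)) ). (Paper's Corollary 'dim': for pseudo-disjoint c, dim M_{c,k} = (k+1)·min { N−k, Σ_i (h_i − k) } with h_i = N − dim c_i − 1, where dim M_{c,k} = (k+1)(N − ℓ_{c,k}).) -/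
open Module

open Topology Filter

section Rank

variable {W E : Type*} [NormedAddCommGroup W] [NormedSpace ℂ W] [FiniteDimensional ℂ W]
  [AddCommGroup E] [Module ℂ E]

theorem LinearMap.eventually_finrank_range_le_add_smul (A B : E →ₗ[ℂ] W) :
    ∀ᶠ t : ℂ in 𝓝 0, finrank ℂ (range A) ≤ finrank ℂ (range (A + t • B)) := by
  let b := finBasis ℂ (range A)
  choose e he using fun i => (b i).2
  have hb : LinearIndependent ℂ fun i => A (e i) + (0 : ℂ) • B (e i) := by
    simpa [he, Function.comp_def] using b.linearIndependent.map' _ (range A).ker_subtype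
  have hc : Tendsto (fun (t : ℂ) i => A (e i) + t • B (e i)) (𝓝 0)
      (𝓝 fun i => A (e i) + (0 : ℂ) • B (e i)) := by
    refine Continuous.tendsto (f := fun (t : ℂ) i => A (e i) + t • B (e i)) ?_ 0
    fun_prop
  filter_upwards [hc.eventually hb.eventually] with t ht
  have h := finrank_span_eq_card ht
  rw [Fintype.card_fin] at h
  rw [← h]
  refine Submodule.finrank_mono (Submodule.span_le.2 ?_)
  rintro _ ⟨i, rfl⟩
  exact ⟨e i, by simp⟩

theorem LinearMap.eventually_finrank_range_lt_add_smul (A B : E →ₗ[ℂ] W) {x : E}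
    (hx : A x = 0) (hB : B x ∉ range A) :
    ∀ᶠ t : ℂ in 𝓝[≠] 0, finrank ℂ (range A) < finrank ℂ (range (A + t • B)) := by
  let b := finBasis ℂ (range A)
  choose e he using fun i => (b i).2
  let f : ℂ → Option (Fin (finrank ℂ (range A))) → W :=
    fun t o => o.elim (B x) fun i => A (e i) + t • B (e i)
  have hb : LinearIndependent ℂ (f 0) := by
    rw [linearIndependent_option]
    constructor
    · simpa [f, he, Function.comp_def] using b.linearIndependent.map' _ (range A).ker_subtype
    · refine fun h => hB (Submodule.span_le.2 ?_ h)
      rintro _ ⟨i, rfl⟩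
      exact ⟨e i, by simp [f]⟩
  have hc : Tendsto f (𝓝 0) (𝓝 (f 0)) := by
    refine Continuous.tendsto (continuous_pi fun o => ?_) 0
    cases o <;> simp only [f, Option.elim] <;> fun_prop
  filter_upwards [nhdsWithin_le_nhds (hc.eventually hb.eventually), self_mem_nhdsWithin] with t ht h0
  have h := finrank_span_eq_card ht
  rw [Fintype.card_option, Fintype.card_fin] at h
  rw [← Nat.succ_le_iff, ← Nat.add_one, ← h]
  refine Submodule.finrank_mono (Submodule.span_le.2 ?_)
  rintro _ ⟨i | i, rfl⟩
  · exact ⟨t⁻¹ • x, by simp [f, hx, smul_smul, inv_mul_cancel₀ (show t ≠ 0 from h0)]⟩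
  · exact ⟨e i, by simp [f]⟩

/-- Among families of linear maps depending affinely on a parameter, a parameter maximizing the total
rank is infinitesimally rank-stable. -/
theorem exists_forall_mem_range_of_mem_ker {X β : Type*} [Fintype β] [AddCommGroup X] [Module ℂ X]
    (A D : β → X → E →ₗ[ℂ] W) (hA : ∀ b v w, ∀ t : ℂ, A b (v + t • w) = A b v + t • D b w)
    (U : Set X) (hU : U.Nonempty) (hUo : ∀ v ∈ U, ∀ w, ∀ᶠ t : ℂ in 𝓝 0, v + t • w ∈ U) :
    ∃ v ∈ U, ∀ b w e, A b v e = 0 → D b w e ∈ LinearMap.range (A b v) := by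
  let r : X → ℕ := fun v => ∑ b, finrank ℂ (LinearMap.range (A b v))
  have hbdd : BddAbove (r '' U) := by
    refine ⟨∑ _b : β, finrank ℂ W, ?_⟩
    rintro _ ⟨v, -, rfl⟩
    exact Finset.sum_le_sum fun b _ => Submodule.finrank_le _
  obtain ⟨v, hv, hmax⟩ := Nat.sSup_mem (hU.image r) hbdd
  refine ⟨v, hv, fun b w e he => by_contra fun hD => ?_⟩
  have h1 := LinearMap.eventually_finrank_range_lt_add_smul _ _ he hD
  have h2 : ∀ᶠ t : ℂ in 𝓝[≠] 0, ∀ b, finrank ℂ (LinearMap.range (A b v)) ≤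
      finrank ℂ (LinearMap.range (A b v + t • D b w)) :=
    nhdsWithin_le_nhds (eventually_all.2 fun b =>
      LinearMap.eventually_finrank_range_le_add_smul (A b v) (D b w))
  obtain ⟨t, ht1, ht2, ht3⟩ := (h1.and (h2.and (nhdsWithin_le_nhds (hUo v hv w)))).exists
  have hlt : r v < r (v + t • w) := by
    refine Finset.sum_lt_sum (fun b _ => ?_) ⟨b, Finset.mem_univ _, ?_⟩ <;> rw [hA]
    exacts [ht2 b, ht1]
  exact (hmax ▸ hlt).not_ge (le_csSup hbdd ⟨_, ht3, rfl⟩)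

end Rank

/-- Within a linear space `X` of families of `κ`-tuples of vectors, if some family is independent
modulo every `C i`, then some such family makes all the intersections of the subspaces
`C i ⊔ span (u i)` infinitesimally stable under perturbations in `X`. -/
theorem exists_stable_family {V ι κ : Type*} [NormedAddCommGroup V] [NormedSpace ℂ V]
    [FiniteDimensional ℂ V] [Fintype ι] [DecidableEq ι] [Fintype κ] (C : ι → Submodule ℂ V)
    (X : Submodule ℂ (ι → κ → V)) {p : ι → κ → V}
    (hpX : p ∈ X)
    (hp : ∀ i, finrank ℂ ↥(C i ⊔ Submodule.span ℂ (Set.range (p i))) =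
      finrank ℂ (C i) + Fintype.card κ) :
    ∃ u ∈ X, (∀ i, finrank ℂ ↥(C i ⊔ Submodule.span ℂ (Set.range (u i))) =
      finrank ℂ (C i) + Fintype.card κ) ∧
      ∀ B : Finset ι, ∀ w ∈ X, ∀ (x : V) (l : ι → κ → ℂ),
        (∀ i ∈ B, x - ∑ j, l i j • u i j ∈ C i) →
        ∃ y, ∀ i ∈ B, y - ∑ j, l i j • w i j ∈ C i ⊔ Submodule.span ℂ (Set.range (u i)) := by
  let G : (i : ι) → (κ → V) → ((κ → ℂ) × C i) →ₗ[ℂ] V := fun i u =>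
    (Fintype.linearCombination ℂ u).coprod (C i).subtype
  let G' : (i : ι) → (κ → V) → ((κ → ℂ) × C i) →ₗ[ℂ] V := fun i u =>
    (Fintype.linearCombination ℂ u).coprod 0
  have hG : ∀ i u, LinearMap.range (G i u) = C i ⊔ Submodule.span ℂ (Set.range u) := by
    intro i u
    rw [LinearMap.range_coprod, Fintype.range_linearCombination, Submodule.range_subtype, sup_comm]
  have hGadd : ∀ i u w, ∀ t : ℂ, G i (u + t • w) = G i u + t • G' i w := by
    intro i u w t
    refine LinearMap.ext fun z => ?_
    simp only [G, G', LinearMap.coprod_apply, Fintype.linearCombination_apply, LinearMap.add_apply,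
      LinearMap.smul_apply, Pi.add_apply, Pi.smul_apply, smul_add, Finset.sum_add_distrib,
      Finset.smul_sum, smul_comm t, LinearMap.zero_apply, add_zero]
    abel
  let A : Finset ι → X → (V × (∀ i, (κ → ℂ) × C i)) →ₗ[ℂ] (ι → V) := fun B u =>
    LinearMap.pi fun i => if i ∈ B then
      LinearMap.fst ℂ _ _ - G i (u.1 i) ∘ₗ LinearMap.proj i ∘ₗ LinearMap.snd ℂ _ _ else 0
  let D : Finset ι → X → (V × (∀ i, (κ → ℂ) × C i)) →ₗ[ℂ] (ι → V) := fun B u =>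
    LinearMap.pi fun i => if i ∈ B then
      - (G' i (u.1 i) ∘ₗ LinearMap.proj i ∘ₗ LinearMap.snd ℂ _ _) else 0
  obtain ⟨u, hu, hs⟩ := exists_forall_mem_range_of_mem_ker A D
    (by
      intro B u w t
      refine LinearMap.ext fun z => funext fun i => ?_
      by_cases hi : i ∈ B
      · simp [A, D, hi, hGadd, sub_eq_add_neg, add_assoc, add_comm]
      · simp [A, D, hi])
    {u : X | ∀ i, finrank ℂ ↥(C i ⊔ Submodule.span ℂ (Set.range (u.1 i))) =
      finrank ℂ (C i) + Fintype.card κ} ⟨⟨p, hpX⟩, hp⟩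
    (by
      intro u hu w
      refine eventually_all.2 fun i => ?_
      filter_upwards [LinearMap.eventually_finrank_range_le_add_smul (G i (u.1 i)) (G' i (w.1 i))]
        with t ht
      rw [← hGadd, hG, hG, hu i] at ht
      refine le_antisymm ?_ ht
      exact (Submodule.finrank_add_le_finrank_add_finrank _ _).trans
        (Nat.add_le_add_left (finrank_range_le_card _) _))
  refine ⟨u.1, u.2, hu, fun B w hw x l hx => ?_⟩
  obtain ⟨⟨y, z⟩, hz⟩ := hs B ⟨w, hw⟩
    (x, fun i => (l i, if hi : i ∈ B then ⟨_, hx i hi⟩ else 0))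
    (by
      funext i
      by_cases hi : i ∈ B
      · simp [A, G, hi, Fintype.linearCombination_apply]
      · simp [A, hi])
  refine ⟨-y, fun i hi => ?_⟩
  have := congrFun hz i
  simp only [A, D, G', hi, LinearMap.pi_apply, if_true, LinearMap.sub_apply, LinearMap.fst_apply,
    LinearMap.neg_apply, LinearMap.comp_apply, LinearMap.snd_apply, LinearMap.proj_apply,
    LinearMap.coprod_apply, LinearMap.zero_apply, add_zero, Fintype.linearCombination_apply] at this
  rw [← hG, sub_eq_add_neg, ← this]
  exact ⟨-z i, by simp only [map_neg]; abel⟩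

/-- `H` splits over `B` when `B` is a disjoint union of two nonempty parts whose intersections of
the `H i` together span the whole space. -/
def SplitsOver {V ι : Type*} [AddCommGroup V] [Module ℂ V] [DecidableEq ι]
    (H : ι → Submodule ℂ V) (B : Finset ι) : Prop :=
  ∃ B₁ B₂ : Finset ι, B₁.Nonempty ∧ B₂.Nonempty ∧ Disjoint B₁ B₂ ∧ B₁ ∪ B₂ = B ∧
    (⨅ i ∈ B₁, H i) ⊔ (⨅ i ∈ B₂, H i) = ⊤

theorem SplitsOver.exists_ssubset {V ι : Type*} [AddCommGroup V] [Module ℂ V] [DecidableEq ι]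
    {H : ι → Submodule ℂ V} {B : Finset ι} (h : SplitsOver H B) :
    ∃ B₁ B₂ : Finset ι, B₁.Nonempty ∧ B₂.Nonempty ∧ B₁ ⊂ B ∧ B₂ ⊂ B ∧ Disjoint B₁ B₂ ∧
      B₁ ∪ B₂ = B ∧ (⨅ i ∈ B₁, H i) ⊔ (⨅ i ∈ B₂, H i) = ⊤ := by
  obtain ⟨B₁, B₂, hB₁, hB₂, hdisj, rfl, htop⟩ := h
  refine ⟨B₁, B₂, hB₁, hB₂, ?_, ?_, hdisj, rfl, htop⟩
  · refine Finset.ssubset_iff_subset_ne.2 ⟨Finset.subset_union_left, fun he => ?_⟩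
    exact hB₂.ne_empty (Finset.disjoint_self_iff_empty _ |>.1
      (hdisj.mono_left (he ▸ Finset.subset_union_right)))
  · refine Finset.ssubset_iff_subset_ne.2 ⟨Finset.subset_union_right, fun he => ?_⟩
    exact hB₁.ne_empty (Finset.disjoint_self_iff_empty _ |>.1
      (hdisj.mono_right (he ▸ Finset.subset_union_left)))

theorem splitsOver_of_forall_exists_sub_smul_mem {V ι : Type*} [AddCommGroup V]
    [Module ℂ V] [DecidableEq ι] (H : ι → Submodule ℂ V)
    (B : Finset ι) (a : ι → ℂ) (h : ∀ w, ∃ y, ∀ i ∈ B, y - a i • w ∈ H i) {i₁ i₂ : ι}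
    (h₁ : i₁ ∈ B) (h₂ : i₂ ∈ B) (ha : a i₁ ≠ a i₂) : SplitsOver H B := by
  have hprod : ∀ T : Finset ℂ, ∀ w, ∃ y, ∀ i ∈ B, y - (∏ c ∈ T, (a i - c)) • w ∈ H i := by
    intro T
    induction T using Finset.induction_on with
    | empty => exact fun w => ⟨w, by simp⟩
    | insert c T hc ih =>
      intro w
      obtain ⟨y, hy⟩ := ih w
      obtain ⟨z, hz⟩ := h y
      refine ⟨z - c • y, fun i hi => ?_⟩
      rw [Finset.prod_insert hc]
      convert! add_mem (hz i hi) ((H i).smul_mem (a i - c) (hy i hi)) using 1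
      module
  let T := (B.image a).erase (a i₁)
  have hT : ∏ c ∈ T, (a i₁ - c) ≠ 0 :=
    Finset.prod_ne_zero_iff.2 fun c hc => sub_ne_zero.2 (Finset.ne_of_mem_erase hc).symm
  refine ⟨{i ∈ B | a i = a i₁}, {i ∈ B | ¬ a i = a i₁}, ⟨i₁, by simp [h₁]⟩,
    ⟨i₂, by simp [h₂, ha.symm]⟩, Finset.disjoint_filter_filter_not _ _ _,
    Finset.filter_union_filter_not_eq _ _, eq_top_iff.2 fun w _ => ?_⟩
  obtain ⟨y, hy⟩ := hprod T ((∏ c ∈ T, (a i₁ - c))⁻¹ • w)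
  refine Submodule.mem_sup.2 ⟨w - y, ?_, y, ?_, sub_add_cancel w y⟩
  · simp only [Submodule.mem_iInf, Finset.mem_filter]
    rintro i ⟨hi, hai⟩
    have := hy i hi
    rw [hai, smul_inv_smul₀ hT] at this
    rw [← neg_sub]
    exact neg_mem this
  · simp only [Submodule.mem_iInf, Finset.mem_filter]
    rintro i ⟨hi, hai⟩
    have := hy i hi
    rwa [Finset.prod_eq_zero (i := a i) (by simp [T, hai]; exact ⟨i, hi, rfl⟩) (sub_self _),
      zero_smul, sub_zero] at this

/-- For a generic family of `κ`-tuples of vectors sharing their entries indexed by `T`, every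
intersection of the subspaces `C i ⊔ span (u i)` splits or is as small as its trivial part. -/
theorem exists_generic_family {V ι κ : Type*} [NormedAddCommGroup V] [NormedSpace ℂ V]
    [FiniteDimensional ℂ V] [Fintype ι] [DecidableEq ι] [Fintype κ] (C : ι → Submodule ℂ V)
    [DecidableEq κ] (T : Finset κ) {p : κ → V}
    (hp : ∀ i, finrank ℂ ↥(C i ⊔ Submodule.span ℂ (Set.range p)) =
      finrank ℂ (C i) + Fintype.card κ) :
    ∃ u : ι → κ → V, (∀ j ∈ T, ∀ i i', u i j = u i' j) ∧
      (∀ i, finrank ℂ ↥(C i ⊔ Submodule.span ℂ (Set.range (u i))) =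
        finrank ℂ (C i) + Fintype.card κ) ∧
      ∀ B : Finset ι, 2 ≤ B.card →
        SplitsOver (fun i => C i ⊔ Submodule.span ℂ (Set.range (u i))) B ∨
        finrank ℂ ↥(⨅ i ∈ B, C i ⊔ Submodule.span ℂ (Set.range (u i))) ≤
          finrank ℂ ↥(⨅ i ∈ B, C i) + T.card := by
  let X : Submodule ℂ (ι → κ → V) :=
    { carrier := {u | ∀ j ∈ T, ∀ i i', u i j = u i' j}
      add_mem' := fun {u w} hu hw j hj i i' => by simp [hu j hj i i', hw j hj i i']
      zero_mem' := fun _ _ _ _ => rfl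
      smul_mem' := fun c u hu j hj i i' => by simp [hu j hj i i'] }
  obtain ⟨u, huX, hu, hs⟩ := exists_stable_family C X (p := fun _ => p) (fun _ _ _ _ => rfl) hp
  classical
  refine ⟨u, huX, hu, fun B hB => or_iff_not_imp_left.2 fun hsplit => ?_⟩
  obtain ⟨i₀, h₀, i₁, h₁, h01⟩ := Finset.one_lt_card.1 hB
  suffices h : (⨅ i ∈ B, C i ⊔ Submodule.span ℂ (Set.range (u i))) ≤
      (⨅ i ∈ B, C i) ⊔ Submodule.span ℂ (T.image (u i₀) : Finset V) by
    refine (Submodule.finrank_mono h).trans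
      ((Submodule.finrank_add_le_finrank_add_finrank _ _).trans (Nat.add_le_add_left ?_ _))
    exact (finrank_span_finset_le_card _).trans Finset.card_image_le
  intro x hx
  simp only [Submodule.mem_iInf] at hx
  have hl : ∀ i, ∃ l : κ → ℂ, i ∈ B → x - ∑ j, l j • u i j ∈ C i := by
    intro i
    by_cases hi : i ∈ B
    · obtain ⟨c, hc, y, hy, rfl⟩ := Submodule.mem_sup.1 (hx i hi)
      obtain ⟨l, rfl⟩ := (Submodule.mem_span_range_iff_exists_fun ℂ).1 hy
      exact ⟨l, fun _ => by simpa using hc⟩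
    · exact ⟨0, fun h => absurd h hi⟩
  choose l hl using hl
  have hconst : ∀ j ∈ T, ∀ i ∈ B, l i j = l i₀ j := by
    intro j hj i hi
    by_contra hne
    refine hsplit (splitsOver_of_forall_exists_sub_smul_mem _ B (fun i => l i j) (fun w => ?_)
      hi h₀ hne)
    obtain ⟨y, hy⟩ := hs B (fun _ => Pi.single j w) (fun _ _ _ _ => rfl) x l hl
    refine ⟨y, fun i hi => ?_⟩
    simpa [Pi.single_apply] using hy i hi
  have hzero : ∀ j ∉ T, ∀ i ∈ B, l i j = 0 := by
    intro j hj i hi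
    by_contra hne
    obtain ⟨i', hi', hii'⟩ := Finset.exists_mem_ne hB i
    refine hsplit (splitsOver_of_forall_exists_sub_smul_mem _ B (Pi.single i (l i j)) (fun w => ?_)
      hi hi' (by simpa [hii'] using hne))
    obtain ⟨y, hy⟩ := hs B (Pi.single i (Pi.single j w))
      (fun j' hj' _ _ => by
        have : j' ≠ j := fun h => hj (h ▸ hj')
        simp [Pi.single_apply, ite_apply, this]) x l hl
    refine ⟨y, fun m hm => ?_⟩
    have := hy m hm
    by_cases hmi : m = i
    · subst hmi
      simpa [Pi.single_apply] using this
    · simpa [hmi] using this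
  have hsum : ∀ i ∈ B, ∑ j, l i j • u i j = ∑ j ∈ T, l i₀ j • u i₀ j := by
    intro i hi
    rw [← Finset.sum_subset (Finset.subset_univ T) fun j _ hj => by rw [hzero j hj i hi, zero_smul]]
    exact Finset.sum_congr rfl fun j hj => by rw [hconst j hj i hi, huX j hj i i₀]
  refine Submodule.mem_sup.2 ⟨x - ∑ j ∈ T, l i₀ j • u i₀ j, ?_, _, ?_, sub_add_cancel _ _⟩
  · simp only [Submodule.mem_iInf]
    intro i hi
    rw [← hsum i hi]
    exact hl i hi
  · exact sum_mem fun j hj => Submodule.smul_mem _ _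
      (Submodule.subset_span (Finset.mem_coe.2 (Finset.mem_image_of_mem _ hj)))

theorem sub_finrank_iInf_union_of_sup_eq_top {V ι : Type*} [AddCommGroup V] [Module ℂ V]
    [FiniteDimensional ℂ V] [DecidableEq ι] (H : ι → Submodule ℂ V)
    (B₁ B₂ : Finset ι) (h : (⨅ i ∈ B₁, H i) ⊔ (⨅ i ∈ B₂, H i) = ⊤) :
    (finrank ℂ V : ℤ) - finrank ℂ ↥(⨅ i ∈ B₁ ∪ B₂, H i) =
      (finrank ℂ V - finrank ℂ ↥(⨅ i ∈ B₁, H i)) + (finrank ℂ V - finrank ℂ ↥(⨅ i ∈ B₂, H i)) := by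
  have := Submodule.finrank_sup_add_finrank_inf_eq (⨅ i ∈ B₁, H i) (⨅ i ∈ B₂, H i)
  rw [h, finrank_top, ← Finset.iInf_union] at this
  omega

theorem sub_finrank_iInf_le_sum {V ι : Type*} [AddCommGroup V] [Module ℂ V]
    [FiniteDimensional ℂ V] [DecidableEq ι] (H : ι → Submodule ℂ V) (B : Finset ι) :
    (finrank ℂ V : ℤ) - finrank ℂ ↥(⨅ i ∈ B, H i) ≤ ∑ i ∈ B, ((finrank ℂ V : ℤ) - finrank ℂ (H i)) := by
  induction B using Finset.induction_on with
  | empty => rw [show (⨅ i ∈ (∅ : Finset ι), H i) = ⊤ by simp]; simp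
  | insert i B hi ih =>
    rw [Finset.sum_insert hi, Finset.iInf_insert]
    have := Submodule.finrank_sup_add_finrank_inf_eq (H i) (⨅ i ∈ B, H i)
    have := Submodule.finrank_le (H i ⊔ ⨅ i ∈ B, H i)
    omega

/-- In a pseudo-disjoint arrangement, the expected codimensions over a set of centers with a common
point add up to at most the codimension of the join of a generic `P` with their intersection. -/
theorem IsPseudoDisjoint.sum_sub_finrank_le {N k n : ℕ}
    {C : Fin n → Submodule ℂ (Fin (N + 1) → ℂ)} (hpd : IsPseudoDisjoint N k n C)
    {p : Fin (k + 1) → Fin (N + 1) → ℂ}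
    (hp : ∀ i, finrank ℂ ↥(C i ⊔ Submodule.span ℂ (Set.range p)) = finrank ℂ (C i) + (k + 1))
    (B : Finset (Fin n)) (hB : B.Nonempty) (hCB : (⨅ i ∈ B, C i) ≠ ⊥) :
    ∑ i ∈ B, ((N : ℤ) - k - finrank ℂ (C i)) ≤ N - k - finrank ℂ ↥(⨅ i ∈ B, C i) := by
  let T : Finset (Fin (k + 1)) := Finset.univ.erase 0
  have hT : T.card = k := by simp [T]
  obtain ⟨u, huT, hu, hsplit⟩ := exists_generic_family C T (p := p) (by simpa using hp)
  rw [hT] at hsplit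
  let H : Fin n → Submodule ℂ (Fin (N + 1) → ℂ) :=
    fun i => C i ⊔ Submodule.span ℂ (Set.range (u i))
  replace hu : ∀ i, finrank ℂ (H i) = finrank ℂ (C i) + (k + 1) := by
    simpa only [Fintype.card_fin] using hu
  replace hsplit : ∀ B : Finset (Fin n), 2 ≤ B.card → SplitsOver H B ∨
    finrank ℂ ↥(⨅ i ∈ B, H i) ≤ finrank ℂ ↥(⨅ i ∈ B, C i) + k := hsplit
  have hcard : ∀ B : Finset (Fin n), 2 ≤ B.card → (⨅ i ∈ B, C i) ≠ ⊥ →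
      finrank ℂ ↥(⨅ i ∈ B, C i) + k + 1 ≤ finrank ℂ ↥(⨅ i ∈ B, H i) := by
    classical
    intro B hB hCB
    obtain ⟨i₀, hi₀⟩ : B.Nonempty := Finset.card_pos.1 (by omega)
    obtain ⟨d, hd, hd0⟩ := (Submodule.ne_bot_iff _).1 hCB
    simp only [Submodule.mem_iInf] at hd
    let Q : Submodule ℂ (Fin (N + 1) → ℂ) := Submodule.span ℂ (T.image (u i₀) : Finset _)
    have hQcard : finrank ℂ Q ≤ k :=
      ((finrank_span_finset_le_card _).trans Finset.card_image_le).trans hT.le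
    have hQH : ∀ i, Q ≤ Submodule.span ℂ (Set.range (u i)) := by
      intro i
      refine Submodule.span_le.2 fun x hx => ?_
      obtain ⟨j, hj, rfl⟩ := Finset.mem_image.1 (Finset.mem_coe.1 hx)
      rw [huT j hj i₀ i]
      exact Submodule.subset_span ⟨j, rfl⟩
    have hCQ : ∀ i, finrank ℂ ↥(C i ⊔ Q) = finrank ℂ (C i) + k := by
      intro i
      have h1 := Submodule.finrank_add_le_finrank_add_finrank (C i) Q
      have hle : H i ≤ (C i ⊔ Q) ⊔ Submodule.span ℂ {u i 0} := by
        refine sup_le (le_sup_left.trans le_sup_left) (Submodule.span_le.2 ?_)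
        rintro _ ⟨j, rfl⟩
        by_cases hj : j = 0
        · subst hj
          exact Submodule.mem_sup_right (Submodule.mem_span_singleton_self _)
        · have hjT : j ∈ T := by simp [T, hj]
          rw [SetLike.mem_coe, huT j hjT i i₀]
          exact Submodule.mem_sup_left (Submodule.mem_sup_right
            (Submodule.subset_span (Finset.mem_coe.2 (Finset.mem_image_of_mem _ hjT))))
      have h2 := (Submodule.finrank_mono hle).trans
        (Submodule.finrank_add_le_finrank_add_finrank _ _)
      have h3 : finrank ℂ ↥(Submodule.span ℂ {u i 0}) ≤ _ := finrank_span_le_card {u i 0}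
      rw [Set.toFinset_singleton, Finset.card_singleton] at h3
      have h4 := hu i
      omega
    have hdQ : d ∉ Q := by
      intro hdQ
      have h1 := Submodule.finrank_sup_add_finrank_inf_eq (C i₀) Q
      have h2 : C i₀ ⊓ Q = ⊥ := Submodule.finrank_eq_zero.1 (by have := hCQ i₀; omega)
      have h3 : d ∈ C i₀ ⊓ Q := ⟨hd i₀ hi₀, hdQ⟩
      rw [h2] at h3
      exact hd0 ((Submodule.mem_bot _).1 h3)
    have hQk : finrank ℂ Q = k := by
      have h1 := Submodule.finrank_add_le_finrank_add_finrank (C i₀) Q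
      have := hCQ i₀
      omega
    let H' : Fin n → Submodule ℂ (Fin (N + 1) → ℂ) := fun i =>
      if d ∈ H i then H i else (C i ⊔ Q) ⊔ Submodule.span ℂ {d}
    have hHH' : ∀ i ∈ B, H' i = H i := fun i hi =>
      if_pos (Submodule.mem_sup_left (hd i hi))
    have key := hpd H' (fun i => ?_) ?_ B hB hCB
    · have : (⨅ i ∈ B, H' i) = ⨅ i ∈ B, H i := iInf_congr fun i => iInf_congr (hHH' i)
      rwa [this] at key
    · by_cases hdi : d ∈ H i
      · rw [show H' i = H i from if_pos hdi]
        exact ⟨le_sup_left, hu i⟩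
      · rw [show H' i = (C i ⊔ Q) ⊔ Submodule.span ℂ {d} from if_neg hdi]
        refine ⟨le_sup_left.trans le_sup_left, ?_⟩
        rw [Submodule.finrank_sup_span_singleton fun h => hdi (sup_le_sup_left (hQH i) _ h), hCQ]
    · have hle : Q ⊔ Submodule.span ℂ {d} ≤ ⨅ i, H' i := by
        refine le_iInf fun i => ?_
        by_cases hdi : d ∈ H i
        · rw [show H' i = H i from if_pos hdi]
          exact sup_le ((hQH i).trans le_sup_right) ((Submodule.span_singleton_le_iff_mem _ _).2 hdi)
        · rw [show H' i = (C i ⊔ Q) ⊔ Submodule.span ℂ {d} from if_neg hdi]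
          exact sup_le_sup_right le_sup_right _
      have := Submodule.finrank_mono hle
      rwa [Submodule.finrank_sup_span_singleton hdQ, hQk] at this
  have hcodim : ∀ B : Finset (Fin n), B.Nonempty → (⨅ i ∈ B, C i) ≠ ⊥ →
      ∑ i ∈ B, ((N : ℤ) - k - finrank ℂ (C i)) ≤ N + 1 - finrank ℂ ↥(⨅ i ∈ B, H i) := by
    intro B
    induction B using Finset.strongInduction with
    | H B ih =>
      intro hB hCB
      rcases (Nat.succ_le_iff.2 hB.card_pos).eq_or_lt with h1 | h2
      · obtain ⟨i, rfl⟩ := Finset.card_eq_one.1 h1.symm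
        rw [Finset.sum_singleton, Finset.iInf_singleton]
        have := hu i
        omega
      · rcases hsplit B h2 with hs | h
        · obtain ⟨B₁, B₂, hB₁, hB₂, hlt₁, hlt₂, hdisj, rfl, htop⟩ := hs.exists_ssubset
          have h := sub_finrank_iInf_union_of_sup_eq_top H B₁ B₂ htop
          rw [Finset.iInf_union] at hCB
          have h1 := ih B₁ hlt₁ hB₁ fun h => hCB (by rw [h, bot_inf_eq])
          have h2 := ih B₂ hlt₂ hB₂ fun h => hCB (by rw [h, inf_bot_eq])
          rw [finrank_fin_fun] at h
          rw [Finset.sum_union hdisj]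
          push_cast at h
          linarith
        · have := hcard B h2 hCB
          omega
  have h1 := hcodim B hB hCB
  rcases (Nat.succ_le_iff.2 hB.card_pos).eq_or_lt with h2 | h2
  · obtain ⟨i, rfl⟩ := Finset.card_eq_one.1 h2.symm
    rw [Finset.sum_singleton, Finset.iInf_singleton]
  · have := hcard B h2 hCB
    omega

/-- **Paper's Corollary "dim"**: for a pseudo-disjoint arrangement, the dimension
`(k+1)(N − ℓ_{c,k}) = (k+1)(N+1−L)` of the multiview variety equals
`(k+1) · min (N−k, Σ_i (h_i − k))` where `h_i − k = N − k − finrank (C i)`. -/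
theorem dim_pseudo_disjoint (N k n : ℕ) (hk : k ≤ N) (hn : 1 ≤ n)
    (C : Fin n → Submodule ℂ (Fin (N + 1) → ℂ))
    (hC : ∀ i, finrank ℂ ↥(C i) ≤ N - k)
    (hpd : IsPseudoDisjoint N k n C)
    (L : ℕ)
    (hL : IsLeast
        { r : ℕ | ∃ P : Submodule ℂ (Fin (N + 1) → ℂ),
            finrank ℂ ↥P = k + 1 ∧ (∀ i, P ⊓ C i = ⊥) ∧
            r = finrank ℂ ↥(⨅ i, C i ⊔ P) } L) :
    ((k : ℤ) + 1) * ((N : ℤ) + 1 - L) =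
      ((k : ℤ) + 1) * min ((N : ℤ) - k) (∑ i, ((N : ℤ) - k - finrank ℂ ↥(C i))) := by
  obtain ⟨⟨P, hPk, hPC, hPL⟩, hmin⟩ := hL
  congr 1
  have hsup : ∀ i, finrank ℂ ↥(C i ⊔ P) = finrank ℂ (C i) + (k + 1) := by
    intro i
    have h1 := Submodule.finrank_sup_add_finrank_inf_eq (C i) P
    rw [inf_comm, hPC i, finrank_bot] at h1
    omega
  apply le_antisymm
  · refine le_min ?_ ?_
    · have h1 : finrank ℂ P ≤ finrank ℂ ↥(⨅ i, C i ⊔ P) :=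
        Submodule.finrank_mono (le_iInf fun i => le_sup_right)
      omega
    · have h1 := sub_finrank_iInf_le_sum (fun i => C i ⊔ P) Finset.univ
      rw [show (⨅ i ∈ Finset.univ, C i ⊔ P) = ⨅ i, C i ⊔ P by simp, ← hPL, finrank_fin_fun] at h1
      simp only [hsup] at h1
      push_cast at h1
      refine h1.trans (Finset.sum_le_sum fun i _ => ?_)
      omega
  let b := finBasisOfFinrankEq ℂ P hPk
  let p : Fin (k + 1) → Fin (N + 1) → ℂ := fun j => b j
  have hpP : Submodule.span ℂ (Set.range p) = P := by
    have : Set.range p = P.subtype '' Set.range b := by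
      rw [← Set.range_comp]
      rfl
    rw [this, Submodule.span_image, b.span_eq, Submodule.map_top, Submodule.range_subtype]
  have hp : ∀ i, finrank ℂ ↥(C i ⊔ Submodule.span ℂ (Set.range p)) =
      finrank ℂ (C i) + (k + 1) := fun i => hpP.symm ▸ hsup i
  obtain ⟨u, huT, hu, hsplit⟩ := exists_generic_family C Finset.univ (p := p) (by simpa using hp)
  rw [Finset.card_univ, Fintype.card_fin] at hsplit
  let H : Fin n → Submodule ℂ (Fin (N + 1) → ℂ) :=
    fun i => C i ⊔ Submodule.span ℂ (Set.range (u i))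
  replace hu : ∀ i, finrank ℂ (H i) = finrank ℂ (C i) + (k + 1) := by
    simpa only [Fintype.card_fin] using hu
  replace hsplit : ∀ B : Finset (Fin n), 2 ≤ B.card → SplitsOver H B ∨
    finrank ℂ ↥(⨅ i ∈ B, H i) ≤ finrank ℂ ↥(⨅ i ∈ B, C i) + (k + 1) := hsplit
  have hnonneg : ∀ i, 0 ≤ (N : ℤ) - k - finrank ℂ (C i) := fun i => by
    have := hC i
    omega
  have hcodim : ∀ B : Finset (Fin n), B.Nonempty →
      min ((N : ℤ) - k) (∑ i ∈ B, ((N : ℤ) - k - finrank ℂ (C i))) ≤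
        N + 1 - finrank ℂ ↥(⨅ i ∈ B, H i) := by
    intro B
    induction B using Finset.strongInduction with
    | H B ih =>
      intro hB
      rcases (Nat.succ_le_iff.2 hB.card_pos).eq_or_lt with h1 | h2
      · obtain ⟨i, rfl⟩ := Finset.card_eq_one.1 h1.symm
        rw [Finset.sum_singleton, Finset.iInf_singleton]
        have := hu i
        omega
      · rcases hsplit B h2 with hs | h
        · obtain ⟨B₁, B₂, hB₁, hB₂, hlt₁, hlt₂, hdisj, rfl, htop⟩ := hs.exists_ssubset
          have h := sub_finrank_iInf_union_of_sup_eq_top H B₁ B₂ htop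
          have h1 := ih B₁ hlt₁ hB₁
          have h2 := ih B₂ hlt₂ hB₂
          have h3 := Finset.sum_nonneg fun i (_ : i ∈ B₁) => hnonneg i
          have h4 := Finset.sum_nonneg fun i (_ : i ∈ B₂) => hnonneg i
          rw [finrank_fin_fun] at h
          rw [Finset.sum_union hdisj]
          push_cast at h
          omega
        · by_cases hCB : (⨅ i ∈ B, C i) = ⊥
          · rw [hCB, finrank_bot] at h
            omega
          · have := hpd.sum_sub_finrank_le hp B hB hCB
            omega
  let i₀ : Fin n := ⟨0, hn⟩
  have hH₀ : ∀ i, H i = C i ⊔ Submodule.span ℂ (Set.range (u i₀)) := fun i => by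
    rw [funext fun j => huT j (Finset.mem_univ j) i₀ i]
  have hle : L ≤ finrank ℂ ↥(⨅ i, H i) := by
    have hrank : finrank ℂ ↥(Submodule.span ℂ (Set.range (u i₀))) = k + 1 := by
      have h1 := Submodule.finrank_add_le_finrank_add_finrank (C i₀)
        (Submodule.span ℂ (Set.range (u i₀)))
      have h2 : finrank ℂ ↥(Submodule.span ℂ (Set.range (u i₀))) ≤ Fintype.card (Fin (k + 1)) :=
        finrank_range_le_card _
      rw [Fintype.card_fin] at h2
      have h3 := hu i₀
      rw [hH₀] at h3
      omega
    refine hmin ⟨_, hrank, fun i => ?_, by rw [iInf_congr hH₀]⟩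
    have h1 := Submodule.finrank_sup_add_finrank_inf_eq (C i)
      (Submodule.span ℂ (Set.range (u i₀)))
    have h2 := hu i
    rw [hH₀] at h2
    rw [inf_comm]
    exact Submodule.finrank_eq_zero.1 (by omega)
  have h := hcodim Finset.univ ⟨i₀, Finset.mem_univ _⟩
  rw [show (⨅ i ∈ Finset.univ, H i) = ⨅ i, H i by simp] at h
  omega
end

section
/- Let c 1, c 2 be submodules of V = Fin (N+1) → ℂ and let d 1, d 2 : ℕ with finrank (c i) ≤ d i ≤ N+1 for i = 1, 2. Then: (a) every pair of submodules H 1, H 2 with c i ≤ H i and finrank (H i) = d i satisfies (as integers) finrank (H 1 ⊓ H 2) ≥ max ( finrank (c 1 ⊓ c 2), d 1 + d 2 − (N+1) ); and (b) there exist submodules H 1, H 2 with c i ≤ H i, finrank (H i) = d i, and (as integers) finrank (H 1 ⊓ H 2) = max ( finrank (c 1 ⊓ c 2), d 1 + d 2 − (N+1) ). (Paper's Lemma 2.6 'subsp dim formula': for generic H_i through c_i, dim H_1 ∧ H_2 = max { dim c_1 ∧ c_2, dim H_1 + dim H_2 − N }; genericity is rendered as the minimum over all such pairs, attained by some pair.)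 -/
open Module

/-- In a finite-dimensional space, every subspace `c` extends to a subspace `H'` of any prescribed
larger dimension that is in general position with respect to `H`: either `H` and `H'` span the
whole space, or `H'` meets `H` in the same dimension as `c` does. -/
theorem exists_finrank_eq_sup_eq_top_or_finrank_inf_eq {K V : Type*} [DivisionRing K]
    [AddCommGroup V] [Module K V] [FiniteDimensional K V] (H c : Submodule K V) {d : ℕ}
    (hcd : finrank K c ≤ d) (hd : d ≤ finrank K V) :
    ∃ H' : Submodule K V, c ≤ H' ∧ finrank K H' = d ∧
      (H ⊔ H' = ⊤ ∨ finrank K ↥(H ⊓ H') = finrank K ↥(H ⊓ c)) := by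
  induction d, hcd using Nat.le_induction with
  | base => exact ⟨c, le_rfl, rfl, Or.inr rfl⟩
  | succ d _ ih =>
    obtain ⟨H', hcH', hH', h⟩ := ih (by lia)
    by_cases htop : H ⊔ H' = ⊤
    · have hne : H' ≠ ⊤ := by
        rintro rfl
        rw [finrank_top] at hH'
        lia
      obtain ⟨v, -, hv⟩ := SetLike.exists_of_lt hne.lt_top
      refine ⟨H' ⊔ Submodule.span K {v}, hcH'.trans le_sup_left, ?_, Or.inl ?_⟩
      · rw [Submodule.finrank_sup_span_singleton hv, hH']
      · rw [← sup_assoc, htop, top_sup_eq]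
    · obtain ⟨v, -, hv⟩ := SetLike.exists_of_lt (Ne.lt_top htop)
      have hrank := Submodule.finrank_sup_span_singleton
        (fun hv' ↦ hv (le_sup_right (a := H) hv') : v ∉ H')
      refine ⟨H' ⊔ Submodule.span K {v}, hcH'.trans le_sup_left, by rw [hrank, hH'], Or.inr ?_⟩
      rw [← h.resolve_left htop]
      have hsup := Submodule.finrank_sup_span_singleton hv
      rw [sup_assoc] at hsup
      have h₁ := Submodule.finrank_sup_add_finrank_inf_eq H (H' ⊔ Submodule.span K {v})
      have h₂ := Submodule.finrank_sup_add_finrank_inf_eq H H'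
      lia

/-- **Paper's Lemma 2.6 "subsp dim formula"**: for fixed centers `c 1, c 2` and
subspaces `H i` through `c i` of fixed dimensions `d i`, the intersection
`H 1 ⊓ H 2` always has `finrank ≥ max (finrank (c 1 ⊓ c 2), d 1 + d 2 − (N+1))`,
and this bound is attained by some (generic) choice of `H 1, H 2`. -/
theorem subsp_dim_formula (N : ℕ) (c₁ c₂ : Submodule ℂ (Fin (N + 1) → ℂ))
    (d₁ d₂ : ℕ)
    (hc₁ : finrank ℂ ↥c₁ ≤ d₁) (hd₁ : d₁ ≤ N + 1)
    (hc₂ : finrank ℂ ↥c₂ ≤ d₂) (hd₂ : d₂ ≤ N + 1) :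
    (∀ H₁ H₂ : Submodule ℂ (Fin (N + 1) → ℂ),
      c₁ ≤ H₁ → c₂ ≤ H₂ → finrank ℂ ↥H₁ = d₁ → finrank ℂ ↥H₂ = d₂ →
      (finrank ℂ ↥(H₁ ⊓ H₂) : ℤ) ≥
        max ((finrank ℂ ↥(c₁ ⊓ c₂) : ℤ)) ((d₁ : ℤ) + d₂ - (N + 1))) ∧
    (∃ H₁ H₂ : Submodule ℂ (Fin (N + 1) → ℂ),
      c₁ ≤ H₁ ∧ c₂ ≤ H₂ ∧ finrank ℂ ↥H₁ = d₁ ∧ finrank ℂ ↥H₂ = d₂ ∧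
      (finrank ℂ ↥(H₁ ⊓ H₂) : ℤ) =
        max ((finrank ℂ ↥(c₁ ⊓ c₂) : ℤ)) ((d₁ : ℤ) + d₂ - (N + 1))) := by
  have hV : finrank ℂ (Fin (N + 1) → ℂ) = N + 1 := by simp
  have lower : ∀ H₁ H₂ : Submodule ℂ (Fin (N + 1) → ℂ),
      c₁ ≤ H₁ → c₂ ≤ H₂ → finrank ℂ ↥H₁ = d₁ → finrank ℂ ↥H₂ = d₂ →
      (finrank ℂ ↥(H₁ ⊓ H₂) : ℤ) ≥
        max ((finrank ℂ ↥(c₁ ⊓ c₂) : ℤ)) ((d₁ : ℤ) + d₂ - (N + 1)) := by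
    intro H₁ H₂ h₁ h₂ hr₁ hr₂
    have hmono := Submodule.finrank_mono (inf_le_inf h₁ h₂)
    have hsum := Submodule.finrank_sup_add_finrank_inf_eq H₁ H₂
    have hle := Submodule.finrank_le (H₁ ⊔ H₂)
    lia
  refine ⟨lower, ?_⟩
  obtain ⟨H₁, h₁, hr₁, hH₁⟩ :=
    exists_finrank_eq_sup_eq_top_or_finrank_inf_eq c₂ c₁ hc₁ (hd₁.trans_eq hV.symm)
  obtain ⟨H₂, h₂, hr₂, hH₂⟩ :=
    exists_finrank_eq_sup_eq_top_or_finrank_inf_eq H₁ c₂ hc₂ (hd₂.trans_eq hV.symm)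
  refine ⟨H₁, H₂, h₁, h₂, hr₁, hr₂, le_antisymm ?_ (lower H₁ H₂ h₁ h₂ hr₁ hr₂)⟩
  by_cases htop : H₁ ⊔ H₂ = ⊤
  · have hsum := Submodule.finrank_sup_add_finrank_inf_eq H₁ H₂
    rw [htop, finrank_top] at hsum
    lia
  · have hntop : c₂ ⊔ H₁ ≠ ⊤ := fun h ↦
      htop (top_unique (h.ge.trans (sup_le (h₂.trans le_sup_right) le_sup_left)))
    rw [hH₂.resolve_left htop, inf_comm H₁, hH₁.resolve_left hntop, inf_comm c₂]
    exact le_max_left _ _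
end

section
/- Let c 0 ≤ c be submodules of V = Fin (N+1) → ℂ, let E be a complement of c 0 (i.e. c 0 ⊓ E = ⊥ and c 0 ⊔ E = ⊤), and let D : ℕ with finrank c ≤ D ≤ N+1. Then the map H ↦ H ⊓ E is a bijection from { H : Submodule ℂ V | c ≤ H ∧ finrank H = D } onto { H' : Submodule ℂ V | H' ≤ E ∧ (c ⊓ E) ≤ H' ∧ finrank H' = D − finrank (c 0) }, with inverse given by H' ↦ c 0 ⊔ H'. (Paper's Lemma 2.5 'isomo onto *': d-planes H through c correspond bijectively to (d − dim c_0 − 1)-planes inside c_0^* through c' = c ∧ c_0^* via H ↦ H ∧ c_0^*, with inverse H' ↦ c_0 ∨ H'.) -/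
open Module

theorem sup_inf_eq_of_le_of_sup_eq_top {α : Type*} [Lattice α] [IsModularLattice α] [BoundedOrder α]
    {a b x : α} (hab : a ⊔ b = ⊤) (hx : a ≤ x) : a ⊔ x ⊓ b = x := by
  rw [inf_comm, ← sup_inf_assoc_of_le b hx, hab, top_inf_eq]

theorem sup_inf_eq_of_le_of_inf_eq_bot {α : Type*} [Lattice α] [IsModularLattice α] [BoundedOrder α]
    {a b y : α} (hab : a ⊓ b = ⊥) (hy : y ≤ b) : (a ⊔ y) ⊓ b = y := by
  rw [sup_comm, sup_inf_assoc_of_le a hy, hab, sup_bot_eq]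

theorem finrank_sup_of_inf_eq_bot {K V : Type*} [DivisionRing K] [AddCommGroup V] [Module K V]
    [FiniteDimensional K V] {s t : Submodule K V} (h : s ⊓ t = ⊥) :
    finrank K ↥(s ⊔ t) = finrank K s + finrank K t := by
  rw [← Submodule.finrank_sup_add_finrank_inf_eq s t, h, finrank_bot, add_zero]

/-- **Paper's Lemma 2.5 "isomo onto *"**: for `c 0 ≤ c` and a complement `E` of
`c 0`, the map `H ↦ H ⊓ E` is a bijection from the `D`-dimensional submodules
through `c` onto the `(D − finrank c 0)`-dimensional submodules of `E` through
`c ⊓ E`, with inverse `H' ↦ c 0 ⊔ H'`. -/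
theorem isomo_onto_star (N : ℕ) (c₀ c E : Submodule ℂ (Fin (N + 1) → ℂ))
    (hc₀c : c₀ ≤ c) (hE₁ : c₀ ⊓ E = ⊥) (hE₂ : c₀ ⊔ E = ⊤)
    (D : ℕ) (hcD : finrank ℂ ↥c ≤ D) (hDN : D ≤ N + 1) :
    Set.BijOn (fun H : Submodule ℂ (Fin (N + 1) → ℂ) => H ⊓ E)
      { H : Submodule ℂ (Fin (N + 1) → ℂ) | c ≤ H ∧ finrank ℂ ↥H = D }
      { H' : Submodule ℂ (Fin (N + 1) → ℂ) |
          H' ≤ E ∧ c ⊓ E ≤ H' ∧ finrank ℂ ↥H' = D - finrank ℂ ↥c₀ } ∧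
    (∀ H : Submodule ℂ (Fin (N + 1) → ℂ), c ≤ H → finrank ℂ ↥H = D →
      c₀ ⊔ (H ⊓ E) = H) ∧
    (∀ H' : Submodule ℂ (Fin (N + 1) → ℂ), H' ≤ E → c ⊓ E ≤ H' →
      finrank ℂ ↥H' = D - finrank ℂ ↥c₀ →
      (c₀ ⊔ H') ⊓ E = H' ∧ c ≤ c₀ ⊔ H' ∧ finrank ℂ ↥(c₀ ⊔ H') = D) := by
  have inf_of_le {H' : Submodule ℂ (Fin (N + 1) → ℂ)} (h : H' ≤ E) : c₀ ⊓ H' = ⊥ :=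
    le_bot_iff.1 (hE₁ ▸ inf_le_inf_left c₀ h)
  have left_inv (H : Submodule ℂ (Fin (N + 1) → ℂ)) (hH : c ≤ H) : c₀ ⊔ (H ⊓ E) = H :=
    sup_inf_eq_of_le_of_sup_eq_top hE₂ (hc₀c.trans hH)
  have right_inv (H' : Submodule ℂ (Fin (N + 1) → ℂ)) (hH' : H' ≤ E) (hc : c ⊓ E ≤ H')
      (hd : finrank ℂ ↥H' = D - finrank ℂ ↥c₀) :
      (c₀ ⊔ H') ⊓ E = H' ∧ c ≤ c₀ ⊔ H' ∧ finrank ℂ ↥(c₀ ⊔ H') = D := by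
    refine ⟨sup_inf_eq_of_le_of_inf_eq_bot hE₁ hH', ?_, ?_⟩
    · exact (left_inv c le_rfl).symm.le.trans (sup_le_sup_left hc c₀)
    · have h₀ := Submodule.finrank_mono hc₀c
      rw [finrank_sup_of_inf_eq_bot (inf_of_le hH'), hd]
      omega
  refine ⟨⟨?_, ?_, ?_⟩, fun H hH _ => left_inv H hH, right_inv⟩
  · rintro H ⟨hH, hd⟩
    refine ⟨inf_le_right, inf_le_inf_right E hH, ?_⟩
    have h := finrank_sup_of_inf_eq_bot (inf_of_le (inf_le_right : H ⊓ E ≤ E))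
    rw [left_inv H hH, hd] at h
    exact (Nat.sub_eq_of_eq_add' h).symm
  · rintro H₁ ⟨h₁, -⟩ H₂ ⟨h₂, -⟩ h
    rw [← left_inv H₁ h₁, ← left_inv H₂ h₂]
    exact congrArg (c₀ ⊔ ·) h
  · rintro H' ⟨hH', hc, hd⟩
    obtain ⟨h, hle, hD⟩ := right_inv H' hH' hc hd
    exact ⟨c₀ ⊔ H', ⟨hle, hD⟩, h⟩
end

section
/- Let C 1, …, C n and H 1, …, H n (n ≥ 1) be submodules of V = Fin (N+1) → ℂ with C i ≤ H i for all i; set c := ⨅ i, C i, let E be a complement of c (c ⊓ E = ⊥, c ⊔ E = ⊤), and set H' i := H i ⊓ E. Then for all nonempty subsets I, J ⊆ Fin n: (⨅_{i∈I} H i) ⊓ (⨅_{j∈J} H j) = c ⊔ ( (⨅_{i∈I} H' i) ⊓ (⨅_{j∈J} H' j) ), and (⨅_{i∈I} H i) ⊔ (⨅_{j∈J} H j) = c ⊔ ( (⨅_{i∈I} H' i) ⊔ (⨅_{j∈J} H' j) ). (Paper's Lemma 2.7 'int join *', as established in its proof: H_I ∧ H_J = c_{[n]} ∨ (H_I' ∧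 H_J') and H_I ∨ H_J = c_{[n]} ∨ (H_I' ∨ H_J').) -/
open Module

/-- In a modular lattice, an element `a` above `c` is recovered from its trace on any `e`
codisjoint from `c`. -/
theorem sup_inf_eq_of_le_of_sup_eq_top_s11 {α : Type*} [Lattice α] [BoundedOrder α]
    [IsModularLattice α] {a c e : α} (hca : c ≤ a) (hce : c ⊔ e = ⊤) : c ⊔ a ⊓ e = a := by
  rw [inf_comm, ← sup_inf_assoc_of_le e hca, hce, top_inf_eq]

/-- **Paper's Lemma 2.7 "int join *"**: with `c = ⨅ i, C i`, `E` a complement of `c`,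
and `H' i = H i ⊓ E`, one has `H_I ⊓ H_J = c ⊔ (H'_I ⊓ H'_J)` and
`H_I ⊔ H_J = c ⊔ (H'_I ⊔ H'_J)` for all nonempty `I, J ⊆ [n]`. -/
theorem int_join_star (N n : ℕ) (hn : 1 ≤ n)
    (C H : Fin n → Submodule ℂ (Fin (N + 1) → ℂ))
    (hCH : ∀ i, C i ≤ H i)
    (E : Submodule ℂ (Fin (N + 1) → ℂ))
    (hE₁ : (⨅ i, C i) ⊓ E = ⊥) (hE₂ : (⨅ i, C i) ⊔ E = ⊤) :
    ∀ I J : Finset (Fin n), I.Nonempty → J.Nonempty →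
      ((⨅ i ∈ I, H i) ⊓ (⨅ j ∈ J, H j) =
        (⨅ i, C i) ⊔ ((⨅ i ∈ I, H i ⊓ E) ⊓ (⨅ j ∈ J, H j ⊓ E))) ∧
      ((⨅ i ∈ I, H i) ⊔ (⨅ j ∈ J, H j) =
        (⨅ i, C i) ⊔ ((⨅ i ∈ I, H i ⊓ E) ⊔ (⨅ j ∈ J, H j ⊓ E))) := by
  intro I J hI hJ
  have hle (K : Finset (Fin n)) : ⨅ i, C i ≤ ⨅ i ∈ K, H i :=
    le_iInf₂ fun i _ => (iInf_le C i).trans (hCH i)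
  rw [← biInf_inf hI, ← biInf_inf hJ]
  constructor
  · rw [← inf_inf_distrib_right,
      sup_inf_eq_of_le_of_sup_eq_top_s11 (le_inf (hle I) (hle J)) hE₂]
  · rw [sup_sup_distrib_left, sup_inf_eq_of_le_of_sup_eq_top_s11 (hle I) hE₂,
      sup_inf_eq_of_le_of_sup_eq_top_s11 (hle J) hE₂]
end

section
/- Let k ≤ N, n ≥ 2, and let C 1, …, C n be submodules of V = Fin (N+1) → ℂ with finrank (C i) ≤ N − k for all i. Then there exists a submodule H of V with C n ≤ H and finrank H = finrank (C n) + k + 1 such that for every m : ℕ, m is the least element of S := { finrank (⨅_{i=1}^{n} (C i ⊔ P)) | finrank P = k+1, P ⊓ C i = ⊥ for all i = 1,…,n } if and only if m is the least element of S' := { finrank (⨅_{i=1}^{n−1} ((C i ⊓ H) ⊔ P)) | P ≤ H, finrank P = k+1, P ⊓ C i = ⊥ for all i = 1,…,n−1 }. (Paper's Lemma 'lck lcprimk': for a generic back-projected plane H_n through c_n, the arrangement c' = (c_1 ∧ H_n, …, c_{n−1} ∧ H_n) inside H_n satisfies ℓ_{c,k} = ℓ_{c',k}; genericity is rendered as existence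 of such an H_n.) -/
open Module

/-- Injectivity is a generic condition in a pencil of linear maps. -/
theorem finite_setOf_not_injective_add_smul {K W F : Type*} [Field K] [AddCommGroup W]
    [Module K W] [FiniteDimensional K W] [AddCommGroup F] [Module K F] (A B : W →ₗ[K] F)
    (hA : Function.Injective A) : {t : K | ¬ Function.Injective (A + t • B)}.Finite := by
  obtain ⟨G, hG⟩ := A.exists_leftInverse_of_injective (LinearMap.ker_eq_bot.2 hA)
  have hfin : {μ : K | End.HasEigenvalue (G ∘ₗ B) μ}.Finite := End.finite_hasEigenvalue _
  refine (hfin.preimage (f := fun t : K => -t⁻¹) ?_).subset ?_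
  · intro s _ t _ h
    simpa using h
  · intro t ht
    simp only [Set.mem_ofPred_eq, ← LinearMap.ker_eq_bot, Submodule.ne_bot_iff] at ht
    obtain ⟨u, hu, hu0⟩ := ht
    have h : u + t • G (B u) = 0 := by
      have h := congrArg G (LinearMap.mem_ker.1 hu)
      have hGA : G (A u) = u := LinearMap.congr_fun hG u
      simpa [hGA] using h
    have ht0 : t ≠ 0 := by
      rintro rfl
      exact hu0 (by simpa using h)
    refine End.hasEigenvalue_of_hasEigenvector (x := u) ⟨End.mem_eigenspace_iff.2 ?_, hu0⟩
    have h' : t • G (B u) = -u := eq_neg_of_add_eq_zero_right h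
    rw [LinearMap.comp_apply, neg_smul, ← smul_neg, ← h', inv_smul_smul₀ ht0]

/-- Injectivity of the member at infinity of a pencil implies injectivity of the generic one. -/
theorem finite_setOf_not_injective_add_smul' {K W F : Type*} [Field K] [AddCommGroup W]
    [Module K W] [FiniteDimensional K W] [AddCommGroup F] [Module K F] (A B : W →ₗ[K] F)
    (hB : Function.Injective B) : {t : K | ¬ Function.Injective (A + t • B)}.Finite := by
  refine (((finite_setOf_not_injective_add_smul B A hB).preimage (f := fun t : K => t⁻¹)
    inv_injective.injOn).union (Set.finite_singleton 0)).subset ?_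
  intro t ht
  by_cases ht0 : t = 0
  · exact Or.inr ht0
  refine Or.inl fun hinj => ht ?_
  have h : ⇑(A + t • B) = fun x => t • (B + t⁻¹ • A) x := by
    ext x
    simp [smul_smul, ht0, add_comm]
  rw [h]
  exact (smul_right_injective F ht0).comp hinj

/-- The dimension of the kernel is upper semicontinuous in a pencil of linear maps. -/
theorem finite_setOf_finrank_ker_lt {K E F : Type*} [Field K] [AddCommGroup E]
    [Module K E] [FiniteDimensional K E] [AddCommGroup F] [Module K F] (A B : E →ₗ[K] F) :
    {t : K | finrank K (LinearMap.ker A) <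
      finrank K (LinearMap.ker (A + t • B))}.Finite := by
  obtain ⟨U, hU⟩ := (LinearMap.ker A).exists_isCompl
  have hinj : Function.Injective (A ∘ₗ U.subtype) := by
    rw [← LinearMap.ker_eq_bot, LinearMap.ker_comp, ← Submodule.disjoint_iff_comap_eq_bot]
    exact hU.disjoint.symm
  refine (finite_setOf_not_injective_add_smul _ (B ∘ₗ U.subtype) hinj).subset fun t ht h => ?_
  have hdisj : Disjoint U (LinearMap.ker (A + t • B)) := by
    rw [Submodule.disjoint_iff_comap_eq_bot, ← LinearMap.ker_comp, LinearMap.ker_eq_bot]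
    exact h
  have h1 := Submodule.finrank_add_finrank_le_of_disjoint hdisj
  have h2 := Submodule.finrank_add_eq_of_isCompl hU
  simp only [Set.mem_ofPred_eq] at ht
  omega

theorem injective_mkQ_comp_iff {K V W : Type*} [Field K] [AddCommGroup V] [Module K V]
    [AddCommGroup W] [Module K W] (C : Submodule K V) (p : W →ₗ[K] V) :
    Function.Injective (C.mkQ ∘ₗ p) ↔
      Function.Injective p ∧ LinearMap.range p ⊓ C = ⊥ := by
  constructor
  · intro h
    refine ⟨Function.Injective.of_comp h, ?_⟩
    rw [Submodule.eq_bot_iff]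
    rintro _ ⟨⟨w, rfl⟩, hw⟩
    have : w = 0 := h (by simpa using hw)
    simp [this]
  · rintro ⟨hp, hC⟩
    rw [← LinearMap.ker_eq_bot, Submodule.eq_bot_iff]
    intro w hw
    have hw' : p w ∈ LinearMap.range p ⊓ C := ⟨⟨w, rfl⟩, by simpa using hw⟩
    rw [hC, Submodule.mem_bot] at hw'
    exact hp (by simpa using hw')

section JoinKernel

variable {K V W ι : Type*} [Field K] [AddCommGroup V] [Module K V] [AddCommGroup W] [Module K W]

/-- The linear map sending `(x, (dᵢ, wᵢ)ᵢ)` to `(x - dᵢ - p wᵢ)ᵢ`, whose kernel parametrizes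
`⨅ i, D i ⊔ range p`. -/
def joinMap (D : ι → Submodule K V) (p : W →ₗ[K] V) :
    (V × ((i : ι) → D i × W)) →ₗ[K] (ι → V) :=
  LinearMap.pi fun i => LinearMap.fst K V _ -
    ((D i).subtype.coprod p) ∘ₗ LinearMap.proj i ∘ₗ LinearMap.snd K V ((i : ι) → D i × W)

theorem mem_ker_joinMap (D : ι → Submodule K V) (p : W →ₗ[K] V)
    (e : V × ((i : ι) → D i × W)) :
    e ∈ LinearMap.ker (joinMap D p) ↔ ∀ i, e.1 = (e.2 i).1 + p (e.2 i).2 := by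
  simp [joinMap, funext_iff, sub_eq_zero]

theorem map_fst_ker_joinMap (D : ι → Submodule K V) (p : W →ₗ[K] V) :
    (LinearMap.ker (joinMap D p)).map (LinearMap.fst K V _) =
      ⨅ i, D i ⊔ LinearMap.range p := by
  ext x
  simp only [Submodule.mem_map, mem_ker_joinMap, Submodule.mem_iInf, Submodule.mem_sup]
  constructor
  · rintro ⟨e, he, rfl⟩ i
    exact ⟨_, (e.2 i).1.2, _, ⟨(e.2 i).2, rfl⟩, (he i).symm⟩
  · intro h
    choose d hd y hy hx using h
    choose w hw using hy
    refine ⟨(x, fun i => (⟨d i, hd i⟩, w i)), fun i => ?_, rfl⟩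
    simp [hw, hx]

theorem finrank_ker_joinMap_le [FiniteDimensional K V] (D : ι → Submodule K V) (p : W →ₗ[K] V)
    (hp : Function.Injective p) (hD : ∀ i, LinearMap.range p ⊓ D i = ⊥) :
    finrank K (LinearMap.ker (joinMap D p)) ≤
      finrank K ↥(⨅ i, D i ⊔ LinearMap.range p) := by
  rw [← map_fst_ker_joinMap, ← LinearMap.range_domRestrict, LinearMap.finrank_range_of_inj]
  rw [← LinearMap.ker_eq_bot, Submodule.eq_bot_iff]
  rintro ⟨e, he⟩ hx
  rw [mem_ker_joinMap] at he
  replace hx : e.1 = 0 := by simpa using hx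
  have key (i : ι) : e.2 i = 0 := by
    have h : ((e.2 i).1 : V) + p (e.2 i).2 = 0 := by rw [← he i, hx]
    have hmem : p (e.2 i).2 ∈ LinearMap.range p ⊓ D i :=
      ⟨⟨_, rfl⟩, by rw [eq_neg_of_add_eq_zero_right h]; exact (D i).neg_mem (e.2 i).1.2⟩
    rw [hD i, Submodule.mem_bot] at hmem
    refine Prod.ext (Subtype.ext ?_) (hp (by simpa using hmem))
    simpa [hmem] using h
  exact Subtype.ext (Prod.ext hx (funext key))

/-- The dimension of an intersection of joins is upper semicontinuous in a pencil. -/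
theorem finite_setOf_finrank_iInf_sup_range_lt [Finite ι] [FiniteDimensional K V]
    [FiniteDimensional K W] (D : ι → Submodule K V) (a b : W →ₗ[K] V)
    (ha : Function.Injective a) (hD : ∀ i, LinearMap.range a ⊓ D i = ⊥) :
    {t : K | finrank K ↥(⨅ i, D i ⊔ LinearMap.range a) <
      finrank K ↥(⨅ i, D i ⊔ LinearMap.range (a + t • b))}.Finite := by
  have h := finite_setOf_finrank_ker_lt (joinMap D a)
    (LinearMap.pi fun i => -(b ∘ₗ LinearMap.snd K (D i) W ∘ₗ LinearMap.proj i ∘ₗ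
      LinearMap.snd K V ((i : ι) → D i × W)))
  refine h.subset fun t ht => ?_
  have hpencil : joinMap D a + t • (LinearMap.pi fun i => -(b ∘ₗ LinearMap.snd K (D i) W ∘ₗ
      LinearMap.proj i ∘ₗ LinearMap.snd K V ((i : ι) → D i × W))) = joinMap D (a + t • b) := by
    refine LinearMap.ext fun e => funext fun i => ?_
    simp [joinMap]
    abel
  simp only [Set.mem_ofPred_eq] at ht ⊢
  rw [hpencil]
  refine (finrank_ker_joinMap_le D a ha hD).trans_lt (ht.trans_le ?_)
  rw [← map_fst_ker_joinMap]
  exact Submodule.finrank_map_le _ _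

end JoinKernel

/-- Finitely many subspaces of codimension at least `d` have a common transversal of
dimension `d`. -/
theorem exists_finrank_eq_forall_inf_eq_bot {K V ι : Type*} [Field K] [Infinite K]
    [AddCommGroup V] [Module K V] [FiniteDimensional K V] [Finite ι] (C : ι → Submodule K V)
    (d : ℕ) (hd : d ≤ finrank K V) (hC : ∀ i, finrank K (C i) + d ≤ finrank K V) :
    ∃ P : Submodule K V, finrank K P = d ∧ ∀ i, P ⊓ C i = ⊥ := by
  induction d with
  | zero => exact ⟨⊥, by simp, by simp⟩
  | succ d ih =>
    obtain ⟨P, hP, hPC⟩ := ih (by omega) fun i => by have := hC i; omega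
    have hlt (i : Option ι) : i.elim P (fun i => C i ⊔ P) ≠ ⊤ := by
      intro h
      cases i with
      | none =>
        have h1 : finrank K P = finrank K V := by rw [show P = ⊤ from h, finrank_top]
        omega
      | some i =>
        have h1 : finrank K ↥(C i ⊔ P) = finrank K V := by
          rw [show C i ⊔ P = ⊤ from h, finrank_top]
        have h2 := Submodule.finrank_add_le_finrank_add_finrank (C i) P
        have h3 := hC i
        omega
    obtain ⟨v, hv⟩ : ∃ v, ∀ i : Option ι, v ∉ i.elim P (fun i => C i ⊔ P) := by
      by_contra! h
      obtain ⟨i, hi⟩ := Subspace.exists_eq_top_of_iUnion_eq_univ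
        (p := fun i : Option ι => i.elim P (fun i => C i ⊔ P))
        (Set.eq_univ_of_forall fun v => Set.mem_iUnion.2 (h v))
      exact hlt i hi
    have hvP : v ∉ P := hv none
    refine ⟨P ⊔ K ∙ v, ?_, fun i => ?_⟩
    · rw [Submodule.finrank_sup_span_singleton hvP, hP]
    · rw [Submodule.eq_bot_iff]
      rintro x ⟨hx, hxC⟩
      obtain ⟨p, hp, c, rfl⟩ : ∃ p ∈ P, ∃ c : K, p + c • v = x := by
        simpa [Submodule.mem_sup, Submodule.mem_span_singleton] using hx
      by_cases hc : c = 0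
      · subst hc
        rw [zero_smul, add_zero] at hxC ⊢
        exact (Submodule.eq_bot_iff _).1 (hPC i) p ⟨hp, hxC⟩
      · refine absurd ?_ (hv (some i))
        have hmem : p + c • v - p ∈ C i ⊔ P :=
          sub_mem (Submodule.mem_sup_left hxC) (Submodule.mem_sup_right hp)
        rw [add_sub_cancel_left] at hmem
        exact (Submodule.smul_mem_iff _ hc).1 hmem

/-- A subspace can be moved inside `H`, along a pencil, off finitely many given subspaces
without increasing the dimension of an intersection of joins. -/
theorem exists_finrank_iInf_sup_le {K V ι κ : Type*} [Field K] [Infinite K] [AddCommGroup V]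
    [Module K V] [FiniteDimensional K V] [Finite ι] [Finite κ] (D : ι → Submodule K V)
    (C : κ → Submodule K V) (H P₀ P₁ : Submodule K V) (h₀ : P₀ ≤ H) (h₁ : P₁ ≤ H)
    (hdim : finrank K P₁ = finrank K P₀) (hC : ∀ j, P₀ ⊓ C j = ⊥) (hD : ∀ i, P₁ ⊓ D i = ⊥) :
    ∃ P ≤ H, finrank K P = finrank K P₀ ∧ (∀ j, P ⊓ C j = ⊥) ∧
      finrank K ↥(⨅ i, D i ⊔ P) ≤ finrank K ↥(⨅ i, D i ⊔ P₁) := by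
  let φ : P₁ ≃ₗ[K] P₀ := LinearEquiv.ofFinrankEq _ _ hdim
  let a : P₁ →ₗ[K] V := P₁.subtype
  let b : P₁ →ₗ[K] V := P₀.subtype ∘ₗ φ.toLinearMap
  have hra : LinearMap.range a = P₁ := P₁.range_subtype
  have hrb : LinearMap.range b = P₀ := by
    rw [LinearMap.range_comp_of_range_eq_top _ φ.range, P₀.range_subtype]
  have ha : Function.Injective a := P₁.subtype_injective
  have hb : Function.Injective b := P₀.subtype_injective.comp φ.injective
  have hfin₁ := finite_setOf_finrank_iInf_sup_range_lt D a b ha (by rwa [hra])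
  have hfin₂ := finite_setOf_not_injective_add_smul a b ha
  have hfin₃ (j : κ) := finite_setOf_not_injective_add_smul' ((C j).mkQ ∘ₗ a) ((C j).mkQ ∘ₗ b)
    ((injective_mkQ_comp_iff _ _).2 ⟨hb, by rw [hrb, hC]⟩)
  obtain ⟨t, ht⟩ := ((hfin₁.union hfin₂).union (Set.finite_iUnion hfin₃)).exists_notMem
  simp only [Set.mem_union, Set.mem_iUnion, Set.mem_ofPred_eq, not_or, not_exists, not_not,
    not_lt] at ht
  obtain ⟨⟨hle, hinj⟩, htC⟩ := ht
  refine ⟨LinearMap.range (a + t • b), ?_, ?_, fun j => ?_, by rwa [hra] at hle⟩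
  · rintro _ ⟨w, rfl⟩
    exact H.add_mem (h₁ w.2) (H.smul_mem t (h₀ (φ w).2))
  · rw [LinearMap.finrank_range_of_inj hinj, hdim]
  · refine ((injective_mkQ_comp_iff _ _).1 ?_).2
    rw [LinearMap.comp_add, LinearMap.comp_smul]
    exact htC j

theorem iInf_inf_sup_eq_of_inf_last_eq_bot {K V : Type*} [Field K] [AddCommGroup V] [Module K V]
    [FiniteDimensional K V] {n : ℕ} (hn : 1 ≤ n) (C : Fin (n + 1) → Submodule K V)
    (H P : Submodule K V) (hCH : C (Fin.last n) ≤ H) (hPH : P ≤ H)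
    (hdim : finrank K H = finrank K (C (Fin.last n)) + finrank K P)
    (hP : P ⊓ C (Fin.last n) = ⊥) :
    ⨅ i : Fin n, (C i.castSucc ⊓ H) ⊔ P = ⨅ i, C i ⊔ P := by
  have : Nonempty (Fin n) := ⟨⟨0, hn⟩⟩
  have hH : C (Fin.last n) ⊔ P = H := by
    refine Submodule.eq_of_le_of_finrank_le (sup_le hCH hPH) ?_
    have := Submodule.finrank_sup_add_finrank_inf_eq (C (Fin.last n)) P
    rw [inf_comm, hP, finrank_bot] at this
    omega
  have hmod (i : Fin n) : (C i.castSucc ⊓ H) ⊔ P = (C i.castSucc ⊔ P) ⊓ H := by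
    rw [sup_comm, ← sup_inf_assoc_of_le _ hPH, sup_comm P]
  simp_rw [hmod]
  rw [← iInf_inf]
  refine le_antisymm (le_iInf fun i => ?_) (le_inf (le_iInf fun i => iInf_le _ _) ?_)
  · refine Fin.lastCases ?_ (fun j => ?_) i
    · exact inf_le_right.trans hH.ge
    · exact inf_le_left.trans (iInf_le _ j)
  · exact (iInf_le _ (Fin.last n)).trans hH.le

/-- **Paper's Lemma "lck lcprimk"**: for an arrangement of `n + 1 ≥ 2` centers
`C 0, …, C n` (the last one being `C (Fin.last n)`), there exists a (generic)
back-projected plane `H` through the last center such that the invariant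
`ℓ_{c,k} + 1` (least element of `S`) agrees with the invariant `ℓ_{c',k} + 1`
(least element of `S'`) of the arrangement `c' = (C i ⊓ H)` of the first `n`
centers cut down to `H`. -/
theorem lck_lcprimk (N k n : ℕ) (hk : k ≤ N) (hn : 1 ≤ n)
    (C : Fin (n + 1) → Submodule ℂ (Fin (N + 1) → ℂ))
    (hC : ∀ i, finrank ℂ ↥(C i) ≤ N - k) :
    ∃ H : Submodule ℂ (Fin (N + 1) → ℂ),
      C (Fin.last n) ≤ H ∧
      finrank ℂ ↥H = finrank ℂ ↥(C (Fin.last n)) + k + 1 ∧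
      ∀ m : ℕ,
        IsLeast
          { r : ℕ | ∃ P : Submodule ℂ (Fin (N + 1) → ℂ),
              finrank ℂ ↥P = k + 1 ∧ (∀ i : Fin (n + 1), P ⊓ C i = ⊥) ∧
              r = finrank ℂ ↥(⨅ i : Fin (n + 1), C i ⊔ P) } m ↔
        IsLeast
          { r : ℕ | ∃ P : Submodule ℂ (Fin (N + 1) → ℂ),
              P ≤ H ∧ finrank ℂ ↥P = k + 1 ∧
              (∀ i : Fin n, P ⊓ C i.castSucc = ⊥) ∧
              r = finrank ℂ ↥(⨅ i : Fin n, (C i.castSucc ⊓ H) ⊔ P) } m := by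
  have hV : finrank ℂ (Fin (N + 1) → ℂ) = N + 1 := by simp
  obtain ⟨Q, hQ, hQC⟩ := exists_finrank_eq_forall_inf_eq_bot C (k + 1) (by omega)
    fun i => by have := hC i; omega
  obtain ⟨r₀, hS⟩ : ∃ r, IsLeast { r : ℕ | ∃ P : Submodule ℂ (Fin (N + 1) → ℂ),
      finrank ℂ ↥P = k + 1 ∧ (∀ i : Fin (n + 1), P ⊓ C i = ⊥) ∧
      r = finrank ℂ ↥(⨅ i : Fin (n + 1), C i ⊔ P) } r := by
    refine ⟨_, Nat.sInf_mem ?_, fun _ h => Nat.sInf_le h⟩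
    exact ⟨_, Q, hQ, hQC, rfl⟩
  obtain ⟨⟨P₀, hP₀, hP₀C, hr₀⟩, hmin⟩ := id hS
  have hH : finrank ℂ ↥(C (Fin.last n) ⊔ P₀) = finrank ℂ ↥(C (Fin.last n)) + k + 1 := by
    have := Submodule.finrank_sup_add_finrank_inf_eq (C (Fin.last n)) P₀
    rw [inf_comm, hP₀C, finrank_bot] at this
    omega
  refine ⟨C (Fin.last n) ⊔ P₀, le_sup_left, hH, fun m => ?_⟩
  have hS' : IsLeast { r : ℕ | ∃ P : Submodule ℂ (Fin (N + 1) → ℂ),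
      P ≤ C (Fin.last n) ⊔ P₀ ∧ finrank ℂ ↥P = k + 1 ∧
      (∀ i : Fin n, P ⊓ C i.castSucc = ⊥) ∧
      r = finrank ℂ ↥(⨅ i : Fin n, (C i.castSucc ⊓ (C (Fin.last n) ⊔ P₀)) ⊔ P) } r₀ := by
    refine ⟨⟨P₀, le_sup_right, hP₀, fun i => hP₀C _, ?_⟩, ?_⟩
    · rw [iInf_inf_sup_eq_of_inf_last_eq_bot hn C _ _ le_sup_left le_sup_right (by omega)
        (hP₀C _), hr₀]
    · rintro _ ⟨P₁, hP₁H, hP₁, hP₁C, rfl⟩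
      obtain ⟨P, hPH, hP, hPC, hle⟩ := exists_finrank_iInf_sup_le
        (fun i : Fin n => C i.castSucc ⊓ (C (Fin.last n) ⊔ P₀)) C _ P₀ P₁ le_sup_right hP₁H
        (by omega) hP₀C fun i => by rw [← inf_assoc, hP₁C, bot_inf_eq]
      rw [iInf_inf_sup_eq_of_inf_last_eq_bot hn C _ P le_sup_left hPH (by omega) (hPC _)] at hle
      exact (hmin ⟨P, hP.trans hP₀, hPC, rfl⟩).trans hle
  exact ⟨fun h => h.unique hS ▸ hS', fun h => h.unique hS' ▸ hS⟩
end
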